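/- For every integer t there exists an integer τ = τ(t) such that the following holds: if G ∈ C_tt, S is a minimal separator of G, and Y ⊆ S ∖ Hub(G) is a stable set, then |Y| ≤ τ. -/

import Mathlib

open Set

/-- `f` enumerates an induced path on `n` vertices in `G`. -/
def IsPathEmb {α : Type} (G : SimpleGraph α) (n : ℕ) (f : Fin n → α) : Prop :=
  Function.Injective f ∧
    ∀ i j : Fin n, G.Adj (f i) (f j) ↔ (i.val = j.val + 1 ∨ j.val = i.val + 1)

/-- `f` enumerates an induced path from `a` to `b`. -/
def IsPathFromTo {α : Type} (G : SimpleGraph α) (n : ℕ) (f : Fin n → α) (a b : α) : Prop :=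
  IsPathEmb G n f ∧ ∃ h : 1 ≤ n, f ⟨0, h⟩ = a ∧ f ⟨n - 1, by omega⟩ = b

/-- The interior (internal vertices) of the path enumerated by `f`. -/
def pathInterior {α : Type} (n : ℕ) (f : Fin n → α) : Set α :=
  {v | ∃ j : Fin n, 0 < j.val ∧ j.val < n - 1 ∧ f j = v}

/-- `k` pairwise internally vertex-disjoint induced paths from `a` to `b` in `G`. -/
def KDisjointPaths {α : Type} (G : SimpleGraph α) (k : ℕ) (a b : α) : Prop :=
  ∃ (n : Fin k → ℕ) (f : ∀ i, Fin (n i) → α),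
    (∀ i, IsPathFromTo G (n i) (f i) a b) ∧
    (∀ i j, i ≠ j → Disjoint (pathInterior (n i) (f i)) (pathInterior (n j) (f j)))

/-- `f` enumerates an induced cycle on `n` vertices. -/
def IsHoleEmb {α : Type} (G : SimpleGraph α) (n : ℕ) (f : ZMod n → α) : Prop :=
  Function.Injective f ∧ ∀ i j : ZMod n, G.Adj (f i) (f j) ↔ (i = j + 1 ∨ j = i + 1)

/-- `H` is the vertex set of a hole of `G` (an induced cycle with at least 4 vertices). -/
def IsHole {α : Type} (G : SimpleGraph α) (H : Set α) : Prop :=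
  ∃ (n : ℕ) (f : ZMod n → α), 4 ≤ n ∧ IsHoleEmb G n f ∧ Set.range f = H

/-- `G` has no even hole. -/
def EvenHoleFree {α : Type} (G : SimpleGraph α) : Prop :=
  ∀ H : Set α, IsHole G H → ¬ Even H.ncard

def Anticomplete {α : Type} (G : SimpleGraph α) (A B : Set α) : Prop :=
  ∀ a ∈ A, ∀ b ∈ B, ¬ G.Adj a b

/-- `X` is a stable (independent) set of `G`. -/
def StableSet {α : Type} (G : SimpleGraph α) (X : Set α) : Prop :=
  ∀ a ∈ X, ∀ b ∈ X, a ≠ b → ¬ G.Adj a b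

/-- The open neighborhood of the set `A`. -/
def setNbhd {α : Type} (G : SimpleGraph α) (A : Set α) : Set α :=
  {v | v ∉ A ∧ ∃ a ∈ A, G.Adj v a}

/-- The set `A` induces a connected (nonempty) subgraph of `G`. -/
def ConnSet {α : Type} (G : SimpleGraph α) (A : Set α) : Prop :=
  (G.induce A).Connected

/-- `D` is a connected component of the subgraph of `G` induced by `S`. -/
def IsCompOf {α : Type} (G : SimpleGraph α) (S D : Set α) : Prop :=
  D ⊆ S ∧ ConnSet G D ∧ ∀ D', D ⊆ D' → D' ⊆ S → ConnSet G D' → D' = D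

/-- `G` contains an (induced) theta. -/
def HasTheta {α : Type} (G : SimpleGraph α) : Prop :=
  ∃ (a b : α) (n : Fin 3 → ℕ) (f : ∀ i, Fin (n i) → α),
    a ≠ b ∧ ¬ G.Adj a b ∧ (∀ i, 3 ≤ n i) ∧
    (∀ i, IsPathFromTo G (n i) (f i) a b) ∧
    (∀ i j : Fin 3, i ≠ j → ∀ (u : Fin (n i)) (v : Fin (n j)),
      0 < u.val → u.val < n i - 1 → 0 < v.val → v.val < n j - 1 →
      f i u ≠ f j v ∧ ¬ G.Adj (f i u) (f j v))

/-- `G` contains an (induced) prism. -/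
def HasPrism {α : Type} (G : SimpleGraph α) : Prop :=
  ∃ (n : Fin 3 → ℕ) (f : ∀ i, Fin (n i) → α),
    (∀ i, 2 ≤ n i) ∧ (∀ i, IsPathEmb G (n i) (f i)) ∧
    (∀ i j : Fin 3, i ≠ j → ∀ u v, f i u ≠ f j v) ∧
    (∀ i j : Fin 3, i ≠ j → ∀ (u : Fin (n i)) (v : Fin (n j)),
      G.Adj (f i u) (f j v) ↔
        ((u.val = 0 ∧ v.val = 0) ∨ (u.val = n i - 1 ∧ v.val = n j - 1)))

/-- The neighbors of `x` in the hole `H`. -/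
def holeNbrs {α : Type} (G : SimpleGraph α) (H : Set α) (x : α) : Set α :=
  {v ∈ H | G.Adj x v}

def IsWheel {α : Type} (G : SimpleGraph α) (H : Set α) (x : α) : Prop :=
  IsHole G H ∧ x ∉ H ∧ 3 ≤ (holeNbrs G H x).ncard

def IsTwinWheel {α : Type} (G : SimpleGraph α) (H : Set α) (x : α) : Prop :=
  IsWheel G H x ∧ ∃ p q r : α, p ≠ q ∧ q ≠ r ∧ p ≠ r ∧
    holeNbrs G H x = {p, q, r} ∧ G.Adj p q ∧ G.Adj q r ∧ ¬ G.Adj p r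

def IsShortPyramid {α : Type} (G : SimpleGraph α) (H : Set α) (x : α) : Prop :=
  IsWheel G H x ∧ ∃ p q r : α, p ≠ q ∧ q ≠ r ∧ p ≠ r ∧
    holeNbrs G H x = {p, q, r} ∧ G.Adj p q ∧ ¬ G.Adj q r ∧ ¬ G.Adj p r

def IsProperWheel {α : Type} (G : SimpleGraph α) (H : Set α) (x : α) : Prop :=
  IsWheel G H x ∧ ¬ IsTwinWheel G H x ∧ ¬ IsShortPyramid G H x

/-- `x` is a hub of the induced subgraph `G[W]`. -/
def IsHubIn {α : Type} (G : SimpleGraph α) (W : Set α) (x : α) : Prop :=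
  x ∈ W ∧ ∃ H : Set α, H ⊆ W ∧ IsProperWheel G H x

/-- `x` is a hub of `G`: the center of some proper wheel. -/
def IsHub {α : Type} (G : SimpleGraph α) (x : α) : Prop :=
  ∃ H : Set α, IsProperWheel G H x

/-- membership in the class `𝒞` of (C₄, theta, prism, even wheel)-free graphs. -/
def MemC {α : Type} (G : SimpleGraph α) : Prop :=
  (∀ H : Set α, IsHole G H → H.ncard ≠ 4) ∧ ¬ HasTheta G ∧ ¬ HasPrism G ∧
    (∀ (H : Set α) (x : α), IsWheel G H x → ¬ Even (holeNbrs G H x).ncard)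

/-- membership in the class `𝒞ₜ`: graphs in `𝒞` with no clique of size `t`. -/
def MemCt {α : Type} (t : ℕ) (G : SimpleGraph α) : Prop :=
  MemC G ∧ G.CliqueFree t

/-- `G` contains a generalized `k`-pyramid as an induced subgraph. -/
def ContainsGenPyramid {α : Type} (G : SimpleGraph α) (k : ℕ) : Prop :=
  ∃ (nP nQ : ℕ) (P : Fin nP → α) (Q : Fin nQ → α)
    (m : Fin k → ℕ) (R : ∀ i, Fin (m i) → α) (xI zI : Fin k → ℕ),
    4 ≤ nP + nQ ∧ 1 ≤ nP ∧ 1 ≤ nQ ∧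
    IsPathEmb G nP P ∧ IsPathEmb G nQ Q ∧
    (∀ i j, P i ≠ Q j) ∧
    (∀ (i : Fin nP) (j : Fin nQ), G.Adj (P i) (Q j) ↔
      ((i.val = 0 ∧ j.val = 0) ∨ (i.val = nP - 1 ∧ j.val = nQ - 1))) ∧
    (∀ i, 1 ≤ m i) ∧ (∀ i, IsPathEmb G (m i) (R i)) ∧
    (∀ i u j, R i u ≠ P j) ∧ (∀ i u j, R i u ≠ Q j) ∧
    (∀ i i', i ≠ i' → ∀ u u', R i u ≠ R i' u' ∧ ¬ G.Adj (R i u) (R i' u')) ∧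
    (∀ i, 0 < xI i ∧ xI i + 1 < nP - 1) ∧
    (∀ (i : Fin k) (u : Fin (m i)) (j : Fin nP), G.Adj (R i u) (P j) ↔
      (u.val = 0 ∧ (j.val = xI i ∨ j.val = xI i + 1))) ∧
    (∀ i, zI i < nQ) ∧
    (∀ (i : Fin k) (u : Fin (m i)) (j : Fin nQ), G.Adj (R i u) (Q j) ↔
      (u.val = m i - 1 ∧ j.val = zI i)) ∧
    (∀ i i' : Fin k, i < i' → xI i + 1 < xI i') ∧
    (∀ i i' : Fin k, i ≤ i' → zI i ≤ zI i')

/-- membership in the class `𝒞ₜₜ`: graphs in `𝒞ₜ` with no induced generalized `t`-pyramid. -/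
def MemCtt {α : Type} (t : ℕ) (G : SimpleGraph α) : Prop :=
  MemCt t G ∧ ¬ ContainsGenPyramid G t

/-- `(T, χ)` is a tree decomposition of `G`. -/
structure IsTD {α ι : Type} (G : SimpleGraph α) (T : SimpleGraph ι) (χ : ι → Set α) : Prop where
  finite : Finite ι
  isTree : T.IsTree
  memBag : ∀ v : α, ∃ t, v ∈ χ t
  edgeBag : ∀ ⦃u v : α⦄, G.Adj u v → ∃ t, u ∈ χ t ∧ v ∈ χ t
  subtree : ∀ v : α, (T.induce {t | v ∈ χ t}).Connected

/-- `G` has a tree decomposition of width at most `w`. -/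
def TwLE {α : Type} (G : SimpleGraph α) (w : ℕ) : Prop :=
  ∃ (ι : Type) (T : SimpleGraph ι) (χ : ι → Set α),
    IsTD G T χ ∧ ∀ t, (χ t).ncard ≤ w + 1

/-- The treewidth of `G`. -/
noncomputable def treeWidth {α : Type} (G : SimpleGraph α) : ℕ :=
  sInf {w | TwLE G w}

/-- For adjacent `t, t'` in a tree `T`, the vertex set of the component of `T - t`
containing `t'`. -/
def branchSet {ι : Type} (T : SimpleGraph ι) (t t' : ι) : Set ι :=
  {s | ∀ w : T.Walk s t, t' ∈ w.support}

/-- The vertex set of `G_{t → t'}`: the union of the bags over the component of `T - t`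
containing `t'`. -/
def sideSet {α ι : Type} (T : SimpleGraph ι) (χ : ι → Set α) (t t' : ι) : Set α :=
  ⋃ s ∈ branchSet T t t', χ s

/-- `(T, χ)` is a tight tree decomposition of `G`. -/
def TightTD {α ι : Type} (G : SimpleGraph α) (T : SimpleGraph ι) (χ : ι → Set α) : Prop :=
  IsTD G T χ ∧ ∀ ⦃t t' : ι⦄, T.Adj t t' →
    ∃ D, IsCompOf G (sideSet T χ t t' \ χ t) D ∧ setNbhd G D = χ t ∩ χ t'

/-- `G` admits a clique cutset. -/
def HasCliqueCutset {α : Type} (G : SimpleGraph α) : Prop :=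
  ∃ C : Set α, G.IsClique C ∧ ¬ (G.induce (Set.univ \ C)).Preconnected

/-- `G` is chordal: it has no hole. -/
def ChordalG {α : Type} (G : SimpleGraph α) : Prop := ∀ H : Set α, ¬ IsHole G H

/-- `G'` is a minimal chordal completion of `G`. -/
def IsMinChordalCompletion {α : Type} (G G' : SimpleGraph α) : Prop :=
  G ≤ G' ∧ ChordalG G' ∧ ∀ G'', G ≤ G'' → G'' ≤ G' → ChordalG G'' → G'' = G'

/-- `Ω` is a potential maximal clique of `G` : a maximal clique of some minimal chordal
completion of `G`. -/
def IsPMC {α : Type} (G : SimpleGraph α) (Ω : Set α) : Prop :=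
  ∃ G' : SimpleGraph α, IsMinChordalCompletion G G' ∧ G'.IsClique Ω ∧
    ∀ Ω' : Set α, G'.IsClique Ω' → Ω ⊆ Ω' → Ω' = Ω

/-- `(T, χ)` is a structured tree decomposition: every bag is a PMC of `G`. -/
def StructuredTD {α ι : Type} (G : SimpleGraph α) (T : SimpleGraph ι) (χ : ι → Set α) : Prop :=
  IsTD G T χ ∧ ∀ t, IsPMC G (χ t)

/-- the decomposition has adhesion less than `m`. -/
def AdhLT {α ι : Type} (T : SimpleGraph ι) (χ : ι → Set α) (m : ℕ) : Prop :=
  ∀ ⦃t t' : ι⦄, T.Adj t t' → (χ t ∩ χ t').ncard < m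

/-- `fatness χ i` is the number of bags of size `i`. -/
noncomputable def fatness {α ι : Type} (χ : ι → Set α) (i : ℕ) : ℕ :=
  {t : ι | (χ t).ncard = i}.ncard

/-- Lexicographic comparison of fatness vectors `(aₙ, …, a₀)` (larger sizes more
significant). -/
def FatLexLE (f g : ℕ → ℕ) : Prop :=
  (∀ i, f i = g i) ∨ ∃ j, f j < g j ∧ ∀ i, j < i → f i = g i

/-- `(T, χ)` is an `m`-atomic tree decomposition of `G`: its adhesion is less than `m` and its
fatness is lexicographically minimum among all tree decompositions with adhesion less than `m`. -/
def IsAtomicTD {α ι : Type} (m : ℕ) (G : SimpleGraph α) (T : SimpleGraph ι)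
    (χ : ι → Set α) : Prop :=
  IsTD G T χ ∧ AdhLT T χ m ∧
    ∀ (ι' : Type) (T' : SimpleGraph ι') (χ' : ι' → Set α),
      IsTD G T' χ' → AdhLT T' χ' m → FatLexLE (fatness χ) (fatness χ')

/-- Adjacency in the torso at the node `x` of the tree decomposition. -/
def torsoAdj {α ι : Type} (G : SimpleGraph α) (T : SimpleGraph ι) (χ : ι → Set α)
    (x : ι) (u v : α) : Prop :=
  u ∈ χ x ∧ v ∈ χ x ∧ u ≠ v ∧
    (G.Adj u v ∨ ∃ y, T.Adj x y ∧ u ∈ χ y ∧ v ∈ χ y)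

/-- The degree of `u` in the torso at `x`. -/
noncomputable def torsoDeg {α ι : Type} (G : SimpleGraph α) (T : SimpleGraph ι)
    (χ : ι → Set α) (x : ι) (u : α) : ℕ :=
  {v | torsoAdj G T χ x u v}.ncard

/-- `u` and `v` lie in the same component of `G[S]`. -/
def SameComp {α : Type} (G : SimpleGraph α) (S : Set α) (u v : α) : Prop :=
  ∃ (hu : u ∈ S) (hv : v ∈ S), (G.induce S).Reachable ⟨u, hu⟩ ⟨v, hv⟩

/-- `X` is a minimal separator of `G`. -/
def IsMinimalSeparator {α : Type} (G : SimpleGraph α) (X : Set α) : Prop :=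
  ∃ u v : α, u ∉ X ∧ v ∉ X ∧ ¬ SameComp G (Set.univ \ X) u v ∧
    ∀ Y : Set α, Y ⊂ X → SameComp G (Set.univ \ Y) u v
/-- The degree of `v` in `H` (as the cardinality of its neighbor set). -/
noncomputable def degreeSet {α : Type} (H : SimpleGraph α) (v : α) : ℕ :=
  (H.neighborSet v).ncard

/-- `H` is a path (as a graph). -/
def IsPathGraph {α : Type} (H : SimpleGraph α) : Prop :=
  ∃ (n : ℕ) (f : Fin n → α), Function.Bijective f ∧
    ∀ i j, H.Adj (f i) (f j) ↔ (i.val = j.val + 1 ∨ j.val = i.val + 1)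

/-- `H` is a caterpillar: a tree of maximum degree three having a path containing all
branch vertices. -/
def IsCaterpillar {α : Type} (H : SimpleGraph α) : Prop :=
  H.IsTree ∧ (∀ v, degreeSet H v ≤ 3) ∧
    ∃ (n : ℕ) (f : Fin n → α), IsPathEmb H n f ∧
      ∀ v, 2 < degreeSet H v → v ∈ Set.range f

/-- `H` is a subdivided star: a tree with exactly one branch vertex (its root), of degree
at least 3. -/
def IsSubdividedStar {α : Type} (H : SimpleGraph α) : Prop :=
  H.IsTree ∧ ∃! r, 2 < degreeSet H r

/-- `H` is (isomorphic to) the line graph of a caterpillar. -/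
def IsLineGraphOfCaterpillar {α : Type} (H : SimpleGraph α) : Prop :=
  ∃ (β : Type) (C : SimpleGraph β), IsCaterpillar C ∧
    Nonempty (SimpleGraph.Iso H C.lineGraph)

/-- `w` is a simplicial vertex of the induced subgraph `G[W]`. -/
def SimplicialIn {α : Type} (G : SimpleGraph α) (W : Set α) (w : α) : Prop :=
  w ∈ W ∧ G.IsClique {u | u ∈ W ∧ G.Adj w u}

/-- `(p, x)` is an alignment: `p` enumerates an induced path, `x` enumerates the set `X`
in the order given by the alignment. -/
structure IsAlignment {α : Type} (G : SimpleGraph α) (n : ℕ) (p : Fin n → α)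
    (k : ℕ) (x : Fin k → α) : Prop where
  hn : 1 ≤ n
  hk : 2 ≤ k
  path : IsPathEmb G n p
  injx : Function.Injective x
  disj : ∀ i j, x i ≠ p j
  cover : ∀ i, ∃ j, G.Adj (x i) (p j)
  first : ∀ j : Fin n, G.Adj (x ⟨0, by omega⟩) (p j) ↔ j.val = 0
  last : ∀ j : Fin n, G.Adj (x ⟨k - 1, by omega⟩) (p j) ↔ j.val = n - 1
  ordered : ∀ (i i' : Fin k) (j j' : Fin n),
    i < i' → G.Adj (x i) (p j) → G.Adj (x i') (p j') → j < j'

/-- A wide alignment: every middle vertex of `X` has two non-adjacent neighbors in `P`. -/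
def IsWideAlignment {α : Type} (G : SimpleGraph α) (n : ℕ) (p : Fin n → α)
    (k : ℕ) (x : Fin k → α) : Prop :=
  IsAlignment G n p k x ∧ ∀ i : Fin k, 0 < i.val → i.val < k - 1 →
    ∃ j j' : Fin n, j.val + 1 < j'.val ∧ G.Adj (x i) (p j) ∧ G.Adj (x i) (p j')

/-- A spiky alignment: every middle vertex of `X` has a unique neighbor in `P`. -/
def IsSpikyAlignment {α : Type} (G : SimpleGraph α) (n : ℕ) (p : Fin n → α)
    (k : ℕ) (x : Fin k → α) : Prop :=
  IsAlignment G n p k x ∧ ∀ i : Fin k, 0 < i.val → i.val < k - 1 →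
    ∃! j : Fin n, G.Adj (x i) (p j)

/-- A triangular alignment: every middle vertex of `X` has exactly two neighbors in `P`,
and they are adjacent. -/
def IsTriangularAlignment {α : Type} (G : SimpleGraph α) (n : ℕ) (p : Fin n → α)
    (k : ℕ) (x : Fin k → α) : Prop :=
  IsAlignment G n p k x ∧ ∀ i : Fin k, 0 < i.val → i.val < k - 1 →
    ∃ j : Fin n, j.val + 1 < n ∧
      ∀ j' : Fin n, G.Adj (x i) (p j') ↔ (j'.val = j.val ∨ j'.val = j.val + 1)

/-- `(H, x)` is a spiky connectifier: `H` is an induced caterpillar with spine `p` and legs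
`ℓ`, and `x` enumerates `X` in the order given by the connectifier (`x 0` and `x (k-1)`
attached at the ends of the spine, the others to the tips of the legs, in the order in which
the legs attach along the spine). -/
def IsSpikyConnectifier {α : Type} (G : SimpleGraph α) (H : Set α)
    (k : ℕ) (x : Fin k → α) : Prop :=
  ∃ (hk : 2 ≤ k) (n : ℕ) (_ : 2 ≤ n) (p : Fin n → α)
    (m : Fin (k - 2) → ℕ) (ℓ : ∀ i, Fin (m i) → α) (a : Fin (k - 2) → ℕ),
    IsPathEmb G n p ∧ (∀ i, 1 ≤ m i) ∧ (∀ i, IsPathEmb G (m i) (ℓ i)) ∧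
    H = Set.range p ∪ ⋃ i, Set.range (ℓ i) ∧
    Function.Injective x ∧ (∀ i, x i ∉ H) ∧
    (∀ i j j', ℓ i j ≠ p j') ∧
    (∀ i i', i ≠ i' → ∀ j j', ℓ i j ≠ ℓ i' j' ∧ ¬ G.Adj (ℓ i j) (ℓ i' j')) ∧
    (∀ i, 0 < a i ∧ a i < n - 1) ∧
    (∀ i i', i < i' → a i < a i') ∧
    (∀ (i : Fin (k - 2)) (j : Fin (m i)) (j' : Fin n),
      G.Adj (ℓ i j) (p j') ↔ (j.val = 0 ∧ j'.val = a i)) ∧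
    (∀ j : Fin n, G.Adj (x ⟨0, by omega⟩) (p j) ↔ j.val = 0) ∧
    (∀ (i : Fin (k - 2)) (j : Fin (m i)), ¬ G.Adj (x ⟨0, by omega⟩) (ℓ i j)) ∧
    (∀ j : Fin n, G.Adj (x ⟨k - 1, by omega⟩) (p j) ↔ j.val = n - 1) ∧
    (∀ (i : Fin (k - 2)) (j : Fin (m i)), ¬ G.Adj (x ⟨k - 1, by omega⟩) (ℓ i j)) ∧
    (∀ (i : Fin (k - 2)) (j : Fin n),
      ¬ G.Adj (x ⟨i.val + 1, by have := i.isLt; omega⟩) (p j)) ∧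
    (∀ (i i' : Fin (k - 2)) (j : Fin (m i')),
      G.Adj (x ⟨i.val + 1, by have := i.isLt; omega⟩) (ℓ i' j) ↔ (i' = i ∧ j.val = m i' - 1))

/-- `(H, x)` is a triangular connectifier: `H` is the line graph of a caterpillar, with
spine `p` and legs `ℓ` attached along triangles, and `x` enumerates `X` in the order given
by the connectifier. -/
def IsTriangularConnectifier {α : Type} (G : SimpleGraph α) (H : Set α)
    (k : ℕ) (x : Fin k → α) : Prop :=
  ∃ (hk : 2 ≤ k) (n : ℕ) (_ : 2 ≤ n) (p : Fin n → α)
    (m : Fin (k - 2) → ℕ) (ℓ : ∀ i, Fin (m i) → α) (a : Fin (k - 2) → ℕ),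
    IsPathEmb G n p ∧ (∀ i, 1 ≤ m i) ∧ (∀ i, IsPathEmb G (m i) (ℓ i)) ∧
    H = Set.range p ∪ ⋃ i, Set.range (ℓ i) ∧
    Function.Injective x ∧ (∀ i, x i ∉ H) ∧
    (∀ i j j', ℓ i j ≠ p j') ∧
    (∀ i i', i ≠ i' → ∀ j j', ℓ i j ≠ ℓ i' j' ∧ ¬ G.Adj (ℓ i j) (ℓ i' j')) ∧
    (∀ i, a i + 1 ≤ n - 1) ∧
    (∀ i i', i < i' → a i < a i') ∧
    (∀ (i : Fin (k - 2)) (j : Fin (m i)) (j' : Fin n),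
      G.Adj (ℓ i j) (p j') ↔ (j.val = 0 ∧ (j'.val = a i ∨ j'.val = a i + 1))) ∧
    (∀ j : Fin n, G.Adj (x ⟨0, by omega⟩) (p j) ↔ j.val = 0) ∧
    (∀ (i : Fin (k - 2)) (j : Fin (m i)), ¬ G.Adj (x ⟨0, by omega⟩) (ℓ i j)) ∧
    (∀ j : Fin n, G.Adj (x ⟨k - 1, by omega⟩) (p j) ↔ j.val = n - 1) ∧
    (∀ (i : Fin (k - 2)) (j : Fin (m i)), ¬ G.Adj (x ⟨k - 1, by omega⟩) (ℓ i j)) ∧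
    (∀ (i : Fin (k - 2)) (j : Fin n),
      ¬ G.Adj (x ⟨i.val + 1, by have := i.isLt; omega⟩) (p j)) ∧
    (∀ (i i' : Fin (k - 2)) (j : Fin (m i')),
      G.Adj (x ⟨i.val + 1, by have := i.isLt; omega⟩) (ℓ i' j) ↔ (i' = i ∧ j.val = m i' - 1))

/-- `(H, x)` is a stellar connectifier: `H` is an induced subdivided star with root `r` and
legs `ℓ`, and the vertices of `X` are attached to the tips of the legs. -/
def IsStellarConnectifier {α : Type} (G : SimpleGraph α) (H : Set α)
    (k : ℕ) (x : Fin k → α) : Prop :=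
  ∃ (_ : 3 ≤ k) (r : α) (m : Fin k → ℕ) (ℓ : ∀ i, Fin (m i) → α),
    (∀ i, 1 ≤ m i) ∧ (∀ i, IsPathEmb G (m i) (ℓ i)) ∧
    H = {r} ∪ ⋃ i, Set.range (ℓ i) ∧
    Function.Injective x ∧ (∀ i, x i ∉ H) ∧
    (∀ i j, ℓ i j ≠ r) ∧
    (∀ i i', i ≠ i' → ∀ j j', ℓ i j ≠ ℓ i' j' ∧ ¬ G.Adj (ℓ i j) (ℓ i' j')) ∧
    (∀ (i : Fin k) (j : Fin (m i)), G.Adj r (ℓ i j) ↔ j.val = 0) ∧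
    (∀ i, ¬ G.Adj (x i) r) ∧
    (∀ (i i' : Fin k) (j : Fin (m i')),
      G.Adj (x i) (ℓ i' j) ↔ (i' = i ∧ j.val = m i' - 1))

/-- `(H, X)` is a wide alignment (set version). -/
def IsWideAlignSet {α : Type} (G : SimpleGraph α) (H X : Set α) : Prop :=
  ∃ (n k : ℕ) (p : Fin n → α) (e : Fin k → α),
    H = Set.range p ∧ X = Set.range e ∧ IsWideAlignment G n p k e

/-- `(H, X)` is a spiky alignment (set version). -/
def IsSpikyAlignSet {α : Type} (G : SimpleGraph α) (H X : Set α) : Prop :=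
  ∃ (n k : ℕ) (p : Fin n → α) (e : Fin k → α),
    H = Set.range p ∧ X = Set.range e ∧ IsSpikyAlignment G n p k e

/-- `(H, X)` is a triangular alignment (set version). -/
def IsTriAlignSet {α : Type} (G : SimpleGraph α) (H X : Set α) : Prop :=
  ∃ (n k : ℕ) (p : Fin n → α) (e : Fin k → α),
    H = Set.range p ∧ X = Set.range e ∧ IsTriangularAlignment G n p k e

/-- `(H, X)` is a spiky connectifier (set version). -/
def IsSpikyConnSet {α : Type} (G : SimpleGraph α) (H X : Set α) : Prop :=
  ∃ (k : ℕ) (e : Fin k → α), X = Set.range e ∧ IsSpikyConnectifier G H k e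

/-- `(H, X)` is a triangular connectifier (set version). -/
def IsTriConnSet {α : Type} (G : SimpleGraph α) (H X : Set α) : Prop :=
  ∃ (k : ℕ) (e : Fin k → α), X = Set.range e ∧ IsTriangularConnectifier G H k e

/-- `(H, X)` is a stellar connectifier (set version). -/
def IsStellarConnSet {α : Type} (G : SimpleGraph α) (H X : Set α) : Prop :=
  ∃ (k : ℕ) (e : Fin k → α), X = Set.range e ∧ IsStellarConnectifier G H k e

/-- `(H, X)` (with order `e` on `X`) is a consistent alignment or consistent connectifier. -/
def IsConsistentWith {α : Type} (G : SimpleGraph α) (H : Set α)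
    (k : ℕ) (e : Fin k → α) : Prop :=
  (∃ (n : ℕ) (p : Fin n → α), H = Set.range p ∧
    (IsWideAlignment G n p k e ∨ IsSpikyAlignment G n p k e ∨ IsTriangularAlignment G n p k e)) ∨
  IsSpikyConnectifier G H k e ∨ IsTriangularConnectifier G H k e ∨
    IsStellarConnectifier G H k e

section Linked

variable {V : Type} {G : SimpleGraph V}

/-- `A` induces a (possibly empty) connected subgraph: every nonempty subset of `A` that is
closed under taking neighbors inside `A` is all of `A`. -/
def Linked (G : SimpleGraph V) (A : Set V) : Prop :=
  ∀ X ⊆ A, X.Nonempty → (∀ x ∈ X, ∀ a ∈ A, G.Adj x a → a ∈ X) → X = A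

/-- No vertex belongs to both sets and no edge joins them. -/
def Apart (G : SimpleGraph V) (A B : Set V) : Prop :=
  ∀ a ∈ A, ∀ b ∈ B, a ≠ b ∧ ¬ G.Adj a b

theorem Apart.symm {A B : Set V} (h : Apart G A B) : Apart G B A :=
  fun a ha b hb => ⟨(h b hb a ha).1.symm, fun e => (h b hb a ha).2 e.symm⟩

theorem Apart.mono {A B A' B' : Set V} (h : Apart G A B) (hA : A' ⊆ A) (hB : B' ⊆ B) :
    Apart G A' B' :=
  fun a ha b hb => h a (hA ha) b (hB hb)

theorem Linked.mem_of_closed {A X : Set V} (hA : Linked G A) {a b : V} (ha : a ∈ A) (hb : b ∈ A)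
    (haX : a ∈ X) (hX : ∀ x ∈ A, x ∈ X → ∀ y ∈ A, G.Adj x y → y ∈ X) : b ∈ X := by
  have : X ∩ A = A := hA (X ∩ A) inter_subset_right ⟨a, haX, ha⟩
    (fun x hx y hy h => ⟨hX x hx.2 hx.1 y hy h, hy⟩)
  exact (this.symm ▸ hb : b ∈ X ∩ A).1

theorem linked_of_mem_of_closed {A : Set V} {a : V} (ha : a ∈ A)
    (h : ∀ X ⊆ A, a ∈ X → (∀ x ∈ X, ∀ y ∈ A, G.Adj x y → y ∈ X) → A ⊆ X) : Linked G A := by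
  intro X hXA hne hX
  by_cases haX : a ∈ X
  · exact hXA.antisymm (h X hXA haX hX)
  · exfalso
    have := h (A \ X) sdiff_subset ⟨ha, haX⟩ (fun x hx y hy e => ⟨hy, fun hyX =>
      hx.2 (hX y hyX x hx.1 e.symm)⟩)
    obtain ⟨x, hx⟩ := hne
    exact (this (hXA hx)).2 hx

theorem linked_singleton (v : V) : Linked G {v} := by
  refine linked_of_mem_of_closed (mem_singleton v) fun X _ hv _ => ?_
  simpa using hv

theorem Linked.union {A B : Set V} (hA : Linked G A) (hB : Linked G B) {a : V} (haA : a ∈ A)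
    (haB : a ∈ B) : Linked G (A ∪ B) := by
  refine linked_of_mem_of_closed (Or.inl haA) fun X _ haX hX => ?_
  rintro b (hb | hb)
  · exact hA.mem_of_closed haA hb haX fun x _ hx y hy e => hX x hx y (Or.inl hy) e
  · exact hB.mem_of_closed haB hb haX fun x _ hx y hy e => hX x hx y (Or.inr hy) e

theorem linked_pair {a b : V} (h : G.Adj a b) : Linked G {a, b} := by
  refine linked_of_mem_of_closed (mem_insert a _) fun X _ haX hX => ?_
  rintro c (rfl | rfl)
  · exact haX
  · exact hX a haX _ (by simp) h

theorem Linked.union_adj {A B : Set V} (hA : Linked G A) (hB : Linked G B) {a b : V} (ha : a ∈ A)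
    (hb : b ∈ B) (h : G.Adj a b) : Linked G (A ∪ B) := by
  have h1 : Linked G (A ∪ {a, b}) := hA.union (linked_pair h) ha (by simp)
  have h2 : Linked G ((A ∪ {a, b}) ∪ B) := h1.union hB (a := b) (by simp) hb
  convert h2 using 1
  ext x
  simp only [mem_union, mem_insert_iff, mem_singleton_iff]
  constructor
  · tauto
  · rintro ((h | rfl | rfl) | h) <;> tauto

theorem Linked.insert_adj {A : Set V} (hA : Linked G A) {a b : V} (ha : a ∈ A)
    (h : G.Adj a b) : Linked G (insert b A) :=
  insert_eq b A ▸ union_comm A {b} ▸ hA.union_adj (linked_singleton b) ha rfl h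

/-- The connected component of a vertex in an induced subgraph. -/
theorem exists_linked_closed {S : Set V} {v : V} (hv : v ∈ S) :
    ∃ X ⊆ S, v ∈ X ∧ Linked G X ∧ ∀ x ∈ X, ∀ y ∈ S, G.Adj x y → y ∈ X := by
  let X : Set V := {x | ∀ Z ⊆ S, v ∈ Z → (∀ z ∈ Z, ∀ y ∈ S, G.Adj z y → y ∈ Z) → x ∈ Z}
  have hXS : X ⊆ S := fun x hx => hx S Subset.rfl hv (fun _ _ y hy _ => hy)
  have hvX : v ∈ X := fun Z _ hvZ _ => hvZ
  have hX : ∀ x ∈ X, ∀ y ∈ S, G.Adj x y → y ∈ X :=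
    fun x hx y hy e Z hZ hvZ hcl => hcl x (hx Z hZ hvZ hcl) y hy e
  refine ⟨X, hXS, hvX, ?_, hX⟩
  refine linked_of_mem_of_closed hvX fun Z hZX hvZ hcl x hx => ?_
  exact hx Z (hZX.trans hXS) hvZ fun z hz y hy e => hcl z hz y (hX z (hZX hz) y hy e) e

/-- Removing a vertex `u` from a connected set: the component `X` of `v` and its complement,
which are both connected and are joined by edges at `u` only. -/
theorem Linked.split {H : Set V} (hH : Linked G H) {u v : V} (hu : u ∈ H) (hv : v ∈ H)
    (huv : u ≠ v) :
    ∃ X ⊆ H, v ∈ X ∧ u ∉ X ∧ Linked G X ∧ Linked G (H \ X) ∧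
      ∀ x ∈ X, ∀ y ∈ H, y ≠ u → G.Adj x y → y ∈ X := by
  obtain ⟨X, hXS, hvX, hXL, hX⟩ := exists_linked_closed (G := G) (S := H \ {u}) (v := v)
    ⟨hv, by simpa using huv.symm⟩
  have huX : u ∉ X := fun h => (hXS h).2 rfl
  refine ⟨X, hXS.trans sdiff_subset, hvX, huX, hXL, ?_, fun x hx y hy hyu e =>
    hX x hx y ⟨hy, hyu⟩ e⟩
  refine linked_of_mem_of_closed (a := u) ⟨hu, huX⟩ fun Z hZ huZ hcl b hb => ?_
  by_contra hbZ
  have hv' : v ∈ (H \ X) \ Z := by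
    refine hH.mem_of_closed (X := (H \ X) \ Z) hb.1 hv ⟨hb, hbZ⟩ fun x hx hxZ y hy e => ?_
    refine ⟨⟨hy, fun hyX => ?_⟩, fun hyZ => hxZ.2 (hcl y hyZ x hxZ.1 e.symm)⟩
    refine hxZ.1.2 (hX y hyX x ⟨hx, ?_⟩ e.symm)
    rintro rfl
    exact hxZ.2 huZ
  exact hv'.1.2 hvX

/-- In a connected set containing `y` and a vertex satisfying `p`, there is a connected subset
containing `y` and exactly one vertex satisfying `p`. -/
theorem Linked.first_hit {C : Set V} (hC : Linked G C) {y c : V} (hy : y ∈ C) (hc : c ∈ C)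
    (p : V → Prop) (hp : p c) :
    ∃ B ⊆ C, ∃ w ∈ B, y ∈ B ∧ Linked G B ∧ p w ∧ (∀ x ∈ B, p x → x = w) ∧
      ∀ z ∈ B, z = y ∨ ∃ x ∈ B, ¬ p x ∧ G.Adj x z := by
  by_cases hpy : p y
  · exact ⟨{y}, by simpa using hy, y, rfl, rfl, linked_singleton y, hpy, fun x hx _ => hx,
      fun z hz => Or.inl hz⟩
  obtain ⟨A, hAS, hyA, hAL, hA⟩ := exists_linked_closed (G := G) (S := {x ∈ C | ¬ p x}) (v := y)
    ⟨hy, hpy⟩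
  have hcA : c ∉ A := fun h => (hAS h).2 hp
  have : ∃ a ∈ A, ∃ w ∈ C, p w ∧ G.Adj a w := by
    by_contra! h
    refine hcA (hC.mem_of_closed hy hc hyA fun x hx hxA z hz e => ?_)
    exact hA x hxA z ⟨hz, fun hpz => h x hxA z hz hpz e⟩ e
  obtain ⟨a, haA, w, hwC, hpw, haw⟩ := this
  refine ⟨insert w A, insert_subset hwC fun x hx => (hAS hx).1, w, mem_insert _ _,
    mem_insert_of_mem _ hyA, hAL.insert_adj haA haw, hpw, ?_, ?_⟩
  · rintro x (rfl | hx) hpx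
    · rfl
    · exact absurd hpx (hAS hx).2
  · rintro z (rfl | hz)
    · exact Or.inr ⟨a, mem_insert_of_mem _ haA, (hAS haA).2, haw⟩
    · by_cases hzy : z = y
      · exact Or.inl hzy
      · right
        by_contra! h
        refine hzy ?_
        have : y ∈ ({z} : Set V) := by
          refine hAL.mem_of_closed hz hyA rfl fun x _ hxz x' hx' e => ?_
          rw [mem_singleton_iff] at hxz
          subst hxz
          exact absurd e.symm (h x' (mem_insert_of_mem _ hx') (hAS hx').2)
        exact (mem_singleton_iff.1 this).symm

end Linked

section IndPath

variable {V : Type} {G : SimpleGraph V}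

/-- `p 0, …, p n` is an induced path. -/
structure IndPath (G : SimpleGraph V) (n : ℕ) (p : ℕ → V) : Prop where
  inj : ∀ i j, i ≤ n → j ≤ n → p i = p j → i = j
  adj : ∀ i j, i ≤ n → j ≤ n → (G.Adj (p i) (p j) ↔ i = j + 1 ∨ j = i + 1)

theorem IndPath.isPathEmb {n : ℕ} {p : ℕ → V} (h : IndPath G n p) :
    IsPathEmb G (n + 1) fun i => p i.val := by
  refine ⟨fun i j hij => Fin.ext (h.inj _ _ (by omega) (by omega) hij), fun i j => ?_⟩
  exact h.adj _ _ (by omega) (by omega)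

theorem IndPath.mono {n m : ℕ} {p : ℕ → V} (h : IndPath G n p) (hm : m ≤ n) : IndPath G m p :=
  ⟨fun i j hi hj => h.inj i j (hi.trans hm) (hj.trans hm),
    fun i j hi hj => h.adj i j (hi.trans hm) (hj.trans hm)⟩

theorem IndPath.shift {n m a : ℕ} {p : ℕ → V} (h : IndPath G n p) (hm : m + a ≤ n) :
    IndPath G m fun i => p (i + a) :=
  ⟨fun i j hi hj e => by have := h.inj (i + a) (j + a) (by omega) (by omega) e; omega,
    fun i j hi hj => by rw [h.adj (i + a) (j + a) (by omega) (by omega)]; omega⟩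

theorem IndPath.reverse {n : ℕ} {p : ℕ → V} (h : IndPath G n p) :
    IndPath G n fun i => p (n - i) :=
  ⟨fun i j hi hj e => by have := h.inj (n - i) (n - j) (by omega) (by omega) e; omega,
    fun i j hi hj => by rw [h.adj (n - i) (n - j) (by omega) (by omega)]; omega⟩

theorem indPath_zero (p : ℕ → V) : IndPath G 0 p :=
  ⟨fun i j hi hj _ => by omega, fun i j hi hj => by
    obtain rfl : i = 0 := by omega
    obtain rfl : j = 0 := by omega
    simp⟩

theorem IndPath.append {n m : ℕ} {p q : ℕ → V} (hp : IndPath G n p) (hq : IndPath G m q)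
    (hne : ∀ i j, i ≤ n → j ≤ m → p i ≠ q j)
    (hadj : ∀ i j, i ≤ n → j ≤ m → (G.Adj (p i) (q j) ↔ i = n ∧ j = 0)) :
    IndPath G (n + m + 1) fun k => if k ≤ n then p k else q (k - (n + 1)) := by
  constructor
  · intro i j hi hj e
    split_ifs at e with h1 h2 h2
    · exact hp.inj _ _ h1 h2 e
    · exact absurd e (hne _ _ h1 (by omega))
    · exact absurd e.symm (hne _ _ h2 (by omega))
    · have := hq.inj _ _ (by omega) (by omega) e; omega
  · intro i j hi hj
    split_ifs with h1 h2 h2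
    · exact hp.adj _ _ h1 h2
    · rw [hadj _ _ h1 (by omega)]; omega
    · rw [G.adj_comm, hadj _ _ h2 (by omega)]; omega
    · rw [hq.adj _ _ (by omega) (by omega)]; omega

theorem Linked.exists_path {A : Set V} (hA : Linked G A) {a b : V} (ha : a ∈ A) (hb : b ∈ A) :
    ∃ (n : ℕ) (p : ℕ → V), IndPath G n p ∧ p 0 = a ∧ p n = b ∧ ∀ i ≤ n, p i ∈ A := by
  classical
  refine hA.mem_of_closed (X := {b | ∃ (n : ℕ) (p : ℕ → V), IndPath G n p ∧ p 0 = a ∧ p n = b ∧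
    ∀ i ≤ n, p i ∈ A}) ha hb ⟨0, fun _ => a, indPath_zero _, rfl, rfl, fun _ _ => ha⟩ ?_
  rintro x - ⟨n, p, hp, h0, hn, hpA⟩ y hy e
  by_cases hyp : ∃ i ≤ n, p i = y
  · obtain ⟨i, hi, rfl⟩ := hyp
    exact ⟨i, p, hp.mono hi, h0, rfl, fun j hj => hpA j (hj.trans hi)⟩
  · push Not at hyp
    have hex : ∃ i, i ≤ n ∧ G.Adj (p i) y := ⟨n, le_rfl, hn ▸ e⟩
    obtain ⟨hk, hky⟩ := Nat.find_spec hex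
    set k := Nat.find hex with hkdef
    have hmin : ∀ i, i < k → ¬ G.Adj (p i) y := fun i hi h =>
      Nat.find_min hex hi ⟨by omega, h⟩
    refine ⟨k + 0 + 1, _, (hp.mono hk).append (indPath_zero (fun _ => y))
      (fun i j hi _ => hyp i (by omega)) ?_, ?_, ?_, ?_⟩
    · intro i j hi hj
      constructor
      · intro h
        refine ⟨?_, by omega⟩
        by_contra hne
        exact hmin i (by omega) h
      · rintro ⟨rfl, -⟩
        exact hky
    · simpa using h0
    · simp
    · intro i hi
      split_ifs with h
      · exact hpA i (by omega)
      · exact hy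

theorem IndPath.linked {n : ℕ} {p : ℕ → V} (h : IndPath G n p) {i j : ℕ} (hij : i ≤ j)
    (hj : j ≤ n) : Linked G {x | ∃ k, i ≤ k ∧ k ≤ j ∧ p k = x} := by
  induction j, hij using Nat.le_induction with
  | base =>
    convert linked_singleton (G := G) (p i)
    ext x
    simp only [mem_ofPred_eq, mem_singleton_iff]
    constructor
    · rintro ⟨k, h1, h2, rfl⟩
      rw [le_antisymm h1 h2]
    · rintro rfl
      exact ⟨i, le_rfl, le_rfl, rfl⟩
  | succ j hij ih =>
    have := (ih (by omega)).insert_adj (b := p (j + 1)) (a := p j) ⟨j, hij, le_rfl, rfl⟩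
      ((h.adj _ _ (by omega) hj).2 (Or.inr rfl))
    convert this using 1
    ext x
    simp only [mem_ofPred_eq, mem_insert_iff]
    constructor
    · rintro ⟨k, h1, h2, rfl⟩
      rcases h2.lt_or_eq with h3 | rfl
      · exact Or.inr ⟨k, h1, by omega, rfl⟩
      · exact Or.inl rfl
    · rintro (rfl | ⟨k, h1, h2, rfl⟩)
      · exact ⟨j + 1, by omega, le_rfl, rfl⟩
      · exact ⟨k, h1, by omega, rfl⟩

end IndPath

section Configurations

variable {V : Type} {G : SimpleGraph V}

/-- The vertices `p i, …, p j` of a path. -/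
def pathSet (p : ℕ → V) (i j : ℕ) : Set V := {x | ∃ k, i ≤ k ∧ k ≤ j ∧ p k = x}

theorem mem_pathSet (p : ℕ → V) {i j k : ℕ} (h1 : i ≤ k) (h2 : k ≤ j) : p k ∈ pathSet p i j :=
  ⟨k, h1, h2, rfl⟩

theorem IndPath.isPathFromTo {n : ℕ} {p : ℕ → V} (h : IndPath G n p) {a b : V} (ha : p 0 = a)
    (hb : p n = b) : IsPathFromTo G (n + 1) (fun i => p i.val) a b :=
  ⟨h.isPathEmb, by omega, ha, hb⟩

theorem hasTheta_of_linked {a b : V} (hne : a ≠ b) (hab : ¬ G.Adj a b) {X₁ X₂ X₃ : Set V}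
    (h₁ : Linked G X₁) (h₂ : Linked G X₂) (h₃ : Linked G X₃) (ha₁ : a ∈ X₁) (ha₂ : a ∈ X₂)
    (ha₃ : a ∈ X₃) (hb₁ : b ∈ X₁) (hb₂ : b ∈ X₂) (hb₃ : b ∈ X₃)
    (h₁₂ : Apart G (X₁ \ {a, b}) (X₂ \ {a, b})) (h₁₃ : Apart G (X₁ \ {a, b}) (X₃ \ {a, b}))
    (h₂₃ : Apart G (X₂ \ {a, b}) (X₃ \ {a, b})) : HasTheta G := by
  obtain ⟨n₁, p₁, hp₁, s₁, e₁, m₁⟩ := h₁.exists_path ha₁ hb₁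
  obtain ⟨n₂, p₂, hp₂, s₂, e₂, m₂⟩ := h₂.exists_path ha₂ hb₂
  obtain ⟨n₃, p₃, hp₃, s₃, e₃, m₃⟩ := h₃.exists_path ha₃ hb₃
  let n : Fin 3 → ℕ := ![n₁, n₂, n₃]
  let p : Fin 3 → ℕ → V := ![p₁, p₂, p₃]
  let X : Fin 3 → Set V := ![X₁, X₂, X₃]
  have hp : ∀ i, IndPath G (n i) (p i) ∧ p i 0 = a ∧ p i (n i) = b ∧
      ∀ k ≤ n i, p i k ∈ X i := by
    intro i
    fin_cases i
    exacts [⟨hp₁, s₁, e₁, m₁⟩, ⟨hp₂, s₂, e₂, m₂⟩, ⟨hp₃, s₃, e₃, m₃⟩]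
  have hX : ∀ i j, i ≠ j → Apart G (X i \ {a, b}) (X j \ {a, b}) := by
    intro i j hij
    fin_cases i <;> fin_cases j <;> first | exact absurd rfl hij | skip
    exacts [h₁₂, h₁₃, h₁₂.symm, h₂₃, h₁₃.symm, h₂₃.symm]
  have hmem : ∀ i k, 0 < k → k < n i → p i k ∈ X i \ {a, b} := by
    intro i k h0 hk
    obtain ⟨h, hs, he, hm⟩ := hp i
    refine ⟨hm k hk.le, ?_⟩
    rintro (e | e)
    · have := h.inj k 0 hk.le (by omega) (e.trans hs.symm); omega
    · have := h.inj k (n i) hk.le le_rfl (e.trans he.symm); omega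
  refine ⟨a, b, fun i => n i + 1, fun i k => p i k.val, hne, hab, fun i => ?_, fun i =>
    (hp i).1.isPathFromTo (hp i).2.1 (hp i).2.2.1, fun i j hij u v hu hu' hv hv' => ?_⟩
  · obtain ⟨h, hs, he, -⟩ := hp i
    by_contra hlt
    have h01 : n i = 0 ∨ n i = 1 := by simp only at hlt; omega
    rcases h01 with h0 | h0
    · rw [h0] at he
      exact hne (hs.symm.trans he)
    · refine hab ?_
      rw [← hs, ← he, h.adj _ _ (by omega) le_rfl]
      omega
  · exact hX i j hij _ (hmem i _ hu (by simpa using hu')) _ (hmem j _ hv (by simpa using hv'))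

/-- The only edges between `X` and `Y`, which are disjoint, are `a a'` and `b b'`. -/
def Ladder (G : SimpleGraph V) (X Y : Set V) (a b a' b' : V) : Prop :=
  ∀ x ∈ X, ∀ y ∈ Y, x ≠ y ∧ (G.Adj x y ↔ (x = a ∧ y = a') ∨ (x = b ∧ y = b'))

theorem Ladder.symm {X Y : Set V} {a b a' b' : V} (h : Ladder G X Y a b a' b') :
    Ladder G Y X a' b' a b := by
  intro y hy x hx
  refine ⟨(h x hx y hy).1.symm, ?_⟩
  rw [G.adj_comm, (h x hx y hy).2]
  tauto

theorem hasPrism_of_linked {X₁ X₂ X₃ : Set V} {a₁ a₂ a₃ b₁ b₂ b₃ : V}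
    (h₁ : Linked G X₁) (h₂ : Linked G X₂) (h₃ : Linked G X₃) (ha₁ : a₁ ∈ X₁) (ha₂ : a₂ ∈ X₂)
    (ha₃ : a₃ ∈ X₃) (hb₁ : b₁ ∈ X₁) (hb₂ : b₂ ∈ X₂) (hb₃ : b₃ ∈ X₃)
    (hne₁ : a₁ ≠ b₁) (hne₂ : a₂ ≠ b₂) (hne₃ : a₃ ≠ b₃)
    (h₁₂ : Ladder G X₁ X₂ a₁ b₁ a₂ b₂) (h₁₃ : Ladder G X₁ X₃ a₁ b₁ a₃ b₃)
    (h₂₃ : Ladder G X₂ X₃ a₂ b₂ a₃ b₃) : HasPrism G := by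
  obtain ⟨n₁, p₁, hp₁, s₁, e₁, m₁⟩ := h₁.exists_path ha₁ hb₁
  obtain ⟨n₂, p₂, hp₂, s₂, e₂, m₂⟩ := h₂.exists_path ha₂ hb₂
  obtain ⟨n₃, p₃, hp₃, s₃, e₃, m₃⟩ := h₃.exists_path ha₃ hb₃
  let n : Fin 3 → ℕ := ![n₁, n₂, n₃]
  let p : Fin 3 → ℕ → V := ![p₁, p₂, p₃]
  let X : Fin 3 → Set V := ![X₁, X₂, X₃]
  let a : Fin 3 → V := ![a₁, a₂, a₃]
  let b : Fin 3 → V := ![b₁, b₂, b₃]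
  have hp : ∀ i, IndPath G (n i) (p i) ∧ p i 0 = a i ∧ p i (n i) = b i ∧
      (∀ k ≤ n i, p i k ∈ X i) ∧ a i ≠ b i := by
    intro i
    fin_cases i
    exacts [⟨hp₁, s₁, e₁, m₁, hne₁⟩, ⟨hp₂, s₂, e₂, m₂, hne₂⟩, ⟨hp₃, s₃, e₃, m₃, hne₃⟩]
  have hX : ∀ i j, i ≠ j → Ladder G (X i) (X j) (a i) (b i) (a j) (b j) := by
    intro i j hij
    fin_cases i <;> fin_cases j <;> first | exact absurd rfl hij | skip
    exacts [h₁₂, h₁₃, h₁₂.symm, h₂₃, h₁₃.symm, h₂₃.symm]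
  have hs : ∀ i k, k ≤ n i → (p i k = a i ↔ k = 0) := by
    intro i k hk
    obtain ⟨h, hs, -⟩ := hp i
    exact ⟨fun e => h.inj k 0 hk (by omega) (e.trans hs.symm), fun e => e ▸ hs⟩
  have he : ∀ i k, k ≤ n i → (p i k = b i ↔ k = n i) := by
    intro i k hk
    obtain ⟨h, -, he, -⟩ := hp i
    exact ⟨fun e => h.inj k (n i) hk le_rfl (e.trans he.symm), fun e => e ▸ he⟩
  refine ⟨fun i => n i + 1, fun i k => p i k.val, fun i => ?_, fun i => (hp i).1.isPathEmb,
    fun i j hij u v => ?_, fun i j hij u v => ?_⟩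
  · obtain ⟨h, hs, he, -, hne⟩ := hp i
    by_contra hlt
    have h0 : n i = 0 := by simp only at hlt; omega
    rw [h0] at he
    exact hne (hs.symm.trans he)
  · exact (hX i j hij _ ((hp i).2.2.2.1 u (Nat.lt_succ_iff.1 u.isLt)) _
      ((hp j).2.2.2.1 v (Nat.lt_succ_iff.1 v.isLt))).1
  · have hu : u.val ≤ n i := Nat.lt_succ_iff.1 u.isLt
    have hv : v.val ≤ n j := Nat.lt_succ_iff.1 v.isLt
    rw [(hX i j hij _ ((hp i).2.2.2.1 u hu) _ ((hp j).2.2.2.1 v hv)).2,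
      hs i _ hu, hs j _ hv, he i _ hu, he j _ hv]
    simp

theorem isHole_of_cyclic {N : ℕ} (hN : 4 ≤ N) {g : ℕ → V}
    (hinj : ∀ i j, i < N → j < N → g i = g j → i = j)
    (hadj : ∀ i j, i < N → j < N → (G.Adj (g i) (g j) ↔
      i = j + 1 ∨ j = i + 1 ∨ (i = 0 ∧ j + 1 = N) ∨ (j = 0 ∧ i + 1 = N))) :
    IsHole G {x | ∃ i < N, g i = x} := by
  obtain ⟨k, rfl⟩ : ∃ k, N = k + 1 := ⟨N - 1, by omega⟩
  have hsucc : ∀ i j : Fin (k + 1), i = j + 1 ↔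
      (i.val = j.val + 1 ∨ (i.val = 0 ∧ j.val = k)) := by
    intro i j
    rw [Fin.ext_iff, Fin.val_add, Fin.val_one']
    have hi := i.isLt
    have hj := j.isLt
    rw [Nat.mod_eq_of_lt (a := 1) (by omega)]
    by_cases h : j.val = k
    · rw [h, Nat.mod_self]; omega
    · rw [Nat.mod_eq_of_lt (by omega)]; omega
  refine ⟨k + 1, fun x : Fin (k + 1) => g x.val, hN, ⟨fun i j e => ?_, fun i j => ?_⟩, ?_⟩
  · exact Fin.ext (hinj _ _ (Fin.isLt i) (Fin.isLt j) e)
  · rw [show (i = j + 1 ↔ _) from hsucc i j, show (j = i + 1 ↔ _) from hsucc j i,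
      hadj _ _ (Fin.isLt i) (Fin.isLt j)]
    omega
  · ext x
    constructor
    · rintro ⟨i, rfl⟩
      exact ⟨Fin.val i, Fin.isLt i, rfl⟩
    · rintro ⟨i, hi, rfl⟩
      exact ⟨(⟨i, hi⟩ : Fin (k + 1)), rfl⟩

/-- Two induced paths with the same ends whose union is a hole. -/
structure HolePair (G : SimpleGraph V) (n : ℕ) (p : ℕ → V) (m : ℕ) (q : ℕ → V) : Prop where
  path₁ : IndPath G n p
  path₂ : IndPath G m q
  start : p 0 = q 0
  finish : p n = q m
  two_le₁ : 2 ≤ n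
  two_le₂ : 2 ≤ m
  interior : ∀ i j, 0 < i → i < n → 0 < j → j < m → p i ≠ q j ∧ ¬ G.Adj (p i) (q j)

namespace HolePair

variable {n m : ℕ} {p q : ℕ → V}

theorem swap (h : HolePair G n p m q) : HolePair G m q n p :=
  ⟨h.path₂, h.path₁, h.start.symm, h.finish.symm, h.two_le₂, h.two_le₁,
    fun i j hi hi' hj hj' => ⟨(h.interior j i hj hj' hi hi').1.symm,
      fun e => (h.interior j i hj hj' hi hi').2 e.symm⟩⟩

theorem eq_iff (h : HolePair G n p m q) {i j : ℕ} (hi : i ≤ n) (hj : j ≤ m) :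
    p i = q j ↔ (i = 0 ∧ j = 0) ∨ (i = n ∧ j = m) := by
  have h1 := h.two_le₁
  have h2 := h.two_le₂
  constructor
  · intro e
    by_cases i0 : i = 0
    · subst i0
      have := h.path₂.inj 0 j (by omega) hj (h.start.symm.trans e)
      omega
    by_cases iN : i = n
    · subst iN
      have := h.path₂.inj m j le_rfl hj (h.finish.symm.trans e)
      omega
    by_cases j0 : j = 0
    · subst j0
      have := h.path₁.inj i 0 hi (by omega) (e.trans h.start.symm)
      omega
    by_cases jN : j = m
    · subst jN
      have := h.path₁.inj i n hi le_rfl (e.trans h.finish.symm)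
      omega
    exact absurd e (h.interior i j (by omega) (by omega) (by omega) (by omega)).1
  · rintro (⟨rfl, rfl⟩ | ⟨rfl, rfl⟩)
    exacts [h.start, h.finish]

theorem adj_iff (h : HolePair G n p m q) {i j : ℕ} (hi : i ≤ n) (hj : j ≤ m) :
    G.Adj (p i) (q j) ↔ (i = 0 ∧ j = 1) ∨ (i = 1 ∧ j = 0) ∨ (i = n ∧ j + 1 = m) ∨
      (i + 1 = n ∧ j = m) := by
  have h1 := h.two_le₁
  have h2 := h.two_le₂
  by_cases i0 : i = 0
  · subst i0
    rw [h.start, h.path₂.adj _ _ (by omega) hj]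
    omega
  by_cases iN : i = n
  · subst iN
    rw [h.finish, h.path₂.adj _ _ le_rfl hj]
    omega
  by_cases j0 : j = 0
  · subst j0
    rw [← h.start, h.path₁.adj _ _ hi (by omega)]
    omega
  by_cases jN : j = m
  · subst jN
    rw [← h.finish, h.path₁.adj _ _ hi le_rfl]
    omega
  have := (h.interior i j (by omega) (by omega) (by omega) (by omega)).2
  simp only [this, false_iff]
  omega

theorem isHole (h : HolePair G n p m q) : IsHole G (pathSet p 0 n ∪ pathSet q 0 m) := by
  have h1 := h.two_le₁
  have h2 := h.two_le₂
  have key := isHole_of_cyclic (G := G) (N := n + m) (by omega)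
    (g := fun i => if i ≤ n then p i else q (n + m - i)) ?_ ?_
  · convert key using 1
    ext x
    constructor
    · rintro (⟨k, -, hk, rfl⟩ | ⟨k, -, hk, rfl⟩)
      · exact ⟨k, by omega, by simp [hk]⟩
      · by_cases k0 : k = 0
        · exact ⟨0, by omega, by simp [k0, h.start]⟩
        by_cases km : k = m
        · exact ⟨n, by omega, by simp [km, h.finish]⟩
        · refine ⟨n + m - k, by omega, ?_⟩
          rw [if_neg (by omega)]
          congr 1
          omega
    · rintro ⟨i, hi, rfl⟩
      split_ifs with h'
      · exact Or.inl (mem_pathSet p (by omega) h')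
      · exact Or.inr (mem_pathSet q (by omega) (by omega))
  · intro i j hi hj e
    split_ifs at e with h3 h4 h4
    · exact h.path₁.inj _ _ h3 h4 e
    · rw [h.eq_iff h3 (by omega)] at e; omega
    · rw [eq_comm, h.eq_iff h4 (by omega)] at e; omega
    · have := h.path₂.inj _ _ (by omega) (by omega) e; omega
  · intro i j hi hj
    split_ifs with h3 h4 h4
    · rw [h.path₁.adj _ _ h3 h4]; omega
    · rw [h.adj_iff h3 (by omega)]; omega
    · rw [G.adj_comm, h.adj_iff h4 (by omega)]; omega
    · rw [h.path₂.adj _ _ (by omega) (by omega)]; omega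

/-- The part of the hole on the left of `p i` and `q j`. -/
def left (p q : ℕ → V) (i j : ℕ) : Set V := pathSet p 0 i ∪ pathSet q 0 j

/-- The part of the hole on the right of `p i` and `q j`. -/
def right (n m : ℕ) (p q : ℕ → V) (i j : ℕ) : Set V := pathSet p i n ∪ pathSet q j m

theorem linked_left (h : HolePair G n p m q) {i j : ℕ} (hi : i ≤ n) (hj : j ≤ m) :
    Linked G (left p q i j) :=
  (h.path₁.linked (Nat.zero_le i) hi).union (h.path₂.linked (Nat.zero_le j) hj)
    (mem_pathSet p le_rfl (Nat.zero_le _)) (h.start ▸ mem_pathSet q le_rfl (Nat.zero_le _))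

theorem linked_right (h : HolePair G n p m q) {i j : ℕ} (hi : i ≤ n) (hj : j ≤ m) :
    Linked G (right n m p q i j) :=
  (h.path₁.linked hi le_rfl).union (h.path₂.linked hj le_rfl)
    (mem_pathSet p hi le_rfl) (h.finish ▸ mem_pathSet q hj le_rfl)

theorem ladder (h : HolePair G n p m q) {i j i' j' : ℕ} (hi : i < i') (hi' : i' ≤ n)
    (hj : j < j') (hj' : j' ≤ m) :
    ∀ x ∈ left p q i j, ∀ y ∈ right n m p q i' j', x ≠ y ∧
      (G.Adj x y ↔ (x = p i ∧ y = p i' ∧ i' = i + 1) ∨ (x = q j ∧ y = q j' ∧ j' = j + 1)) := by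
  have h1 := h.two_le₁
  have h2 := h.two_le₂
  have hpp : ∀ a b, a ≤ n → b ≤ n → (p a = p b ↔ a = b) := fun a b ha hb =>
    ⟨h.path₁.inj a b ha hb, fun e => e ▸ rfl⟩
  have hqq : ∀ a b, a ≤ m → b ≤ m → (q a = q b ↔ a = b) := fun a b ha hb =>
    ⟨h.path₂.inj a b ha hb, fun e => e ▸ rfl⟩
  have hqp : ∀ a b, a ≤ n → b ≤ m → (q b = p a ↔ (a = 0 ∧ b = 0) ∨ (a = n ∧ b = m)) :=
    fun a b ha hb => eq_comm.trans (h.eq_iff ha hb)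
  rintro x (⟨a, -, ha, rfl⟩ | ⟨a, -, ha, rfl⟩) y (⟨b, hb, hb', rfl⟩ | ⟨b, hb, hb', rfl⟩)
  · rw [h.path₁.adj a b (by omega) hb', Ne, hpp a b (by omega) hb', hpp a i (by omega) (by omega),
      hpp b i' hb' hi', h.eq_iff (i := a) (j := j) (by omega) (by omega),
      h.eq_iff (i := b) (j := j') (by omega) (by omega)]
    omega
  · rw [h.adj_iff (i := a) (j := b) (by omega) hb', Ne, h.eq_iff (by omega) hb',
      hpp a i (by omega) (by omega), eq_comm (b := p i'), h.eq_iff hi' hb',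
      h.eq_iff (i := a) (j := j) (by omega) (by omega), hqq b j' hb' hj']
    omega
  · rw [G.adj_comm, h.adj_iff (i := b) (j := a) hb' (by omega), Ne, hqp b a hb' (by omega),
      hqp i a (by omega) (by omega), hpp b i' hb' hi',
      hqq a j (by omega) (by omega), h.eq_iff (i := b) (j := j') hb' hj']
    omega
  · rw [h.path₂.adj a b (by omega) hb', Ne, hqq a b (by omega) hb', hqq a j (by omega) (by omega),
      hqq b j' hb' hj', hqp i a (by omega) (by omega), hqp i' b hi' hb']
    omega

end HolePair

end Configurations

section Local

variable {V : Type} {G : SimpleGraph V}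

/-- The vertex `w` is the only vertex of `C` with neighbors on the path `p 0, …, p n`, its extreme
neighbors there are `p l` and `p r`, and these are internal vertices of the path. -/
structure Attach (G : SimpleGraph V) (n : ℕ) (p : ℕ → V) (C : Set V) (w : V) (l r : ℕ) :
    Prop where
  mem : w ∈ C
  ne : ∀ x ∈ C, ∀ i ≤ n, x ≠ p i
  nbr : ∀ x ∈ C, ∀ i ≤ n, G.Adj x (p i) → x = w ∧ l ≤ i ∧ i ≤ r
  adj_left : G.Adj w (p l)
  adj_right : G.Adj w (p r)
  le : l ≤ r
  pos : 0 < l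
  lt : r < n

namespace HolePair

variable {n m : ℕ} {p q : ℕ → V} {C : Set V} {w₁ w₂ : V} {l₁ r₁ l₂ r₂ : ℕ}

theorem apart (h : HolePair G n p m q) {i j i' j' : ℕ} (hi : i + 1 < i') (hi' : i' ≤ n)
    (hj : j + 1 < j') (hj' : j' ≤ m) : Apart G (left p q i j) (right n m p q i' j') := by
  intro x hx y hy
  obtain ⟨hne, hadj⟩ := h.ladder (by omega) hi' (by omega) hj' x hx y hy
  refine ⟨hne, fun e => ?_⟩
  rcases hadj.1 e with ⟨-, -, h⟩ | ⟨-, -, h⟩ <;> omega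

theorem hasTheta_of_single (h : HolePair G n p m q) (hC : Linked G C)
    (a₁ : Attach G n p C w₁ l₁ l₁) (a₂ : Attach G m q C w₂ l₂ l₂) : HasTheta G := by
  have hl₁ := a₁.lt
  have hl₂ := a₂.lt
  have hp₁ := a₁.pos
  have hp₂ := a₂.pos
  have hfar := h.interior l₁ l₂ hp₁ hl₁ hp₂ hl₂
  have hX₃ : Linked G (insert (p l₁) (insert (q l₂) C)) :=
    (hC.insert_adj a₂.mem a₂.adj_left).insert_adj (mem_insert_of_mem _ a₁.mem) a₁.adj_left
  have hsub : ∀ x, x ∈ insert (p l₁) (insert (q l₂) C) \ {p l₁, q l₂} → x ∈ C := by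
    rintro x ⟨(rfl | rfl | hx), hx'⟩
    · simp at hx'
    · simp at hx'
    · exact hx
  have hL : ∀ x, x ∈ left p q l₁ l₂ \ {p l₁, q l₂} → x ∈ left p q (l₁ - 1) (l₂ - 1) := by
    rintro x ⟨⟨k, -, hk, rfl⟩ | ⟨k, -, hk, rfl⟩, hx⟩
    · have : k ≠ l₁ := by rintro rfl; simp at hx
      exact Or.inl (mem_pathSet p (by omega) (by omega))
    · have : k ≠ l₂ := by rintro rfl; simp at hx
      exact Or.inr (mem_pathSet q (by omega) (by omega))
  have hR : ∀ x, x ∈ right n m p q l₁ l₂ \ {p l₁, q l₂} →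
      x ∈ right n m p q (l₁ + 1) (l₂ + 1) := by
    rintro x ⟨⟨k, hk, hk', rfl⟩ | ⟨k, hk, hk', rfl⟩, hx⟩
    · have : k ≠ l₁ := by rintro rfl; simp at hx
      exact Or.inl (mem_pathSet p (by omega) (by omega))
    · have : k ≠ l₂ := by rintro rfl; simp at hx
      exact Or.inr (mem_pathSet q (by omega) (by omega))
  have hCapart : ∀ x, (x ∈ pathSet p 0 n ∨ x ∈ pathSet q 0 m) → x ∉ ({p l₁, q l₂} : Set V) →
      ∀ y ∈ C, x ≠ y ∧ ¬ G.Adj x y := by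
    rintro x (⟨k, -, hk, rfl⟩ | ⟨k, -, hk, rfl⟩) hx y hy
    · refine ⟨(a₁.ne y hy k hk).symm, fun e => hx ?_⟩
      obtain ⟨-, h1, h2⟩ := a₁.nbr y hy k hk e.symm
      rw [le_antisymm h2 h1]; simp
    · refine ⟨(a₂.ne y hy k hk).symm, fun e => hx ?_⟩
      obtain ⟨-, h1, h2⟩ := a₂.nbr y hy k hk e.symm
      rw [le_antisymm h2 h1]; simp
  refine hasTheta_of_linked hfar.1 hfar.2 (h.linked_left hl₁.le hl₂.le)
    (h.linked_right hl₁.le hl₂.le) hX₃ (Or.inl (mem_pathSet p (by omega) le_rfl))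
    (Or.inl (mem_pathSet p le_rfl (by omega))) (mem_insert _ _)
    (Or.inr (mem_pathSet q (by omega) le_rfl)) (Or.inr (mem_pathSet q le_rfl (by omega)))
    (mem_insert_of_mem _ (mem_insert _ _)) ?_ ?_ ?_
  · exact fun x hx y hy => h.apart (by omega) (by omega) (by omega) (by omega) x (hL x hx) y
      (hR y hy)
  · refine fun x hx y hy => hCapart x ?_ hx.2 y (hsub y hy)
    rcases hx.1 with ⟨k, -, hk, rfl⟩ | ⟨k, -, hk, rfl⟩
    · exact Or.inl (mem_pathSet p (by omega) (by omega))
    · exact Or.inr (mem_pathSet q (by omega) (by omega))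
  · refine fun x hx y hy => hCapart x ?_ hx.2 y (hsub y hy)
    rcases hx.1 with ⟨k, -, hk, rfl⟩ | ⟨k, -, hk, rfl⟩
    · exact Or.inl (mem_pathSet p (by omega) (by omega))
    · exact Or.inr (mem_pathSet q (by omega) (by omega))

theorem hasPrism (h : HolePair G n p m q) (hC : Linked G C) (hw : w₁ ≠ w₂)
    (a₁ : Attach G n p C w₁ l₁ (l₁ + 1)) (a₂ : Attach G m q C w₂ l₂ (l₂ + 1)) : HasPrism G := by
  have hl₁ := a₁.lt
  have hl₂ := a₂.lt
  have hp₁ := a₁.pos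
  have hp₂ := a₂.pos
  have hlad : ∀ i j, (i = l₁ ∨ i = l₁ + 1) → (j = l₂ ∨ j = l₂ + 1) → ∀ Z : Set V,
      (∀ z ∈ Z, (∃ k ≤ n, p k = z ∧ ((l₁ ≤ k ∧ k ≤ l₁ + 1) → k = i)) ∨
        ∃ k ≤ m, q k = z ∧ ((l₂ ≤ k ∧ k ≤ l₂ + 1) → k = j)) →
      Ladder G C Z w₁ w₂ (p i) (q j) := by
    intro i j hi hj Z hZ x hx y hy
    have hip : G.Adj w₁ (p i) := by
      rcases hi with rfl | rfl
      exacts [a₁.adj_left, a₁.adj_right]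
    have hjp : G.Adj w₂ (q j) := by
      rcases hj with rfl | rfl
      exacts [a₂.adj_left, a₂.adj_right]
    refine ⟨?_, fun e => ?_, ?_⟩
    · rcases hZ y hy with ⟨k, hk, rfl, -⟩ | ⟨k, hk, rfl, -⟩
      exacts [a₁.ne x hx k hk, a₂.ne x hx k hk]
    · rcases hZ y hy with ⟨k, hk, rfl, hk'⟩ | ⟨k, hk, rfl, hk'⟩
      · obtain ⟨rfl, h1⟩ := a₁.nbr x hx k hk e
        rw [hk' h1]; exact Or.inl ⟨rfl, rfl⟩
      · obtain ⟨rfl, h1⟩ := a₂.nbr x hx k hk e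
        rw [hk' h1]; exact Or.inr ⟨rfl, rfl⟩
    · rintro (⟨rfl, rfl⟩ | ⟨rfl, rfl⟩)
      exacts [hip, hjp]
  refine hasPrism_of_linked hC (h.linked_left (i := l₁) (j := l₂) (by omega) (by omega))
    (h.linked_right (i := l₁ + 1) (j := l₂ + 1) (by omega) (by omega)) a₁.mem
    (Or.inl (mem_pathSet p (by omega) le_rfl)) (Or.inl (mem_pathSet p le_rfl (by omega)))
    a₂.mem (Or.inr (mem_pathSet q (by omega) le_rfl)) (Or.inr (mem_pathSet q le_rfl (by omega)))
    hw (h.interior _ _ hp₁ (by omega) hp₂ (by omega)).1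
    (h.interior _ _ (by omega) (by omega) (by omega) (by omega)).1 ?_ ?_ ?_
  · refine hlad _ _ (Or.inl rfl) (Or.inl rfl) _ ?_
    rintro x (⟨k, -, hk, rfl⟩ | ⟨k, -, hk, rfl⟩)
    · exact Or.inl ⟨k, by omega, rfl, by omega⟩
    · exact Or.inr ⟨k, by omega, rfl, by omega⟩
  · refine hlad _ _ (Or.inr rfl) (Or.inr rfl) _ ?_
    rintro x (⟨k, hk, hk', rfl⟩ | ⟨k, hk, hk', rfl⟩)
    · exact Or.inl ⟨k, by omega, rfl, by omega⟩
    · exact Or.inr ⟨k, by omega, rfl, by omega⟩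
  · intro x hx y hy
    simpa using h.ladder (Nat.lt_succ_self l₁) (by omega) (Nat.lt_succ_self l₂) (by omega) x hx y hy

theorem hasTheta_of_wide_single (h : HolePair G n p m q) (hC : Linked G C) (hw : w₁ ≠ w₂)
    (a₁ : Attach G n p C w₁ l₁ r₁) (a₂ : Attach G m q C w₂ l₂ l₂) (hlr : l₁ + 2 ≤ r₁) :
    HasTheta G := by
  have hl₁ := a₁.lt
  have hl₂ := a₂.lt
  have hp₁ := a₁.pos
  have hp₂ := a₂.pos
  have hX₃ : Linked G (insert (q l₂) C) := hC.insert_adj a₂.mem a₂.adj_left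
  have hL : ∀ x, x ∈ insert w₁ (left p q l₁ l₂) \ {w₁, q l₂} → x ∈ left p q l₁ (l₂ - 1) := by
    rintro x ⟨rfl | ⟨k, -, hk, rfl⟩ | ⟨k, -, hk, rfl⟩, hx⟩
    · simp at hx
    · exact Or.inl (mem_pathSet p (by omega) (by omega))
    · have : k ≠ l₂ := by rintro rfl; simp at hx
      exact Or.inr (mem_pathSet q (by omega) (by omega))
  have hR : ∀ x, x ∈ insert w₁ (right n m p q r₁ l₂) \ {w₁, q l₂} →
      x ∈ right n m p q r₁ (l₂ + 1) := by
    rintro x ⟨rfl | ⟨k, hk, hk', rfl⟩ | ⟨k, hk, hk', rfl⟩, hx⟩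
    · simp at hx
    · exact Or.inl (mem_pathSet p (by omega) (by omega))
    · have : k ≠ l₂ := by rintro rfl; simp at hx
      exact Or.inr (mem_pathSet q (by omega) (by omega))
  have hCapart : ∀ x, (x ∈ pathSet p 0 n ∨ x ∈ pathSet q 0 m) → x ∉ ({w₁, q l₂} : Set V) →
      ∀ y, y ∈ insert (q l₂) C \ {w₁, q l₂} → x ≠ y ∧ ¬ G.Adj x y := by
    intro x hx hx' y hy
    have hyC : y ∈ C := by
      rcases hy with ⟨rfl | hy, hy'⟩
      · simp at hy'
      · exact hy
    have hyw : y ≠ w₁ := by rintro rfl; simp at hy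
    rcases hx with ⟨k, -, hk, rfl⟩ | ⟨k, -, hk, rfl⟩
    · exact ⟨(a₁.ne y hyC k hk).symm, fun e => hyw (a₁.nbr y hyC k hk e.symm).1⟩
    · refine ⟨(a₂.ne y hyC k hk).symm, fun e => hx' ?_⟩
      obtain ⟨-, h1, h2⟩ := a₂.nbr y hyC k hk e.symm
      rw [le_antisymm h2 h1]; simp
  refine hasTheta_of_linked (a₂.ne w₁ a₁.mem l₂ hl₂.le)
    (fun e => hw (a₂.nbr w₁ a₁.mem l₂ hl₂.le e).1)
    ((h.linked_left (i := l₁) (j := l₂) (by omega) hl₂.le).insert_adj (a := p l₁)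
      (Or.inl (mem_pathSet p (by omega) le_rfl)) a₁.adj_left.symm)
    ((h.linked_right (i := r₁) (j := l₂) (by omega) hl₂.le).insert_adj (a := p r₁)
      (Or.inl (mem_pathSet p le_rfl (by omega))) a₁.adj_right.symm) hX₃
    (mem_insert _ _) (mem_insert _ _) (mem_insert_of_mem _ a₁.mem)
    (Or.inr (Or.inr (mem_pathSet q (by omega) le_rfl)))
    (Or.inr (Or.inr (mem_pathSet q le_rfl (by omega)))) (mem_insert _ _) ?_ ?_ ?_
  · exact fun x hx y hy => h.apart (by omega) (by omega) (by omega) (by omega) x (hL x hx) y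
      (hR y hy)
  · refine fun x hx y hy => hCapart x ?_ hx.2 y hy
    rcases hL x hx with ⟨k, -, hk, rfl⟩ | ⟨k, -, hk, rfl⟩
    · exact Or.inl (mem_pathSet p (by omega) (by omega))
    · exact Or.inr (mem_pathSet q (by omega) (by omega))
  · refine fun x hx y hy => hCapart x ?_ hx.2 y hy
    rcases hR x hx with ⟨k, -, hk, rfl⟩ | ⟨k, -, hk, rfl⟩
    · exact Or.inl (mem_pathSet p (by omega) (by omega))
    · exact Or.inr (mem_pathSet q (by omega) (by omega))

theorem hasTheta_of_wide_wide (h : HolePair G n p m q) (hC : Linked G C) (hw : w₁ ≠ w₂)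
    (hadj : ¬ G.Adj w₁ w₂) (a₁ : Attach G n p C w₁ l₁ r₁) (a₂ : Attach G m q C w₂ l₂ r₂)
    (hlr₁ : l₁ + 2 ≤ r₁) (hlr₂ : l₂ + 2 ≤ r₂) : HasTheta G := by
  have hl₁ := a₁.lt
  have hl₂ := a₂.lt
  have hp₁ := a₁.pos
  have hp₂ := a₂.pos
  have hdel : ∀ (Z : Set V) x, x ∈ insert w₁ (insert w₂ Z) \ {w₁, w₂} → x ∈ Z := by
    rintro Z x ⟨rfl | rfl | hx, hx'⟩
    · simp at hx'
    · simp at hx'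
    · exact hx
  have hCapart : ∀ x, (x ∈ pathSet p 0 n ∨ x ∈ pathSet q 0 m) →
      ∀ y ∈ C \ {w₁, w₂}, x ≠ y ∧ ¬ G.Adj x y := by
    rintro x (⟨k, -, hk, rfl⟩ | ⟨k, -, hk, rfl⟩) y ⟨hy, hy'⟩
    · exact ⟨(a₁.ne y hy k hk).symm, fun e => hy' (Or.inl (a₁.nbr y hy k hk e.symm).1)⟩
    · exact ⟨(a₂.ne y hy k hk).symm, fun e => hy' (Or.inr (a₂.nbr y hy k hk e.symm).1)⟩
  refine hasTheta_of_linked hw hadj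
    (((h.linked_left (i := l₁) (j := l₂) (by omega) (by omega)).insert_adj (a := q l₂)
      (Or.inr (mem_pathSet q (by omega) le_rfl)) a₂.adj_left.symm).insert_adj (a := p l₁)
      (Or.inr (Or.inl (mem_pathSet p (by omega) le_rfl))) a₁.adj_left.symm)
    (((h.linked_right (i := r₁) (j := r₂) (by omega) (by omega)).insert_adj (a := q r₂)
      (Or.inr (mem_pathSet q le_rfl (by omega))) a₂.adj_right.symm).insert_adj (a := p r₁)
      (Or.inr (Or.inl (mem_pathSet p le_rfl (by omega)))) a₁.adj_right.symm) hC
    (mem_insert _ _) (mem_insert _ _) a₁.mem (Or.inr (mem_insert _ _))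
    (Or.inr (mem_insert _ _)) a₂.mem ?_ ?_ ?_
  · exact fun x hx y hy => h.apart (by omega) (by omega) (by omega) (by omega) x
      (hdel _ x hx) y (hdel _ y hy)
  · refine fun x hx y hy => hCapart x ?_ y hy
    rcases hdel _ x hx with ⟨k, -, hk, rfl⟩ | ⟨k, -, hk, rfl⟩
    · exact Or.inl (mem_pathSet p (by omega) (by omega))
    · exact Or.inr (mem_pathSet q (by omega) (by omega))
  · refine fun x hx y hy => hCapart x ?_ y hy
    rcases hdel _ x hx with ⟨k, -, hk, rfl⟩ | ⟨k, -, hk, rfl⟩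
    · exact Or.inl (mem_pathSet p (by omega) (by omega))
    · exact Or.inr (mem_pathSet q (by omega) (by omega))

end HolePair

end Local

section Wheels

variable {V : Type} {G : SimpleGraph V}

theorem IsHole.finite {H : Set V} (h : IsHole G H) : H.Finite := by
  obtain ⟨n, f, hn, -, rfl⟩ := h
  have : NeZero n := ⟨by omega⟩
  exact Set.finite_range f

theorem isProperWheel_of_stable {H : Set V} (hH : IsHole G H) {w x y z : V} (hw : w ∉ H)
    (hx : x ∈ holeNbrs G H w) (hy : y ∈ holeNbrs G H w) (hz : z ∈ holeNbrs G H w)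
    (hxy : x ≠ y ∧ ¬ G.Adj x y) (hxz : x ≠ z ∧ ¬ G.Adj x z) (hyz : y ≠ z ∧ ¬ G.Adj y z) :
    IsProperWheel G H w := by
  have hfin : (holeNbrs G H w).Finite := hH.finite.subset fun v hv => hv.1
  have hcard : ({x, y, z} : Set V).ncard = 3 :=
    Set.ncard_eq_three.2 ⟨x, y, z, hxy.1, hxz.1, hyz.1, rfl⟩
  have hsub : ({x, y, z} : Set V) ⊆ holeNbrs G H w := by
    rintro v (rfl | rfl | rfl) <;> assumption
  have key : ∀ p q r : V, p ≠ q → q ≠ r → p ≠ r → holeNbrs G H w = {p, q, r} → ¬ G.Adj p q := by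
    intro p q r hpq hqr hpr hN e
    have hcard' : ({p, q, r} : Set V).ncard = 3 :=
      Set.ncard_eq_three.2 ⟨p, q, r, hpq, hpr, hqr, rfl⟩
    have heq : ({x, y, z} : Set V) = holeNbrs G H w :=
      Set.eq_of_subset_of_ncard_le hsub (by rw [hN, hcard, hcard']) hfin
    have hp : p ∈ ({x, y, z} : Set V) := by rw [heq, hN]; simp
    have hq : q ∈ ({x, y, z} : Set V) := by rw [heq, hN]; simp
    rcases hp with rfl | rfl | rfl <;> rcases hq with rfl | rfl | rfl <;>
      first
      | exact hpq rfl
      | exact hxy.2 e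
      | exact hxz.2 e
      | exact hyz.2 e
      | exact hxy.2 e.symm
      | exact hxz.2 e.symm
      | exact hyz.2 e.symm
  refine ⟨⟨hH, hw, hcard ▸ Set.ncard_le_ncard hsub hfin⟩, ?_, ?_⟩
  · rintro ⟨-, p, q, r, h1, h2, h3, hN, e, -⟩
    exact key p q r h1 h2 h3 hN e
  · rintro ⟨-, p, q, r, h1, h2, h3, hN, e, -⟩
    exact key p q r h1 h2 h3 hN e

/-- The indices of the neighbors of `w` on the path `p 0, …, p n`. -/
def nbrIdx (G : SimpleGraph V) (n : ℕ) (p : ℕ → V) (w : V) : Set ℕ := {i | i ≤ n ∧ G.Adj w (p i)}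

theorem nbrIdx_finite (n : ℕ) (p : ℕ → V) (w : V) : (nbrIdx G n p w).Finite :=
  (Set.finite_Iic n).subset fun _ hi => hi.1

namespace HolePair

variable {n m : ℕ} {p q : ℕ → V} {C : Set V} {w w₁ w₂ : V} {l₁ r₁ l₂ r₂ : ℕ}

theorem not_even (h : HolePair G n p m q) (hG : MemC G) (hwp : ∀ i ≤ n, w ≠ p i)
    (hwq : ∀ i ≤ m, w ≠ q i) (h0 : ¬ G.Adj w (p 0)) (hn : ¬ G.Adj w (p n))
    (h3 : 3 ≤ (nbrIdx G n p w).ncard + (nbrIdx G m q w).ncard) :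
    ¬ Even ((nbrIdx G n p w).ncard + (nbrIdx G m q w).ncard) := by
  have hN : holeNbrs G (pathSet p 0 n ∪ pathSet q 0 m) w =
      p '' nbrIdx G n p w ∪ q '' nbrIdx G m q w := by
    ext x
    constructor
    · rintro ⟨⟨k, -, hk, rfl⟩ | ⟨k, -, hk, rfl⟩, e⟩
      · exact Or.inl ⟨k, ⟨hk, e⟩, rfl⟩
      · exact Or.inr ⟨k, ⟨hk, e⟩, rfl⟩
    · rintro (⟨k, ⟨hk, e⟩, rfl⟩ | ⟨k, ⟨hk, e⟩, rfl⟩)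
      · exact ⟨Or.inl (mem_pathSet p (by omega) hk), e⟩
      · exact ⟨Or.inr (mem_pathSet q (by omega) hk), e⟩
  have hdisj : Disjoint (p '' nbrIdx G n p w) (q '' nbrIdx G m q w) := by
    rw [Set.disjoint_left]
    rintro x ⟨i, ⟨hi, ei⟩, rfl⟩ ⟨j, ⟨hj, ej⟩, hji⟩
    rcases (h.eq_iff hi hj).1 hji.symm with ⟨rfl, rfl⟩ | ⟨rfl, rfl⟩
    exacts [h0 ei, hn ei]
  have hcard : (holeNbrs G (pathSet p 0 n ∪ pathSet q 0 m) w).ncard =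
      (nbrIdx G n p w).ncard + (nbrIdx G m q w).ncard := by
    rw [hN, Set.ncard_union_eq hdisj ((nbrIdx_finite n p w).image p)
      ((nbrIdx_finite m q w).image q), Set.InjOn.ncard_image, Set.InjOn.ncard_image]
    · exact fun i hi j hj => h.path₂.inj i j hi.1 hj.1
    · exact fun i hi j hj => h.path₁.inj i j hi.1 hj.1
  rw [← hcard] at h3 ⊢
  refine hG.2.2.2 _ w ⟨h.isHole, ?_, h3⟩
  rintro (⟨k, -, hk, e⟩ | ⟨k, -, hk, e⟩)
  exacts [hwp k hk e.symm, hwq k hk e.symm]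

theorem isHub_of_wide (h : HolePair G n p m q) (a₁ : Attach G n p C w l₁ r₁)
    (a₂ : Attach G m q C w l₂ r₂) (hlr : l₁ + 2 ≤ r₁) : IsHub G w := by
  have hl₁ := a₁.lt
  have hl₂ := a₂.lt
  have hp₁ := a₁.pos
  have hp₂ := a₂.pos
  have hle := a₂.le
  refine ⟨_, isProperWheel_of_stable h.isHole (x := p l₁) (y := p r₁) (z := q l₂) ?_
    ⟨Or.inl (mem_pathSet p (by omega) (by omega)), a₁.adj_left⟩
    ⟨Or.inl (mem_pathSet p (by omega) (by omega)), a₁.adj_right⟩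
    ⟨Or.inr (mem_pathSet q (by omega) (by omega)), a₂.adj_left⟩ ?_
    (h.interior _ _ hp₁ (by omega) hp₂ (by omega))
    (h.interior _ _ (by omega) (by omega) hp₂ (by omega))⟩
  · rintro (⟨k, -, hk, e⟩ | ⟨k, -, hk, e⟩)
    exacts [a₁.ne w a₁.mem k hk e.symm, a₂.ne w a₂.mem k hk e.symm]
  · refine ⟨fun e => ?_, fun e => ?_⟩
    · have := h.path₁.inj _ _ (by omega) (by omega) e; omega
    · rw [h.path₁.adj _ _ (by omega) (by omega)] at e; omega

theorem nbrIdx_attach (a₁ : Attach G n p C w l₁ (l₁ + 1)) : (nbrIdx G n p w).ncard = 2 := by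
  have hl₁ := a₁.lt
  have : nbrIdx G n p w = {l₁, l₁ + 1} := by
    ext i
    constructor
    · rintro ⟨hi, e⟩
      have := (a₁.nbr w a₁.mem i hi e).2
      simp only [mem_insert_iff, mem_singleton_iff]
      omega
    · rintro (rfl | rfl)
      exacts [⟨by omega, a₁.adj_left⟩, ⟨by omega, a₁.adj_right⟩]
  rw [this, Set.ncard_pair (by omega)]

theorem false_of_double (h : HolePair G n p m q) (hG : MemC G)
    (a₁ : Attach G n p C w l₁ (l₁ + 1)) (a₂ : Attach G m q C w l₂ (l₂ + 1)) : False := by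
  have hl₁ := a₁.lt
  have hp₁ := a₁.pos
  refine h.not_even hG (w := w) (a₁.ne w a₁.mem) (a₂.ne w a₂.mem) (fun e => ?_) (fun e => ?_) ?_ ?_
  · have := a₁.nbr w a₁.mem 0 (by omega) e; omega
  · have := a₁.nbr w a₁.mem n (by omega) e; omega
  · rw [nbrIdx_attach a₁, nbrIdx_attach a₂]; norm_num
  · rw [nbrIdx_attach a₁, nbrIdx_attach a₂]; decide

theorem hasTheta_of_pair (h : HolePair G n p m q) (hlr : l₁ + 2 ≤ r₁) (hp₁ : 0 < l₁) (hl₁ : r₁ < n)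
    (hwp : ∀ i ≤ n, w ≠ p i) (hwq : ∀ i ≤ m, w ≠ q i) (hq : ∀ i ≤ m, ¬ G.Adj w (q i))
    (e₁ : G.Adj w (p l₁)) (e₂ : G.Adj w (p r₁))
    (hp : ∀ i ≤ n, G.Adj w (p i) → i = l₁ ∨ i = r₁) : HasTheta G := by
  have h1 := h.two_le₁
  have h2 := h.two_le₂
  have hmid : ∀ (Z : Set V) x, x ∈ insert (p l₁) (insert (p r₁) Z) \ {p l₁, p r₁} → x ∈ Z := by
    rintro Z x ⟨rfl | rfl | hx, hx'⟩
    · simp at hx'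
    · simp at hx'
    · exact hx
  have hX₁ : ∀ x, x ∈ pathSet p l₁ r₁ \ {p l₁, p r₁} → ∃ k, l₁ < k ∧ k < r₁ ∧ p k = x := by
    rintro x ⟨⟨k, hk, hk', rfl⟩, hx⟩
    have : k ≠ l₁ := by rintro rfl; simp at hx
    have : k ≠ r₁ := by rintro rfl; simp at hx
    exact ⟨k, by omega, by omega, rfl⟩
  have hX₃ : ∀ x, x ∈ (left p q l₁ m ∪ pathSet p r₁ n) \ {p l₁, p r₁} →
      (∃ k ≤ n, (k < l₁ ∨ r₁ < k) ∧ p k = x) ∨ ∃ k ≤ m, q k = x := by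
    rintro x ⟨(⟨k, hk, hk', rfl⟩ | ⟨k, hk, hk', rfl⟩) | ⟨k, hk, hk', rfl⟩, hx⟩
    · have : k ≠ l₁ := by rintro rfl; simp at hx
      exact Or.inl ⟨k, by omega, by omega, rfl⟩
    · exact Or.inr ⟨k, hk', rfl⟩
    · have : k ≠ r₁ := by rintro rfl; simp at hx
      exact Or.inl ⟨k, by omega, by omega, rfl⟩
  refine hasTheta_of_linked (a := p l₁) (b := p r₁)
    (X₂ := insert (p l₁) (insert (p r₁) {w})) (X₃ := left p q l₁ m ∪ pathSet p r₁ n)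
    (fun e => ?_) (fun e => ?_)
    (h.path₁.linked (i := l₁) (j := r₁) (by omega) (by omega))
    (((linked_singleton w).insert_adj rfl e₂).insert_adj (mem_insert_of_mem _ rfl) e₁)
    ((h.linked_left (i := l₁) (j := m) (by omega) le_rfl).union
      (h.path₁.linked (i := r₁) (j := n) (by omega) le_rfl) (a := p n)
      (h.finish ▸ Or.inr (mem_pathSet q (by omega) le_rfl)) (mem_pathSet p (by omega) le_rfl))
    (mem_pathSet p (by omega) (by omega)) (mem_insert _ _)
    (Or.inl (Or.inl (mem_pathSet p (by omega) (by omega)))) (mem_pathSet p (by omega) (by omega))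
    (mem_insert_of_mem _ (mem_insert _ _)) (Or.inr (mem_pathSet p le_rfl (by omega))) ?_ ?_ ?_
  · have := h.path₁.inj _ _ (by omega) (by omega) e; omega
  · rw [h.path₁.adj _ _ (by omega) (by omega)] at e; omega
  · intro x hx y hy
    obtain ⟨k, hk, hk', rfl⟩ := hX₁ x hx
    obtain rfl := hmid _ y hy
    refine ⟨(hwp k (by omega)).symm, fun e => ?_⟩
    have := hp k (by omega) e.symm
    omega
  · intro x hx y hy
    obtain ⟨k, hk, hk', rfl⟩ := hX₁ x hx
    rcases hX₃ y hy with ⟨j, hj, hj', rfl⟩ | ⟨j, hj, rfl⟩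
    · refine ⟨fun e => ?_, fun e => ?_⟩
      · have := h.path₁.inj _ _ (by omega) (by omega) e; omega
      · rw [h.path₁.adj _ _ (by omega) (by omega)] at e; omega
    · refine ⟨fun e => ?_, fun e => ?_⟩
      · rw [h.eq_iff (by omega) (by omega)] at e; omega
      · rw [h.adj_iff (by omega) (by omega)] at e; omega
  · intro x hx y hy
    obtain rfl := hmid _ x hx
    rcases hX₃ y hy with ⟨j, hj, hj', rfl⟩ | ⟨j, hj, rfl⟩
    · refine ⟨hwp j hj, fun e => ?_⟩
      have := hp j (by omega) e
      omega
    · exact ⟨hwq j hj, hq j hj⟩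

/-- Rerouting the second path through a vertex `x` that has two far neighbors on it. -/
theorem reroute (h : HolePair G n p m q) {x : V} (hlr : l₂ + 2 ≤ r₂) (hp₂ : 0 < l₂)
    (hl₂ : r₂ < m) (hxp : ∀ i ≤ n, x ≠ p i) (hxq : ∀ i ≤ m, x ≠ q i)
    (hp : ∀ i ≤ n, ¬ G.Adj x (p i)) (hq : ∀ i ≤ m, G.Adj x (q i) → l₂ ≤ i ∧ i ≤ r₂)
    (el : G.Adj x (q l₂)) (er : G.Adj x (q r₂)) :
    ∃ (m' : ℕ) (q' : ℕ → V), HolePair G n p m' q' ∧ m' + r₂ = m + l₂ + 2 ∧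
      (∀ j ≤ l₂, q' j = q j) ∧ q' (l₂ + 1) = x ∧ ∀ j, q' (j + (l₂ + 2)) = q (j + r₂) := by
  have h2 := h.two_le₂
  have hA : IndPath G (l₂ + 0 + 1) fun k => if k ≤ l₂ then q k else x := by
    refine (h.path₂.mono (m := l₂) (by omega)).append (indPath_zero fun _ => x)
      (fun i j hi _ e => hxq i (by omega) e.symm) fun i j hi hj => ?_
    constructor
    · intro e
      have := (hq i (by omega) e.symm).1
      omega
    · rintro ⟨rfl, -⟩
      exact el.symm
  have hB := hA.append (m := m - r₂) (h.path₂.shift (a := r₂) (by omega)) ?_ ?_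
  · refine ⟨l₂ + 1 + (m - r₂) + 1, fun k => if k ≤ l₂ then q k else if k = l₂ + 1 then x else
      q (k - (l₂ + 2) + r₂), ⟨h.path₁, ?_, ?_, ?_, h.two_le₁, by omega, ?_⟩, by omega, ?_, ?_, ?_⟩
    · convert hB using 2 with k
      split_ifs <;> first | rfl | omega
    · simpa using h.start
    · rw [if_neg (by omega), if_neg (by omega), h.finish]
      congr 1
      omega
    · intro i j hi hi' hj hj'
      split_ifs with h3 h4
      · exact h.interior i j hi hi' hj (by omega)
      · exact ⟨(hxp i hi'.le).symm, fun e => hp i hi'.le e.symm⟩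
      · exact h.interior i _ hi hi' (by omega) (by omega)
    · intro j hj
      simp [hj]
    · simp
    · intro j
      dsimp only
      rw [if_neg (by omega), if_neg (by omega), Nat.add_sub_cancel]
  · intro i j hi hj e
    split_ifs at e
    · have := h.path₂.inj _ _ (by omega) (by omega) e; omega
    · exact hxq _ (by omega) e
  · intro i j hi hj
    split_ifs with h3
    · rw [h.path₂.adj _ _ (by omega) (by omega)]; omega
    · obtain rfl : i = l₂ + 0 + 1 := by omega
      constructor
      · intro e
        have := (hq _ (by omega) e).2
        omega
      · rintro ⟨-, rfl⟩
        rwa [Nat.zero_add]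

theorem exists_eq_of_reroute {m' : ℕ} {q' : ℕ → V} (hm : m' + r₂ = m + l₂ + 2) (hl₂ : l₂ ≤ m)
    (hlo : ∀ j ≤ l₂, q' j = q j) (hhi : ∀ j, q' (j + (l₂ + 2)) = q (j + r₂)) {j : ℕ}
    (hj : j ≤ m') (hne : j ≠ l₂ + 1) : ∃ k ≤ m, q' j = q k ∧
      (j ≤ l₂ ∧ k = j ∨ l₂ + 2 ≤ j ∧ k + (l₂ + 2) = j + r₂) := by
  rcases lt_or_ge l₂ j with h | h
  · obtain ⟨k, rfl⟩ : ∃ k, j = k + (l₂ + 2) := ⟨j - (l₂ + 2), by omega⟩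
    exact ⟨k + r₂, by omega, hhi k, by omega⟩
  · exact ⟨j, by omega, hlo j h, by omega⟩

theorem false_of_wide_wide (h : HolePair G n p m q) (hG : MemC G) (hw : w₁ ≠ w₂)
    (hadj : G.Adj w₁ w₂) (a₁ : Attach G n p C w₁ l₁ r₁) (a₂ : Attach G m q C w₂ l₂ r₂)
    (hlr₁ : l₁ + 2 ≤ r₁) (hlr₂ : l₂ + 2 ≤ r₂) : False := by
  have hl₁ := a₁.lt
  have hp₁ := a₁.pos
  have hl₂ := a₂.lt
  have hne₁ := a₁.ne w₁ a₁.mem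
  have hq₁ : ∀ i ≤ m, ¬ G.Adj w₁ (q i) := fun i hi e => hw (a₂.nbr w₁ a₁.mem i hi e).1
  have hq₂ : ∀ i ≤ n, ¬ G.Adj w₂ (p i) := fun i hi e => hw (a₁.nbr w₂ a₂.mem i hi e).1.symm
  have h0 : ¬ G.Adj w₁ (p 0) := fun e => by have := a₁.nbr w₁ a₁.mem 0 (by omega) e; omega
  have hn : ¬ G.Adj w₁ (p n) := fun e => by have := a₁.nbr w₁ a₁.mem n (by omega) e; omega
  have hsub : ({l₁, r₁} : Set ℕ) ⊆ nbrIdx G n p w₁ := by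
    rintro i (rfl | rfl)
    exacts [⟨by omega, a₁.adj_left⟩, ⟨by omega, a₁.adj_right⟩]
  have hc2 : 2 ≤ (nbrIdx G n p w₁).ncard := by
    have := Set.ncard_le_ncard hsub (nbrIdx_finite _ _ _)
    rwa [Set.ncard_pair (by omega)] at this
  rcases hc2.eq_or_lt with hc | hc
  · refine hG.2.1 (h.hasTheta_of_pair hlr₁ hp₁ hl₁ hne₁ (a₂.ne w₁ a₁.mem) hq₁ a₁.adj_left
      a₁.adj_right fun i hi e => ?_)
    have heq := Set.eq_of_subset_of_ncard_le hsub
      (by rw [← hc, Set.ncard_pair (by omega)]) (nbrIdx_finite _ _ _)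
    have : i ∈ ({l₁, r₁} : Set ℕ) := by rw [heq]; exact ⟨hi, e⟩
    simpa using this
  · have hE : nbrIdx G m q w₁ = ∅ := by
      ext i
      simp only [mem_empty_iff_false, iff_false]
      exact fun hi => hq₁ i hi.1 hi.2
    have hodd : ¬ Even (nbrIdx G n p w₁).ncard := by
      have := h.not_even hG hne₁ (a₂.ne w₁ a₁.mem) h0 hn
      rw [hE, Set.ncard_empty, add_zero] at this
      exact this hc
    obtain ⟨m', q', h', hm', hlo, hx, hhi⟩ := h.reroute hlr₂ a₂.pos a₂.lt (a₁.ne w₂ a₂.mem)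
      (a₂.ne w₂ a₂.mem) hq₂ (fun i hi e => (a₂.nbr w₂ a₂.mem i hi e).2) a₂.adj_left a₂.adj_right
    have hE' : nbrIdx G m' q' w₁ = {l₂ + 1} := by
      ext i
      simp only [mem_singleton_iff]
      constructor
      · rintro ⟨hi, e⟩
        by_contra hne
        obtain ⟨k, hk, hk', -⟩ := exists_eq_of_reroute hm' (by omega) hlo hhi hi hne
        exact hq₁ k hk (hk' ▸ e)
      · rintro rfl
        exact ⟨by omega, hx.symm ▸ hadj⟩
    have := h'.not_even hG hne₁ (fun i hi => ?_) h0 hn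
    · rw [hE', Set.ncard_singleton] at this
      refine this (by omega) ?_
      rw [Nat.even_add_one]
      exact hodd
    · by_cases hi' : i = l₂ + 1
      · rw [hi', hx]; exact hw
      · obtain ⟨k, hk, hk', -⟩ := exists_eq_of_reroute hm' (by omega) hlo hhi hi hi'
        rw [hk']
        exact a₂.ne w₁ a₁.mem k hk

/-- A connected set attached to both paths of a hole is attached by a triangle to exactly one
of them. -/
theorem attach_cases (h : HolePair G n p m q) (hG : MemC G) (hC : Linked G C)
    (a₁ : Attach G n p C w₁ l₁ r₁) (a₂ : Attach G m q C w₂ l₂ r₂) (hub : w₁ = w₂ → ¬ IsHub G w₁) :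
    (r₂ = l₂ + 1 ∧ (l₁ = r₁ ∨ (l₁ + 2 ≤ r₁ ∧ w₁ ≠ w₂))) ∨
      (r₁ = l₁ + 1 ∧ (l₂ = r₂ ∨ (l₂ + 2 ≤ r₂ ∧ w₁ ≠ w₂))) := by
  have hle₁ := a₁.le
  have hle₂ := a₂.le
  by_cases hw : w₁ = w₂
  · subst hw
    have hn₁ : ¬ l₁ + 2 ≤ r₁ := fun h' => hub rfl (h.isHub_of_wide a₁ a₂ h')
    have hn₂ : ¬ l₂ + 2 ≤ r₂ := fun h' => hub rfl (h.swap.isHub_of_wide a₂ a₁ h')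
    by_cases e₁ : l₁ = r₁ <;> by_cases e₂ : l₂ = r₂
    · subst e₁ e₂
      exact absurd (h.hasTheta_of_single hC a₁ a₂) hG.2.1
    · exact Or.inl ⟨by omega, Or.inl e₁⟩
    · exact Or.inr ⟨by omega, Or.inl e₂⟩
    · obtain rfl : r₁ = l₁ + 1 := by omega
      obtain rfl : r₂ = l₂ + 1 := by omega
      exact (h.false_of_double hG a₁ a₂).elim
  · by_cases t₁ : r₁ = l₁ + 1
    · by_cases t₂ : r₂ = l₂ + 1
      · subst t₁ t₂
        exact absurd (h.hasPrism hC hw a₁ a₂) hG.2.2.1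
      · refine Or.inr ⟨t₁, ?_⟩
        by_cases s : l₂ = r₂
        exacts [Or.inl s, Or.inr ⟨by omega, hw⟩]
    · by_cases t₂ : r₂ = l₂ + 1
      · refine Or.inl ⟨t₂, ?_⟩
        by_cases s : l₁ = r₁
        exacts [Or.inl s, Or.inr ⟨by omega, hw⟩]
      · exfalso
        by_cases s₁ : l₁ = r₁ <;> by_cases s₂ : l₂ = r₂
        · subst s₁ s₂
          exact hG.2.1 (h.hasTheta_of_single hC a₁ a₂)
        · subst s₁
          exact hG.2.1 (h.swap.hasTheta_of_wide_single hC (Ne.symm hw) a₂ a₁ (by omega))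
        · subst s₂
          exact hG.2.1 (h.hasTheta_of_wide_single hC hw a₁ a₂ (by omega))
        · by_cases hadj : G.Adj w₁ w₂
          · exact h.false_of_wide_wide hG hw hadj a₁ a₂ (by omega) (by omega)
          · exact hG.2.1 (h.hasTheta_of_wide_wide hC hw hadj a₁ a₂ (by omega) (by omega))

end HolePair

end Wheels

section Pyramid

variable {V : Type} {G : SimpleGraph V}

theorem Attach.mono {n l r : ℕ} {p : ℕ → V} {C C' : Set V} {w : V} (a : Attach G n p C w l r)
    (h : C' ⊆ C) (hw : w ∈ C') : Attach G n p C' w l r :=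
  ⟨hw, fun x hx => a.ne x (h hx), fun x hx => a.nbr x (h hx), a.adj_left, a.adj_right, a.le,
    a.pos, a.lt⟩

namespace HolePair

variable {n m : ℕ} {p q : ℕ → V}

theorem containsGenPyramid {t : ℕ} (h : HolePair G n p m q) (C : ℕ → Set V)
    (w₁ w₂ : ℕ → V) (l z : ℕ → ℕ) (hC : ∀ i < t, Linked G (C i))
    (hap : ∀ i j, i < j → j < t → Apart G (C i) (C j))
    (a₁ : ∀ i < t, Attach G n p (C i) (w₁ i) (l i) (l i + 1))
    (a₂ : ∀ i < t, Attach G m q (C i) (w₂ i) (z i) (z i))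
    (hl : ∀ i j, i < j → j < t → l i + 1 < l j) (hz : ∀ i j, i < j → j < t → z i ≤ z j) :
    ContainsGenPyramid G t := by
  have h1 := h.two_le₁
  have h2 := h.two_le₂
  have hex : ∀ i : Fin t, ∃ (k : ℕ) (f : ℕ → V), IndPath G k f ∧ f 0 = w₁ i ∧ f k = w₂ i ∧
      ∀ u ≤ k, f u ∈ C i := fun i => (hC i i.isLt).exists_path (a₁ i i.isLt).mem (a₂ i i.isLt).mem
  choose k f hf h0 hk hfC using hex
  refine ⟨n + 1, m - 1, fun i => p i.val, fun j => q (j.val + 1), fun i => k i + 1,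
    fun i u => f i u.val, fun i => l i, fun i => z i - 1, by omega, by omega, by omega,
    h.path₁.isPathEmb, ?_, ?_, ?_, fun i => Nat.succ_pos _, fun i => (hf i).isPathEmb, ?_, ?_,
    ?_, ?_, ?_, ?_, ?_, ?_, ?_⟩
  · refine ⟨fun i j e => ?_, fun i j => ?_⟩
    · have := h.path₂.inj _ _ (by omega) (by omega) e
      exact Fin.ext (by omega)
    · rw [h.path₂.adj _ _ (by omega) (by omega)]; omega
  · intro i j e
    rw [h.eq_iff (by omega) (by omega)] at e
    omega
  · intro i j
    rw [h.adj_iff (by omega) (by omega)]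
    omega
  · exact fun i u j => (a₁ i i.isLt).ne _ (hfC i u (Nat.lt_succ_iff.1 u.isLt)) j (by omega)
  · exact fun i u j => (a₂ i i.isLt).ne _ (hfC i u (Nat.lt_succ_iff.1 u.isLt)) _ (by omega)
  · intro i i' hne u u'
    have hu := hfC i u (Nat.lt_succ_iff.1 u.isLt)
    have hu' := hfC i' u' (Nat.lt_succ_iff.1 u'.isLt)
    rcases lt_or_gt_of_ne (fun e => hne (Fin.ext e) : i.val ≠ i'.val) with hlt | hlt
    · exact hap i i' hlt i'.isLt _ hu _ hu'
    · exact (hap i' i hlt i.isLt).symm _ hu _ hu'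
  · intro i
    have := (a₁ i i.isLt).pos
    have := (a₁ i i.isLt).lt
    dsimp only
    omega
  · intro i u j
    dsimp only
    have hu' := Nat.lt_succ_iff.1 u.isLt
    constructor
    · intro e
      obtain ⟨hw, hlo⟩ := (a₁ i i.isLt).nbr _ (hfC i u hu') j (by omega) e
      exact ⟨(hf i).inj _ _ hu' (by omega) (hw.trans (h0 i).symm), by omega⟩
    · rintro ⟨hu, hj⟩
      rw [hu, h0]
      rcases hj with hj | hj <;> rw [hj]
      exacts [(a₁ i i.isLt).adj_left, (a₁ i i.isLt).adj_right]
  · intro i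
    have := (a₂ i i.isLt).pos
    have := (a₂ i i.isLt).lt
    dsimp only
    omega
  · intro i u j
    dsimp only
    have hu' := Nat.lt_succ_iff.1 u.isLt
    have := (a₂ i i.isLt).pos
    constructor
    · intro e
      obtain ⟨hw, hlo⟩ := (a₂ i i.isLt).nbr _ (hfC i u hu') _ (by omega) e
      have := (hf i).inj _ _ hu' le_rfl (hw.trans (hk i).symm)
      omega
    · rintro ⟨hu, hj⟩
      have hu : u.val = k i := hu
      have hj : j.val + 1 = z i := by omega
      rw [hu, hk, hj]
      exact (a₂ i i.isLt).adj_left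
  · exact fun i i' hlt => hl i i' hlt i'.isLt
  · intro i i' hle
    rcases (show i.val ≤ i'.val from hle).eq_or_lt with e | hlt
    · dsimp only
      rw [e]
    · exact Nat.sub_le_sub_right (hz i i' hlt i'.isLt) 1

/-- Rerouting the second path through the attachments of the sets `C 0, …, C (s - 1)`. -/
theorem exists_reroute {t : ℕ} (h : HolePair G n p m q) (C : ℕ → Set V)
    (w₁ w₂ : ℕ → V) (l₁ l₂ r₂ : ℕ → ℕ) (hC : ∀ i < t, Linked G (C i))
    (hap : ∀ i j, i < j → j < t → Apart G (C i) (C j))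
    (a₁ : ∀ i < t, Attach G n p (C i) (w₁ i) (l₁ i) (l₁ i + 1))
    (a₂ : ∀ i < t, Attach G m q (C i) (w₂ i) (l₂ i) (r₂ i))
    (hwide : ∀ i < t, l₂ i + 2 ≤ r₂ i ∧ w₁ i ≠ w₂ i)
    (hlr : ∀ i j, i < j → j < t → r₂ i < l₂ j) {s : ℕ} (hs : s ≤ t) :
    ∃ (m' : ℕ) (q' : ℕ → V) (C' : ℕ → Set V) (w : ℕ → V) (l r : ℕ → ℕ), HolePair G n p m' q' ∧
      (∀ i < t, C' i ⊆ C i ∧ Linked G (C' i) ∧ Attach G n p (C' i) (w₁ i) (l₁ i) (l₁ i + 1) ∧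
        Attach G m' q' (C' i) (w i) (l i) (r i) ∧ (i < s → l i = r i) ∧
        (s ≤ i → l i + 2 ≤ r i ∧ w₁ i ≠ w i)) ∧
      ∀ i j, i < j → j < t → r i < l j := by
  induction s with
  | zero =>
    exact ⟨m, q, C, w₂, l₂, r₂, h, fun i hi => ⟨Subset.rfl, hC i hi, a₁ i hi, a₂ i hi, by omega,
      fun _ => hwide i hi⟩, hlr⟩
  | succ s ih =>
    obtain ⟨m', q', C', w, l, r, h', hall, hord⟩ := ih (by omega)
    obtain ⟨hsub, hlink, b₁, b₂, -, hw⟩ := hall s (by omega)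
    obtain ⟨hwide', hne⟩ := hw le_rfl
    have hlt := b₂.lt
    have hpos := b₂.pos
    obtain ⟨m'', q'', h'', hm'', hlo, hx, hhi⟩ := h'.reroute hwide' b₂.pos b₂.lt
      (b₁.ne _ b₂.mem) (b₂.ne _ b₂.mem) (fun i hi e => hne (b₁.nbr _ b₂.mem i hi e).1.symm)
      (fun i hi e => (b₂.nbr _ b₂.mem i hi e).2) b₂.adj_left b₂.adj_right
    have hidx : ∀ {j}, j ≤ m'' → j ≠ l s + 1 → ∃ k ≤ m', q'' j = q' k ∧
        (j ≤ l s ∧ k = j ∨ l s + 2 ≤ j ∧ k + (l s + 2) = j + r s) :=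
      fun hj hne => exists_eq_of_reroute hm'' (by omega) hlo hhi hj hne
    have hex : ∃ c ∈ C' s, G.Adj (w s) c := by
      by_contra! hno
      have : w₁ s ∈ ({w s} : Set V) := hlink.mem_of_closed b₂.mem b₁.mem rfl
        fun x _ hxw y hy e => absurd ((mem_singleton_iff.1 hxw) ▸ e) (hno y hy)
      exact hne this
    obtain ⟨c, hc, hwc⟩ := hex
    obtain ⟨B, hBC, b, hbB, hwB, hBlink, hpb, hBuniq, hBnbr⟩ :=
      hlink.first_hit b₁.mem hc (fun v => G.Adj (w s) v) hwc
    have hwsB : w s ∉ B := by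
      intro hmem
      rcases hBnbr _ hmem with e | ⟨y, -, hy, e⟩
      exacts [hne e.symm, hy e.symm]
    have hother : ∀ i < t, i ≠ s → ∀ x ∈ C' i, x ≠ w s ∧ ¬ G.Adj x (w s) := by
      intro i hi his x hxi
      rcases lt_or_gt_of_ne his with hlt | hlt
      · exact hap i s hlt (by omega) x ((hall i hi).1 hxi) _ (hsub b₂.mem)
      · exact (hap s i hlt hi).symm x ((hall i hi).1 hxi) _ (hsub b₂.mem)
    have hatt : ∀ i < t, i ≠ s → ∀ a d : ℕ, (i < s → a = l i ∧ d = r i) →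
        (s < i → a + r s = l i + (l s + 2) ∧ d + r s = r i + (l s + 2)) →
        Attach G m'' q'' (C' i) (w i) a d := by
      intro i hi his a d hlow hhigh
      obtain ⟨-, -, -, c₂, -⟩ := hall i hi
      have hle := c₂.le
      have hlt' := c₂.lt
      have hpos' := c₂.pos
      have hcase : (i < s ∧ r i < l s) ∨ (s < i ∧ r s < l i) := by
        rcases lt_or_gt_of_ne his with hlt | hlt
        exacts [Or.inl ⟨hlt, hord i s hlt (by omega)⟩, Or.inr ⟨hlt, hord s i hlt hi⟩]
      have hne' : ∀ a', (l i ≤ a' ∧ a' ≤ r i) → ∀ b', (i < s → b' = a') →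
          (s < i → b' + r s = a' + (l s + 2)) → q'' b' = q' a' := by
        intro a' ha' b' hb₁ hb₂
        rcases hcase with ⟨hc₁, hc₂⟩ | ⟨hc₁, hc₂⟩
        · rw [hb₁ hc₁, hlo _ (by omega)]
        · have := hb₂ hc₁
          obtain ⟨k, rfl⟩ : ∃ k, b' = k + (l s + 2) := ⟨b' - (l s + 2), by omega⟩
          rw [hhi]
          congr 1
          omega
      refine ⟨c₂.mem, fun x hxi j hj => ?_, fun x hxi j hj e => ?_, ?_, ?_, by omega, by omega,
        by omega⟩
      · by_cases hjs : j = l s + 1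
        · rw [hjs, hx]; exact (hother i hi his x hxi).1
        · obtain ⟨k, hk, hjk, -⟩ := hidx hj hjs
          rw [hjk]; exact c₂.ne x hxi k hk
      · by_cases hjs : j = l s + 1
        · rw [hjs, hx] at e; exact absurd e (hother i hi his x hxi).2
        · obtain ⟨k, hk, hjk, hk'⟩ := hidx hj hjs
          rw [hjk] at e
          have := c₂.nbr x hxi k hk e
          refine ⟨this.1, ?_⟩
          omega
      · rw [hne' (l i) (by omega) a (by omega) (by omega)]
        exact c₂.adj_left
      · rw [hne' (r i) (by omega) d (by omega) (by omega)]
        exact c₂.adj_right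
    have hnew : Attach G m'' q'' B b (l s + 1) (l s + 1) := by
      refine ⟨hbB, fun x hxB j hj => ?_, fun x hxB j hj e => ?_, ?_, ?_, le_rfl, by omega,
        by omega⟩
      · by_cases hjs : j = l s + 1
        · rw [hjs, hx]; rintro rfl; exact hwsB hxB
        · obtain ⟨k, hk, hjk, -⟩ := hidx hj hjs
          rw [hjk]; exact b₂.ne x (hBC hxB) k hk
      · by_cases hjs : j = l s + 1
        · rw [hjs, hx] at e
          exact ⟨hBuniq x hxB e.symm, by omega⟩
        · obtain ⟨k, hk, hjk, hk'⟩ := hidx hj hjs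
          rw [hjk] at e
          have := (b₂.nbr x (hBC hxB) k hk e).1
          exact absurd (this ▸ hxB) hwsB
      · rw [hx]; exact hpb.symm
      · rw [hx]; exact hpb.symm
    refine ⟨m'', q'', fun i => if i = s then B else C' i, fun i => if i = s then b else w i,
      fun i => if i < s then l i else if i = s then l s + 1 else l i + (l s + 2) - r s,
      fun i => if i < s then r i else if i = s then l s + 1 else r i + (l s + 2) - r s, h'',
      fun i hi => ?_, fun i j hij hj => ?_⟩
    · by_cases his : i = s
      · subst his
        simp only [lt_irrefl, if_false, if_true]
        exact ⟨hBC.trans hsub, hBlink, b₁.mono hBC hwB, hnew, fun _ => trivial, by omega⟩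
      · obtain ⟨d₁, d₂, d₃, d₄, d₅, d₆⟩ := hall i hi
        simp only [his, if_false]
        refine ⟨d₁, d₂, d₃, hatt i hi his _ _ ?_ ?_, ?_, ?_⟩
        · intro hlt; simp [hlt]
        · intro hlt
          have := hord s i hlt hi
          have := d₄.le
          rw [if_neg (by omega), if_neg (by omega)]
          omega
        · intro hlt
          have := d₅ (by omega)
          split_ifs <;> omega
        · intro hlt
          have h6 := d₆ (by omega)
          have := hord s i (by omega) hi
          refine ⟨?_, h6.2⟩
          rw [if_neg (by omega), if_neg (by omega)]
          omega
    · have h1 := hord i j hij hj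
      have h2 := (hall i (by omega)).2.2.2.1.le
      have h3 := (hall j hj).2.2.2.1.le
      have h4 : s < j → r s < l j := fun hlt => hord s j hlt hj
      have h5 : i < s → r i < l s := fun hlt => hord i s hlt (by omega)
      have h6 : s < i → r s < l i := fun hlt => hord s i hlt (by omega)
      dsimp only
      split_ifs <;> omega

end HolePair

end Pyramid

section Side

variable {V : Type} {G : SimpleGraph V}

/-- A path in `D` together with disjoint connected sets `B i` containing `y i`, attached along
the path in the order of the indices. -/
structure Side (G : SimpleGraph V) (D : Set V) (N : ℕ) (y : ℕ → V) (n : ℕ) (P w : ℕ → V)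
    (B : ℕ → Set V) (l r : ℕ → ℕ) : Prop where
  path : IndPath G n P
  path_mem : ∀ k ≤ n, P k ∈ D
  mem : ∀ i < N, y i ∈ B i
  linked : ∀ i < N, Linked G (B i)
  sub : ∀ i < N, B i ⊆ insert (y i) D
  w_mem : ∀ i < N, w i ∈ B i
  ne : ∀ i < N, ∀ x ∈ B i, ∀ k ≤ n, x ≠ P k
  nbr : ∀ i < N, ∀ x ∈ B i, ∀ k ≤ n, G.Adj x (P k) → x = w i ∧ l i ≤ k ∧ k ≤ r i
  adj_left : ∀ i < N, G.Adj (w i) (P (l i))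
  adj_right : ∀ i < N, G.Adj (w i) (P (r i))
  le : ∀ i < N, l i ≤ r i
  le_length : ∀ i < N, r i ≤ n
  apart : ∀ i j, i < j → j < N → Apart G (B i) (B j)
  order : ∀ i j, i < j → j < N → r i < l j ∨ (l i = r i ∧ r i = l j ∧ l j = r j)

namespace Side

variable {D : Set V} {N n : ℕ} {y P w : ℕ → V} {B : ℕ → Set V} {l r : ℕ → ℕ}

theorem comp (h : Side G D N y n P w B l r) {M : ℕ} {e : ℕ → ℕ} (he : ∀ i < M, e i < N)
    (hmono : ∀ i j, i < j → j < M → e i < e j) :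
    Side G D M (fun i => y (e i)) n P (fun i => w (e i)) (fun i => B (e i)) (fun i => l (e i))
      (fun i => r (e i)) where
  path := h.path
  path_mem := h.path_mem
  mem i hi := h.mem _ (he i hi)
  linked i hi := h.linked _ (he i hi)
  sub i hi := h.sub _ (he i hi)
  w_mem i hi := h.w_mem _ (he i hi)
  ne i hi := h.ne _ (he i hi)
  nbr i hi := h.nbr _ (he i hi)
  adj_left i hi := h.adj_left _ (he i hi)
  adj_right i hi := h.adj_right _ (he i hi)
  le i hi := h.le _ (he i hi)
  le_length i hi := h.le_length _ (he i hi)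
  apart i j hij hj := h.apart _ _ (hmono i j hij hj) (he j hj)
  order i j hij hj := h.order _ _ (hmono i j hij hj) (he j hj)

theorem reverse (h : Side G D N y n P w B l r) :
    Side G D N (fun i => y (N - 1 - i)) n (fun k => P (n - k)) (fun i => w (N - 1 - i))
      (fun i => B (N - 1 - i)) (fun i => n - r (N - 1 - i)) (fun i => n - l (N - 1 - i)) where
  path := h.path.reverse
  path_mem k _ := h.path_mem _ (by omega)
  mem i hi := h.mem _ (by omega)
  linked i hi := h.linked _ (by omega)
  sub i hi := h.sub _ (by omega)
  w_mem i hi := h.w_mem _ (by omega)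
  ne i hi x hx k _ := h.ne _ (by omega) x hx _ (by omega)
  nbr i hi x hx k hk e := by
    have := h.nbr _ (by omega) x hx _ (by omega) e
    exact ⟨this.1, by omega, by omega⟩
  adj_left i hi := by
    have := h.le_length (N - 1 - i) (by omega)
    rw [show n - (n - r (N - 1 - i)) = r (N - 1 - i) by omega]
    exact h.adj_right _ (by omega)
  adj_right i hi := by
    have := h.le_length (N - 1 - i) (by omega)
    have := h.le (N - 1 - i) (by omega)
    rw [show n - (n - l (N - 1 - i)) = l (N - 1 - i) by omega]
    exact h.adj_left _ (by omega)
  le i hi := by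
    have := h.le (N - 1 - i) (by omega)
    omega
  le_length i hi := by omega
  apart i j hij hj := (h.apart _ _ (by omega) (by omega)).symm
  order i j hij hj := by
    have h1 := h.order (N - 1 - j) (N - 1 - i) (by omega) (by omega)
    have h2 := h.le_length (N - 1 - i) (by omega)
    have h3 := h.le (N - 1 - i) (by omega)
    have h4 := h.le (N - 1 - j) (by omega)
    omega

/-- Extending the path of a side to a path between the first and the last of the vertices `y`. -/
theorem exists_path {K : ℕ} (h : Side G D (K + 1) y n P w B l r) (hK : 0 < K) :
    ∃ (m : ℕ) (E : ℕ → V) (l' r' : ℕ → ℕ), IndPath G m E ∧ 2 ≤ m ∧ E 0 = y 0 ∧ E m = y K ∧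
      (∀ k, 0 < k → k < m → E k ∈ D) ∧
      (∀ i, 0 < i → i < K → Attach G m E (B i) (w i) (l' i) (r' i)) ∧
      ∀ i j, i < j → 0 < i → j < K →
        r' i < l' j ∨ (l' i = r' i ∧ r' i = l' j ∧ l' j = r' j) := by
  obtain ⟨a, f, hf, f0, fa, fB⟩ := (h.linked 0 (by omega)).exists_path (h.mem 0 (by omega))
    (h.w_mem 0 (by omega))
  obtain ⟨b, g, hg, g0, gb, gB⟩ := (h.linked K (by omega)).exists_path (h.w_mem K (by omega))
    (h.mem K (by omega))
  have hrl : ∀ i j, i < j → j ≤ K → r i ≤ l j := by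
    intro i j hij hj
    have := h.order i j hij (by omega)
    omega
  have h0K := hrl 0 K hK le_rfl
  have hle0 := h.le 0 (by omega)
  have hleK := h.le K (by omega)
  have hlenK := h.le_length K (by omega)
  have hap := h.apart 0 K hK (by omega)
  have hP := h.path.shift (m := l K - r 0) (a := r 0) (by omega)
  have h1 := hf.append hP (fun i j hi hj => h.ne 0 (by omega) _ (fB i hi) _ (by omega)) (by
    intro i j hi hj
    constructor
    · intro e
      have := h.nbr 0 (by omega) _ (fB i hi) _ (by omega) e
      exact ⟨hf.inj _ _ hi le_rfl (this.1.trans fa.symm), by omega⟩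
    · rintro ⟨rfl, rfl⟩
      rw [fa, Nat.zero_add]
      exact h.adj_right 0 (by omega))
  have h2 := h1.append hg (by
    intro i j hi hj
    split_ifs with h3
    · exact (hap _ (fB i h3) _ (gB j hj)).1
    · exact (h.ne K (by omega) _ (gB j hj) _ (by omega)).symm) (by
    intro i j hi hj
    split_ifs with h3
    · simp only [(hap _ (fB i h3) _ (gB j hj)).2, false_iff]
      omega
    · constructor
      · intro e
        have := h.nbr K (by omega) _ (gB j hj) _ (by omega) e.symm
        have := hg.inj _ _ hj (Nat.zero_le _) (this.1.trans g0.symm)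
        omega
      · rintro ⟨rfl, rfl⟩
        rw [g0, show a + (l K - r 0) + 1 - (a + 1) + r 0 = l K by omega]
        exact (h.adj_left K (by omega)).symm)
  set E : ℕ → V := fun k => if k ≤ a + (l K - r 0) + 1 then
    (if k ≤ a then f k else P (k - (a + 1) + r 0)) else g (k - (a + (l K - r 0) + 1 + 1)) with hE
  have hcase : ∀ k ≤ a + (l K - r 0) + 1 + b + 1, (k ≤ a ∧ E k ∈ B 0) ∨
      (∃ j, r 0 ≤ j ∧ j ≤ l K ∧ k + r 0 = j + (a + 1) ∧ E k = P j) ∨ E k ∈ B K := by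
    intro k hk
    rw [hE]
    dsimp only
    split_ifs with h3 h4
    · exact Or.inl ⟨h4, fB k h4⟩
    · exact Or.inr (Or.inl ⟨_, by omega, by omega, by omega, rfl⟩)
    · exact Or.inr (Or.inr (gB _ (by omega)))
  have hEP : ∀ j, r 0 ≤ j → j ≤ l K → E (j + (a + 1) - r 0) = P j := by
    intro j hj hj'
    rw [hE]
    dsimp only
    rw [if_pos (by omega), if_neg (by omega)]
    congr 1
    omega
  have hE0 : E 0 = y 0 := by simp [hE, f0]
  have hEm : E (a + (l K - r 0) + 1 + b + 1) = y K := by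
    rw [hE]
    dsimp only
    rw [if_neg (by omega), ← gb]
    congr 1
    omega
  refine ⟨_, E, fun i => l i + (a + 1) - r 0, fun i => r i + (a + 1) - r 0, h2, by omega, hE0,
    hEm, ?_, ?_, ?_⟩
  · intro k hk hk'
    rcases hcase k hk'.le with ⟨-, h3⟩ | ⟨j, -, hj, -, h3⟩ | h3
    · rcases h.sub 0 (by omega) h3 with h4 | h4
      · have := h2.inj k 0 hk'.le (by omega) (h4.trans hE0.symm)
        omega
      · exact h4
    · rw [h3]; exact h.path_mem j (by omega)
    · rcases h.sub K (by omega) h3 with h4 | h4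
      · have := h2.inj k _ hk'.le le_rfl (h4.trans hEm.symm)
        omega
      · exact h4
  · intro i hi hiK
    have h3 := hrl 0 i hi hiK.le
    have h4 := hrl i K hiK le_rfl
    have h5 := h.le i (by omega)
    show Attach G _ E (B i) (w i) (l i + (a + 1) - r 0) (r i + (a + 1) - r 0)
    refine ⟨h.w_mem i (by omega), ?_, ?_, ?_, ?_, by omega, by omega, by omega⟩
    · intro x hx k hk
      rcases hcase k hk with ⟨-, h3⟩ | ⟨j, -, hj, -, h3⟩ | h3
      · exact ((h.apart 0 i hi (by omega)) _ h3 _ hx).1.symm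
      · rw [h3]; exact h.ne i (by omega) x hx j (by omega)
      · exact ((h.apart i K hiK (by omega)) _ hx _ h3).1
    · intro x hx k hk e
      rcases hcase k hk with ⟨-, h3⟩ | ⟨j, -, hj, hjk, h3⟩ | h3
      · exact absurd e.symm ((h.apart 0 i hi (by omega)) _ h3 _ hx).2
      · rw [h3] at e
        have := h.nbr i (by omega) x hx j (by omega) e
        exact ⟨this.1, by omega, by omega⟩
      · exact absurd e ((h.apart i K hiK (by omega)) _ hx _ h3).2
    · rw [hEP _ h3 (by omega)]; exact h.adj_left i (by omega)
    · rw [hEP _ (by omega) h4]; exact h.adj_right i (by omega)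
  · intro i j hij hi hj
    have h3 := h.order i j hij (by omega)
    have h4 := hrl 0 i hi (by omega)
    have h5 := hrl 0 j (by omega) (by omega)
    have h6 := h.le i (by omega)
    dsimp only
    omega

end Side

end Side

section Combinatorics

/-- Ramsey's theorem for graphs. -/
theorem exists_clique_or_stable (a b : ℕ) : ∃ n : ℕ, ∀ (V : Type) (G : SimpleGraph V)
    (S : Finset V), n ≤ S.card → (∃ T ⊆ S, G.IsNClique a T) ∨
      ∃ T ⊆ S, T.card = b ∧ ∀ x ∈ T, ∀ y ∈ T, x ≠ y → ¬ G.Adj x y := by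
  classical
  induction a generalizing b with
  | zero => exact ⟨0, fun V G S _ => Or.inl ⟨∅, by simp, by simp [SimpleGraph.isNClique_iff]⟩⟩
  | succ a iha =>
    induction b with
    | zero => exact ⟨0, fun V G S _ => Or.inr ⟨∅, by simp, by simp⟩⟩
    | succ b ihb =>
      obtain ⟨n₁, h₁⟩ := iha (b + 1)
      obtain ⟨n₂, h₂⟩ := ihb
      refine ⟨n₁ + n₂ + 1, fun V G S hS => ?_⟩
      obtain ⟨v, hv⟩ := Finset.card_pos.1 (show 0 < S.card by omega)
      have hcard := Finset.card_filter_add_card_filter_not (s := S.erase v) (G.Adj v)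
      rw [Finset.card_erase_of_mem hv] at hcard
      by_cases hn : n₁ ≤ ((S.erase v).filter (G.Adj v)).card
      · rcases h₁ V G _ hn with ⟨T, hT, hT'⟩ | ⟨T, hT, hT'⟩
        · refine Or.inl ⟨insert v T, ?_, hT'.insert fun x hx => (Finset.mem_filter.1 (hT hx)).2⟩
          exact Finset.insert_subset hv fun x hx =>
            Finset.mem_of_mem_erase (Finset.mem_filter.1 (hT hx)).1
        · exact Or.inr ⟨T, fun x hx =>
            Finset.mem_of_mem_erase (Finset.mem_filter.1 (hT hx)).1, hT'⟩
      · rcases h₂ V G ((S.erase v).filter fun x => ¬ G.Adj v x) (by omega) with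
          ⟨T, hT, hT'⟩ | ⟨T, hT, hT', hTs⟩
        · exact Or.inl ⟨T, fun x hx =>
            Finset.mem_of_mem_erase (Finset.mem_filter.1 (hT hx)).1, hT'⟩
        · have hvT : v ∉ T := fun h => by simpa using (Finset.mem_filter.1 (hT h)).1
          have hTv : ∀ x ∈ T, ¬ G.Adj v x := fun x hx => (Finset.mem_filter.1 (hT hx)).2
          refine Or.inr ⟨insert v T, ?_, by rw [Finset.card_insert_of_notMem hvT, hT'], ?_⟩
          · exact Finset.insert_subset hv fun x hx =>
              Finset.mem_of_mem_erase (Finset.mem_filter.1 (hT hx)).1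
          · intro x hx y hy hxy
            rw [Finset.mem_insert] at hx hy
            rcases hx with rfl | hx <;> rcases hy with rfl | hy
            · exact absurd rfl hxy
            · exact hTv y hy
            · exact fun e => hTv x hx e.symm
            · exact hTs x hx y hy hxy

/-- A finite set of `N` elements enumerated by the natural numbers below `N`. -/
theorem Finset.exists_enum {ι : Type} (S : Finset ι) {N : ℕ} (hN : N ≤ S.card) (hne : S.Nonempty) :
    ∃ e : ℕ → ι, (∀ i, e i ∈ S) ∧ ∀ i j, i < N → j < N → e i = e j → i = j := by
  classical
  obtain ⟨a, ha⟩ := hne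
  refine ⟨fun i => if h : i < S.card then (S.equivFin.symm ⟨i, h⟩ : ι) else a, ?_, ?_⟩
  · intro i
    dsimp only
    split_ifs
    · exact (S.equivFin.symm _).2
    · exact ha
  · intro i j hi hj h
    dsimp only at h
    rw [dif_pos (by omega), dif_pos (by omega)] at h
    simpa using S.equivFin.symm.injective (Subtype.ext h)

/-- A finite set of natural numbers enumerated in increasing order. -/
theorem Finset.exists_increasing_enum (S : Finset ℕ) {N : ℕ} (hN : N ≤ S.card) :
    ∃ e : ℕ → ℕ, (∀ i < N, e i ∈ S) ∧ ∀ i j, i < j → j < N → e i < e j := by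
  refine ⟨fun i => if h : i < S.card then S.orderEmbOfFin rfl ⟨i, h⟩ else 0, ?_, ?_⟩
  · intro i hi
    dsimp only
    rw [dif_pos (by omega)]
    exact S.orderEmbOfFin_mem rfl _
  · intro i j hij hj
    dsimp only
    rw [dif_pos (by omega), dif_pos (by omega)]
    exact (S.orderEmbOfFin rfl).strictMono (by simpa using hij)

/-- Many intervals, at most `c` of them sharing a point, contain `N` pairwise disjoint ones. -/
theorem exists_disjoint_intervals {ι : Type} (l r : ι → ℕ) (c N : ℕ) (S : Finset ι)
    (hlr : ∀ i ∈ S, l i ≤ r i)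
    (hc : ∀ k, ∀ T ⊆ S, (∀ i ∈ T, l i ≤ k ∧ k ≤ r i) → T.card ≤ c) (hne : S.Nonempty)
    (hS : c * N ≤ S.card) :
    ∃ e : ℕ → ι, (∀ i < N, e i ∈ S) ∧ ∀ i j, i < j → j < N → r (e i) < l (e j) := by
  classical
  induction N generalizing S with
  | zero => exact ⟨fun _ => hne.choose, by omega, by omega⟩
  | succ N ih =>
    obtain ⟨a, ha, hmin⟩ := S.exists_min_image r hne
    by_cases hN : N = 0
    · subst hN
      exact ⟨fun _ => a, fun _ _ => ha, by omega⟩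
    have h1 : (S.filter fun i => l i ≤ r a).card ≤ c := hc (r a) _ (Finset.filter_subset _ _)
      fun i hi => ⟨(Finset.mem_filter.1 hi).2, hmin i (Finset.mem_filter.1 hi).1⟩
    have h2 := Finset.card_filter_add_card_filter_not (s := S) fun i => l i ≤ r a
    have hc0 : 1 ≤ c := hc (r a) {a} (by simpa using ha) (by simpa using hlr a ha)
    rw [Nat.mul_succ] at hS
    have h3 : 1 ≤ c * N := Nat.mul_pos hc0 (Nat.pos_of_ne_zero hN)
    obtain ⟨e, he, he'⟩ := ih (S.filter fun i => ¬ l i ≤ r a)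
      (fun i hi => hlr i (Finset.mem_filter.1 hi).1)
      (fun k T hT => hc k T (hT.trans (Finset.filter_subset _ _)))
      (Finset.card_pos.1 (by omega)) (by omega)
    refine ⟨fun i => if i = 0 then a else e (i - 1), ?_, ?_⟩
    · intro i hi
      dsimp only
      split_ifs with h
      · exact ha
      · exact (Finset.mem_filter.1 (he (i - 1) (by omega))).1
    · intro i j hij hj
      dsimp only
      rw [if_neg (show j ≠ 0 by omega)]
      split_ifs with h
      · have := (Finset.mem_filter.1 (he (j - 1) (by omega))).2
        omega
      · exact he' _ _ (by omega) (by omega)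

/-- In a rooted tree with at most `d` children at each vertex, let `S` be a large set of vertices
containing the root and all vertices with several children. Then some vertex of `S` has many
proper ancestors in `S`. -/
theorem exists_many_ancestors {V : Type} [Fintype V] (H S : Set V) (ρ : V) (δ : V → ℕ)
    (π : V → V) (hρ : ρ ∈ H) (hπ : ∀ x ∈ H, x ≠ ρ → π x ∈ H ∧ δ (π x) + 1 = δ x)
    (hδ : δ ρ = 0) (hSH : S ⊆ H) (hρS : ρ ∈ S)
    (hS : ∀ c ∈ H, ∀ c' ∈ H, c ≠ ρ → c' ≠ ρ → π c = π c' → π c ∉ S → c = c') (d : ℕ)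
    (hd : ∀ x ∈ H, {c | c ∈ H ∧ c ≠ ρ ∧ π c = x}.ncard ≤ d) (s : ℕ)
    (hs : ∑ i ∈ Finset.range s, d ^ i < S.ncard) :
    ∃ x ∈ S, s ≤ {k | k < δ x ∧ π^[k + 1] x ∈ S}.ncard := by
  classical
  set a : V → ℕ := fun x => ∑ k ∈ Finset.range (δ x), if π^[k + 1] x ∈ S then 1 else 0 with ha
  have haρ : a ρ = 0 := by simp [ha, hδ]
  have hstep : ∀ x ∈ H, x ≠ ρ → a x = a (π x) + if π x ∈ S then 1 else 0 := by
    intro x hx hxρ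
    simp only [ha, ← (hπ x hx hxρ).2, Finset.sum_range_succ', Function.iterate_succ_apply,
      Function.iterate_zero, id]
    rfl
  have hSH' : ∀ x ∈ S, x ∈ H := fun x hx => hSH hx
  have hkey : ∀ i, (Finset.univ.filter fun x => x ∈ S ∧ a x = i).card ≤
      (Finset.univ.filter fun x => x ∈ H ∧ a x = i ∧ (x = ρ ∨ π x ∈ S)).card := by
    intro i
    have h1 := Finset.card_filter_add_card_filter_not
      (s := Finset.univ.filter fun x => x ∈ H ∧ a x = i) fun x => x ∈ S
    have h2 := Finset.card_filter_add_card_filter_not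
      (s := Finset.univ.filter fun x => x ∈ H ∧ a x = i) fun x => x = ρ ∨ π x ∈ S
    have h3 : ((Finset.univ.filter fun x => x ∈ H ∧ a x = i).filter
        fun x => ¬ (x = ρ ∨ π x ∈ S)).card ≤
        ((Finset.univ.filter fun x => x ∈ H ∧ a x = i).filter fun x => x ∉ S).card := by
      refine Finset.card_le_card_of_injOn π ?_ ?_
      · intro x hx
        simp only [Finset.coe_filter, Finset.mem_filter, Finset.mem_univ, true_and,
          mem_ofPred_eq, not_or] at hx ⊢
        obtain ⟨⟨hxH, hxi⟩, hxρ, hxS⟩ := hx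
        rw [hstep x hxH hxρ, if_neg hxS] at hxi
        exact ⟨⟨(hπ x hxH hxρ).1, hxi⟩, hxS⟩
      · intro x hx x' hx' h
        simp only [Finset.coe_filter, Finset.mem_filter, Finset.mem_univ, true_and,
          mem_ofPred_eq, not_or] at hx hx'
        exact hS x hx.1.1 x' hx'.1.1 hx.2.1 hx'.2.1 h hx.2.2
    simp only [Finset.filter_filter] at h1 h2 h3
    have h4 : (Finset.univ.filter fun x => (x ∈ H ∧ a x = i) ∧ x ∈ S) =
        Finset.univ.filter fun x => x ∈ S ∧ a x = i := by
      ext x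
      have := hSH' x
      simp only [Finset.mem_filter, Finset.mem_univ, true_and]
      tauto
    simp only [and_assoc] at h1 h2 h3 h4
    rw [h4] at h1
    omega
  have hpow : ∀ i, (Finset.univ.filter fun x => x ∈ S ∧ a x = i).card ≤ d ^ i := by
    intro i
    induction i with
    | zero =>
      refine (hkey 0).trans ?_
      rw [pow_zero, Finset.card_le_one]
      have : ∀ x ∈ Finset.univ.filter fun x => x ∈ H ∧ a x = 0 ∧ (x = ρ ∨ π x ∈ S), x = ρ := by
        intro x hx
        simp only [Finset.mem_filter, Finset.mem_univ, true_and] at hx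
        by_contra hxρ
        have h1 := hstep x hx.1 hxρ
        rw [if_pos (hx.2.2.resolve_left hxρ)] at h1
        omega
      exact fun x hx y hy => (this x hx).trans (this y hy).symm
    | succ i ih =>
      refine (hkey (i + 1)).trans ?_
      rw [pow_succ']
      refine (Finset.card_le_mul_card_image_of_maps_to
        (t := Finset.univ.filter fun x => x ∈ S ∧ a x = i) (f := π) ?_ d ?_).trans
        (Nat.mul_le_mul_left d ih)
      · intro x hx
        simp only [Finset.mem_filter, Finset.mem_univ, true_and] at hx ⊢
        have hxρ : x ≠ ρ := by rintro rfl; omega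
        have h1 := hstep x hx.1 hxρ
        have h2 := hx.2.2.resolve_left hxρ
        rw [if_pos h2] at h1
        exact ⟨h2, by omega⟩
      · intro b hb
        simp only [Finset.mem_filter, Finset.mem_univ, true_and] at hb
        refine le_trans ?_ (hd b (hSH' b hb.1))
        rw [← Set.ncard_coe_finset]
        refine Set.ncard_le_ncard ?_ (Set.toFinite _)
        intro x hx
        simp only [Finset.coe_filter, Finset.mem_filter, Finset.mem_univ, true_and,
          mem_ofPred_eq] at hx ⊢
        refine ⟨hx.1.1, ?_, hx.2⟩
        rintro rfl
        omega
  by_contra! hcon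
  refine absurd hs (not_lt.2 ?_)
  have hlt : ∀ x ∈ S, a x < s := by
    intro x hx
    refine lt_of_le_of_lt (le_of_eq ?_) (hcon x hx)
    rw [ha]
    dsimp only
    rw [Finset.sum_boole, ← Set.ncard_coe_finset, Nat.cast_id]
    congr 1
    ext k
    rw [Finset.mem_coe, Finset.mem_filter, Finset.mem_range]
    rfl
  rw [Set.ncard_eq_toFinset_card' S, Finset.card_eq_sum_card_fiberwise (f := a)
    (t := Finset.range s) (fun x hx => by simpa using hlt x (by simpa using hx))]
  refine Finset.sum_le_sum fun i _ => le_trans (le_of_eq ?_) (hpow i)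
  congr 1
  ext x
  simp

end Combinatorics

section Tight

variable {V : Type} {G : SimpleGraph V}

/-- Removing a connected set `P` from a connected set `H`: the component `X` of `v` and its
complement in `H`, which are both connected. -/
theorem Linked.split_of_linked {H P : Set V} (hH : Linked G H) (hP : Linked G P) (hPH : P ⊆ H)
    (hne : P.Nonempty) {v : V} (hv : v ∈ H) (hvP : v ∉ P) :
    ∃ X ⊆ H \ P, v ∈ X ∧ Linked G X ∧ Linked G (H \ X) ∧
      ∀ x ∈ X, ∀ y ∈ H, y ∉ P → G.Adj x y → y ∈ X := by
  obtain ⟨X, hXS, hvX, hXL, hX⟩ := exists_linked_closed (G := G) (S := H \ P) ⟨hv, hvP⟩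
  refine ⟨X, hXS, hvX, hXL, ?_, fun x hx y hy hyP e => hX x hx y ⟨hy, hyP⟩ e⟩
  obtain ⟨u, hu⟩ := hne
  refine linked_of_mem_of_closed (a := u) ⟨hPH hu, fun h => (hXS h).2 hu⟩
    fun Z hZ huZ hcl b hb => ?_
  have hPX : ∀ x ∈ P, x ∈ H \ X := fun x hx => ⟨hPH hx, fun h => (hXS h).2 hx⟩
  have hPZ : ∀ x ∈ P, x ∈ Z := fun x hx => hP.mem_of_closed hu hx huZ
    fun x _ hxZ y hy e => hcl x hxZ y (hPX y hy) e
  by_contra hbZ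
  have : u ∈ (H \ X) \ Z := by
    refine hH.mem_of_closed (X := (H \ X) \ Z) hb.1 (hPH hu) ⟨hb, hbZ⟩ fun x hx hxZ y hy e => ?_
    exact ⟨⟨hy, fun hyX => hxZ.2 (hPZ x (by_contra fun hxP => hxZ.1.2
      (hX y hyX x ⟨hx, hxP⟩ e.symm)))⟩, fun hyZ => hxZ.2 (hcl y hyZ x hxZ.1 e.symm)⟩
  exact this.2 huZ

/-- `H` is a connected set to which all vertices of the stable set `Y` attach, and no proper
connected subset of `H` has this property. -/
structure Tight (G : SimpleGraph V) (Y H : Set V) : Prop where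
  stable : StableSet G Y
  notMem : ∀ y ∈ Y, y ∉ H
  linked : Linked G H
  exists_adj : ∀ y ∈ Y, ∃ x ∈ H, G.Adj y x
  exists_not_adj : ∀ X ⊆ H, X ≠ H → Linked G X → ∃ y ∈ Y, ∀ x ∈ X, ¬ G.Adj y x

theorem exists_tight [Finite V] {Y D : Set V} (hY : StableSet G Y) (hYD : ∀ y ∈ Y, y ∉ D)
    (hD : Linked G D) (hadj : ∀ y ∈ Y, ∃ x ∈ D, G.Adj y x) : ∃ H ⊆ D, Tight G Y H := by
  have hex : ∃ k, ∃ H ⊆ D, Linked G H ∧ (∀ y ∈ Y, ∃ x ∈ H, G.Adj y x) ∧ H.ncard = k :=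
    ⟨_, D, Subset.rfl, hD, hadj, rfl⟩
  classical
  obtain ⟨H, hHD, hH, hHadj, hcard⟩ := Nat.find_spec hex
  refine ⟨H, hHD, hY, fun y hy h => hYD y hy (hHD h), hH, hHadj, fun X hXH hne hX => ?_⟩
  by_contra! hcon
  refine Nat.find_min hex (m := X.ncard) ?_ ⟨X, hXH.trans hHD, hX, hcon, rfl⟩
  rw [← hcard]
  exact Set.ncard_lt_ncard (hXH.ssubset_of_ne hne) (Set.toFinite _)

/-- The graph contains a side on `N` vertices of `Y`. -/
def HasSide (G : SimpleGraph V) (D Y : Set V) (N : ℕ) : Prop :=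
  ∃ (y : ℕ → V) (n : ℕ) (P w : ℕ → V) (B : ℕ → Set V) (l r : ℕ → ℕ),
    (∀ i < N, y i ∈ Y) ∧ Side G D N y n P w B l r

theorem HasSide.mono {D D' Y : Set V} {N : ℕ} (h : HasSide G D Y N) (hD : D ⊆ D') :
    HasSide G D' Y N := by
  obtain ⟨y, n, P, w, B, l, r, hy, h⟩ := h
  exact ⟨y, n, P, w, B, l, r, hy, { h with
    path_mem := fun k hk => hD (h.path_mem k hk)
    sub := fun i hi => (h.sub i hi).trans (insert_subset_insert hD) }⟩

/-- A side from connected sets `C i`, containing `y i` and pairwise far apart, where the vertices of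
`C i` with a neighbor on the path are adjacent to `P (j i)` and no other vertex of the path. -/
theorem hasSide_of_single {D Y : Set V} {N n : ℕ} {P : ℕ → V} (hP : IndPath G n P)
    (hPD : ∀ k ≤ n, P k ∈ D) {y c : ℕ → V} {C : ℕ → Set V} {j : ℕ → ℕ} (hy : ∀ i < N, y i ∈ Y)
    (hyC : ∀ i < N, y i ∈ C i) (hcC : ∀ i < N, c i ∈ C i) (hC : ∀ i < N, Linked G (C i))
    (hCD : ∀ i < N, C i ⊆ insert (y i) D) (hc : ∀ i < N, G.Adj (c i) (P (j i)))
    (hyP : ∀ i < N, y i ≠ P (j i)) (hj : ∀ i < N, j i ≤ n)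
    (hCP : ∀ i < N, ∀ x ∈ C i, ∀ k ≤ n, k ≠ j i → x ≠ P k ∧ (x ≠ P (j i) → ¬ G.Adj x (P k)))
    (hap : ∀ i k, i < k → k < N → Apart G (C i) (C k))
    (hmono : ∀ i k, i < k → k < N → j i ≤ j k) :
    HasSide G D Y N := by
  have key : ∀ i, ∃ B w, i < N → B ⊆ C i ∧ w ∈ B ∧ y i ∈ B ∧ Linked G B ∧ G.Adj w (P (j i)) ∧
      (∀ x ∈ B, G.Adj x (P (j i)) → x = w) ∧ ∀ x ∈ B, x ≠ P (j i) := by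
    intro i
    by_cases hi : i < N
    · obtain ⟨B, hB, w, hw, hyB, hBL, hpw, huniq, hlast⟩ := (hC i hi).first_hit (hyC i hi)
        (hcC i hi) (fun x => G.Adj x (P (j i))) (hc i hi)
      refine ⟨B, w, fun _ => ⟨hB, hw, hyB, hBL, hpw, huniq, fun x hx h => ?_⟩⟩
      rcases hlast x hx with h1 | ⟨x', -, h2, h3⟩
      · exact hyP i hi (h1.symm.trans h)
      · exact h2 (h ▸ h3)
    · exact ⟨∅, P 0, fun h => absurd h hi⟩
  choose B w hBw using key
  refine ⟨y, n, P, w, B, j, j, hy, hP, hPD, fun i hi => (hBw i hi).2.2.1,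
    fun i hi => (hBw i hi).2.2.2.1, fun i hi => (hBw i hi).1.trans (hCD i hi),
    fun i hi => (hBw i hi).2.1, ?_, ?_, fun i hi => (hBw i hi).2.2.2.2.1,
    fun i hi => (hBw i hi).2.2.2.2.1, fun _ _ => le_rfl, hj,
    fun i k hik hk => (hap i k hik hk).mono (hBw i (hik.trans hk)).1 (hBw k hk).1, ?_⟩
  · intro i hi x hx k hk
    by_cases h : k = j i
    · rw [h]; exact (hBw i hi).2.2.2.2.2.2 x hx
    · exact (hCP i hi x ((hBw i hi).1 hx) k hk h).1
  · intro i hi x hx k hk e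
    by_cases h : k = j i
    · subst h
      exact ⟨(hBw i hi).2.2.2.2.2.1 x hx e, le_rfl, le_rfl⟩
    · exact absurd e ((hCP i hi x ((hBw i hi).1 hx) k hk h).2 ((hBw i hi).2.2.2.2.2.2 x hx))
  · intro i k hik hk
    have := hmono i k hik hk
    omega

namespace Tight

variable {Y H : Set V}

theorem exists_legs (h : Tight G Y H) {N : ℕ} {u : ℕ → V} {X : ℕ → Set V}
    (hu : ∀ i < N, u i ∈ H) (huX : ∀ i < N, u i ∉ X i) (hXH : ∀ i < N, X i ⊆ H)
    (hX : ∀ i < N, Linked G (X i)) (hHX : ∀ i < N, Linked G (H \ X i))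
    (hcl : ∀ i < N, ∀ x ∈ X i, ∀ y ∈ H, y ≠ u i → G.Adj x y → y ∈ X i)
    (huu : ∀ i < N, ∀ j < N, i ≠ j → u j ∈ X i ∧ ¬ G.Adj (u i) (u j)) :
    ∃ y : ℕ → V, (∀ i < N, y i ∈ Y ∧ (∀ x ∈ X i, ¬ G.Adj (y i) x) ∧
      Linked G (insert (y i) (H \ X i))) ∧
      ∀ i < N, ∀ j < N, i ≠ j → Apart G (insert (y i) (H \ X i)) (insert (y j) (H \ X j)) := by
  have hy : ∀ i, ∃ y, i < N → y ∈ Y ∧ ∀ x ∈ X i, ¬ G.Adj y x := by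
    intro i
    by_cases hi : i < N
    · obtain ⟨y, hy⟩ := h.exists_not_adj (X i) (hXH i hi) (fun e => huX i hi (e ▸ hu i hi))
        (hX i hi)
      exact ⟨y, fun _ => hy⟩
    · exact ⟨u i, fun h => absurd h hi⟩
  choose y hy using hy
  have hsub : ∀ i < N, ∀ j < N, i ≠ j → H \ X i ⊆ X j := by
    intro i hi j hj hij b hb
    refine (hHX i hi).mem_of_closed ⟨hu i hi, huX i hi⟩ hb (huu j hj i hi hij.symm).1 ?_
    intro x _ hxX z hz e
    exact hcl j hj x hxX z hz.1 (fun hzu => hz.2 (hzu ▸ (huu i hi j hj hij).1)) e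
  have hyx : ∀ i < N, ∀ j < N, i ≠ j → ∀ x ∈ H \ X j, y i ≠ x ∧ ¬ G.Adj (y i) x := by
    intro i hi j hj hij x hx
    refine ⟨fun e => h.notMem _ (hy i hi).1 (e ▸ hx.1), (hy i hi).2 x ?_⟩
    exact hsub j hj i hi hij.symm hx
  refine ⟨y, fun i hi => ⟨(hy i hi).1, (hy i hi).2, ?_⟩, ?_⟩
  · obtain ⟨x, hx, e⟩ := h.exists_adj _ (hy i hi).1
    exact (hHX i hi).insert_adj ⟨hx, fun hxX => (hy i hi).2 x hxX e⟩ e.symm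
  · rintro i hi j hj hij a (rfl | ha) b (rfl | hb)
    · have hne : y i ≠ y j := by
        intro e
        obtain ⟨x, hx, e'⟩ := h.exists_adj _ (hy i hi).1
        have : x ∉ X i := fun hxX => (hy i hi).2 x hxX e'
        exact (hy j hj).2 x (hsub i hi j hj hij ⟨hx, this⟩) (e ▸ e')
      exact ⟨hne, h.stable _ (hy i hi).1 _ (hy j hj).1 hne⟩
    · exact hyx i hi j hj hij b hb
    · have := hyx j hj i hi hij.symm a ha
      exact ⟨this.1.symm, fun e => this.2 e.symm⟩
    · refine ⟨fun e => hb.2 (e ▸ hsub i hi j hj hij ha), fun e => ?_⟩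
      have h1 : b = u j := by_contra fun hbu =>
        hb.2 (hcl j hj a (hsub i hi j hj hij ha) b hb.1 hbu e)
      have h2 : a = u i := by_contra fun hau =>
        ha.2 (hcl i hi b (hsub j hj i hi hij.symm hb) a ha.1 hau e.symm)
      exact (huu i hi j hj hij).2 (h2 ▸ h1 ▸ e)

theorem hasSide_of_many_adj (h : Tight G Y H) {N : ℕ} {v : V} (hv : v ∈ H) {y : ℕ → V}
    (hy : ∀ i < N, y i ∈ Y ∧ G.Adj (y i) v) (hinj : ∀ i j, i < N → j < N → y i = y j → i = j) :
    HasSide G H Y N := by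
  refine hasSide_of_single (indPath_zero fun _ => v) (fun _ _ => hv) (y := y) (c := y)
    (C := fun i => {y i}) (j := fun _ => 0) (fun i hi => (hy i hi).1) (fun _ _ => rfl)
    (fun _ _ => rfl) (fun _ _ => linked_singleton _) (fun i _ => by simp)
    (fun i hi => (hy i hi).2) (fun i hi => (hy i hi).2.ne) (fun _ _ => le_rfl)
    (fun i hi x hx k hk hk' => absurd (Nat.le_zero.1 hk) hk') ?_ (fun _ _ _ _ => le_rfl)
  rintro i k hik hk a rfl b rfl
  have hne : y i ≠ y k := fun e => by
    have := hinj i k (by omega) hk e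
    omega
  exact ⟨hne, h.stable _ (hy i (by omega)).1 _ (hy k hk).1 hne⟩

theorem hasSide_of_stable_nbrs (h : Tight G Y H) {N : ℕ} {v : V} (hv : v ∈ H) {u : ℕ → V}
    (hu : ∀ i < N, u i ∈ H ∧ G.Adj (u i) v) (hinj : ∀ i j, i < N → j < N → u i = u j → i = j)
    (hstable : ∀ i < N, ∀ j < N, i ≠ j → ¬ G.Adj (u i) (u j)) :
    HasSide G H Y N := by
  have key : ∀ i, ∃ X, i < N → X ⊆ H ∧ v ∈ X ∧ u i ∉ X ∧ Linked G X ∧ Linked G (H \ X) ∧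
      ∀ x ∈ X, ∀ y ∈ H, y ≠ u i → G.Adj x y → y ∈ X := by
    intro i
    by_cases hi : i < N
    · obtain ⟨X, hX⟩ := h.linked.split (hu i hi).1 hv (hu i hi).2.ne
      exact ⟨X, fun _ => hX⟩
    · exact ⟨∅, fun h => absurd h hi⟩
  choose X hX using key
  obtain ⟨y, hy, hap⟩ := h.exists_legs (fun i hi => (hu i hi).1) (fun i hi => (hX i hi).2.2.1)
    (fun i hi => (hX i hi).1) (fun i hi => (hX i hi).2.2.2.1)
    (fun i hi => (hX i hi).2.2.2.2.1) (fun i hi => (hX i hi).2.2.2.2.2) (by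
      intro i hi j hj hij
      refine ⟨(hX i hi).2.2.2.2.2 v (hX i hi).2.1 _ (hu j hj).1 (fun e => ?_) (hu j hj).2.symm,
        hstable i hi j hj hij⟩
      exact hij (hinj _ _ hj hi e).symm)
  refine hasSide_of_single (indPath_zero fun _ => v) (fun _ _ => hv) (y := y) (c := u)
    (C := fun i => insert (y i) (H \ X i)) (j := fun _ => 0) (fun i hi => (hy i hi).1)
    (fun _ _ => mem_insert _ _) (fun i hi => Or.inr ⟨(hu i hi).1, (hX i hi).2.2.1⟩)
    (fun i hi => (hy i hi).2.2) (fun i _ => insert_subset_insert sdiff_subset)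
    (fun i hi => (hu i hi).2) (fun i hi e => h.notMem _ (hy i hi).1 (e ▸ hv))
    (fun _ _ => le_rfl) (fun i hi x hx k hk hk' => absurd (Nat.le_zero.1 hk) hk')
    (fun i k hik hk => hap i (by omega) k hk (by omega)) (fun _ _ _ _ => le_rfl)

end Tight

end Tight

section Tree

variable {V : Type} {G : SimpleGraph V}

theorem hasTheta_of_apart {a b : V} (hne : a ≠ b) (hab : ¬ G.Adj a b) {Z₁ Z₂ Z₃ : Set V}
    (h₁ : Linked G Z₁) (h₂ : Linked G Z₂) (h₃ : Linked G Z₃)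
    (ha₁ : ∃ x ∈ Z₁, G.Adj a x) (ha₂ : ∃ x ∈ Z₂, G.Adj a x) (ha₃ : ∃ x ∈ Z₃, G.Adj a x)
    (hb₁ : ∃ x ∈ Z₁, G.Adj b x) (hb₂ : ∃ x ∈ Z₂, G.Adj b x) (hb₃ : ∃ x ∈ Z₃, G.Adj b x)
    (h₁₂ : Apart G Z₁ Z₂) (h₁₃ : Apart G Z₁ Z₃) (h₂₃ : Apart G Z₂ Z₃) : HasTheta G := by
  have key : ∀ Z : Set V, Linked G Z → (∃ x ∈ Z, G.Adj a x) → (∃ x ∈ Z, G.Adj b x) →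
      Linked G (insert a (insert b Z)) := by
    rintro Z hZ ⟨x, hx, hax⟩ ⟨y, hy, hby⟩
    exact (hZ.insert_adj hy hby.symm).insert_adj (mem_insert_of_mem _ hx) hax.symm
  have hsub : ∀ Z : Set V, insert a (insert b Z) \ {a, b} ⊆ Z := by
    rintro Z x ⟨rfl | rfl | hx, hx'⟩
    · simp at hx'
    · simp at hx'
    · exact hx
  exact hasTheta_of_linked hne hab (key Z₁ h₁ ha₁ hb₁) (key Z₂ h₂ ha₂ hb₂) (key Z₃ h₃ ha₃ hb₃)
    (by simp) (by simp) (by simp) (by simp) (by simp) (by simp) (h₁₂.mono (hsub _) (hsub _))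
    (h₁₃.mono (hsub _) (hsub _)) (h₂₃.mono (hsub _) (hsub _))

/-- A breadth-first search tree of a connected set: `δ` is the distance to the root `ρ` and `π`
is the parent function. -/
theorem Linked.exists_tree {H : Set V} (hH : Linked G H) {ρ : V} (hρ : ρ ∈ H) :
    ∃ (δ : V → ℕ) (π : V → V), δ ρ = 0 ∧
      (∀ x ∈ H, x ≠ ρ → π x ∈ H ∧ G.Adj (π x) x ∧ δ (π x) + 1 = δ x) ∧
      ∀ x ∈ H, ∀ y ∈ H, G.Adj x y → δ y ≤ δ x + 1 := by
  classical
  let W : ℕ → V → Prop := fun n => Nat.rec (fun x => x = ρ)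
    (fun _ Q x => x ∈ H ∧ ∃ y, Q y ∧ G.Adj y x) n
  have hW : ∀ k x, W (k + 1) x ↔ x ∈ H ∧ ∃ y, W k y ∧ G.Adj y x := fun _ _ => Iff.rfl
  have hWH : ∀ k x, W k x → x ∈ H := by
    rintro (_ | k) x hx
    · exact (show x = ρ from hx) ▸ hρ
    · exact hx.1
  have hex : ∀ x ∈ H, ∃ k, W k x := by
    intro x hx
    refine hH.mem_of_closed (X := {x | ∃ k, W k x}) hρ hx ⟨0, rfl⟩ ?_
    rintro x - ⟨k, hk⟩ y hy e
    exact ⟨k + 1, hy, x, hk, e⟩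
  have hδ : ∀ x, ∃ k, x ∈ H → W k x ∧ ∀ j, W j x → k ≤ j := by
    intro x
    by_cases hx : x ∈ H
    · obtain ⟨k, hk, hmin⟩ := wellFounded_lt.has_min {k : ℕ | W k x} (hex x hx)
      exact ⟨k, fun _ => ⟨hk, fun j hj => not_lt.1 (hmin j hj)⟩⟩
    · exact ⟨0, fun h => absurd h hx⟩
  choose δ hδ using hδ
  have hlip : ∀ x ∈ H, ∀ y ∈ H, G.Adj x y → δ y ≤ δ x + 1 :=
    fun x hx y hy e => (hδ y hy).2 _ ⟨hy, x, (hδ x hx).1, e⟩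
  have hπ : ∀ x, ∃ y, x ∈ H → x ≠ ρ → y ∈ H ∧ G.Adj y x ∧ δ y + 1 = δ x := by
    intro x
    by_cases hx : x ∈ H
    · rcases hk : δ x with _ | k
      · refine ⟨x, fun _ hxρ => absurd ?_ hxρ⟩
        have := (hδ x hx).1
        rw [hk] at this
        exact this
      · have h1 := (hδ x hx).1
        rw [hk] at h1
        obtain ⟨-, y, hy, e⟩ := h1
        refine ⟨y, fun _ _ => ⟨hWH _ _ hy, e, ?_⟩⟩
        have h2 := (hδ y (hWH _ _ hy)).2 _ hy
        have h3 := hlip y (hWH _ _ hy) x hx e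
        omega
    · exact ⟨x, fun h => absurd h hx⟩
  choose π hπ using hπ
  refine ⟨δ, π, ?_, hπ, hlip⟩
  have := (hδ ρ hρ).2 0 rfl
  omega

namespace Tight

variable {Y H : Set V} {N n : ℕ} {P : ℕ → V}

/-- Vertices of `Y` attached to a path of `H`. -/
theorem hasSide_of_nbrs_on_path (h : Tight G Y H) (hP : IndPath G n P) (hPH : ∀ k ≤ n, P k ∈ H)
    {D : Set V} (hD : Linked G D) (hHD : Apart G H D) (hYD : ∀ y ∈ Y, ∃ x ∈ D, G.Adj y x)
    (htheta : ¬ HasTheta G) {c : ℕ} (hc : ∀ v ∈ H, ∀ T : Finset V, (∀ y ∈ T, y ∈ Y ∧ G.Adj y v) →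
      T.card ≤ c) (T : Finset V) (hTY : ∀ y ∈ T, y ∈ Y) (hTP : ∀ y ∈ T, ∃ k ≤ n, G.Adj y (P k))
    (hne : T.Nonempty) (hT : (c + 1) * N ≤ T.card) : HasSide G H Y N := by
  classical
  have key : ∀ y, ∃ l r, y ∈ T → l ≤ r ∧ r ≤ n ∧ G.Adj y (P l) ∧ G.Adj y (P r) ∧
      ∀ k ≤ n, G.Adj y (P k) → l ≤ k ∧ k ≤ r := by
    intro y
    by_cases hy : y ∈ T
    · obtain ⟨k, hk, e⟩ := hTP y hy
      have hmem : ∀ k, k ∈ (Finset.range (n + 1)).filter (fun k => G.Adj y (P k)) ↔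
          k ≤ n ∧ G.Adj y (P k) := by simp
      have hne' : ((Finset.range (n + 1)).filter fun k => G.Adj y (P k)).Nonempty :=
        ⟨k, (hmem k).2 ⟨hk, e⟩⟩
      have h1 := (hmem _).1 (Finset.min'_mem _ hne')
      have h2 := (hmem _).1 (Finset.max'_mem _ hne')
      exact ⟨_, _, fun _ => ⟨Finset.min'_le_max' _ hne', h2.1, h1.2, h2.2, fun k hk e =>
        ⟨Finset.min'_le _ _ ((hmem k).2 ⟨hk, e⟩), Finset.le_max' _ _ ((hmem k).2 ⟨hk, e⟩)⟩⟩⟩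
    · exact ⟨0, 0, fun h => absurd h hy⟩
  choose l r hlr using key
  obtain ⟨e, he, hdis⟩ := exists_disjoint_intervals l r (c + 1) N T (fun y hy => (hlr y hy).1) (by
    intro k T' hT' hk
    have h1 := Finset.card_filter_add_card_filter_not (s := T') fun y => G.Adj y (P k)
    by_cases hkn : k ≤ n
    swap
    · rw [Finset.card_eq_zero.2 (Finset.eq_empty_of_forall_notMem fun y hy => ?_)]
      · omega
      · have h2 := hk y hy
        have h3 := (hlr y (hT' hy)).2.1
        omega
    have h2 : (T'.filter fun y => G.Adj y (P k)).card ≤ c := hc _ (hPH k hkn) _ fun y hy =>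
      ⟨hTY y (hT' (Finset.mem_filter.1 hy).1), (Finset.mem_filter.1 hy).2⟩
    have h3 : (T'.filter fun y => ¬ G.Adj y (P k)).card ≤ 1 := by
      rw [Finset.card_le_one]
      intro a ha b hb
      obtain ⟨ha, hak⟩ := Finset.mem_filter.1 ha
      obtain ⟨hb, hbk⟩ := Finset.mem_filter.1 hb
      by_contra hab
      have side : ∀ y ∈ T', ¬ G.Adj y (P k) → l y < k ∧ k < r y := by
        intro y hy hyk
        have h4 := hk y hy
        have h5 := hlr y (hT' hy)
        refine ⟨lt_of_le_of_ne h4.1 ?_, lt_of_le_of_ne h4.2 ?_⟩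
        · intro h6; exact hyk (h6 ▸ h5.2.2.1)
        · intro h6; exact hyk (h6 ▸ h5.2.2.2.1)
      have ha' := side a ha hak
      have hb' := side b hb hbk
      have hla := hlr a (hT' ha)
      have hlb := hlr b (hT' hb)
      refine htheta (hasTheta_of_apart hab
        (h.stable a (hTY a (hT' ha)) b (hTY b (hT' hb)) hab)
        (hP.linked (Nat.zero_le (k - 1)) (by omega)) (hP.linked (i := k + 1) (j := n) (by omega)
          le_rfl) hD ⟨_, ⟨l a, by omega, by omega, rfl⟩, hla.2.2.1⟩
        ⟨_, ⟨r a, by omega, by omega, rfl⟩, hla.2.2.2.1⟩ (hYD a (hTY a (hT' ha)))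
        ⟨_, ⟨l b, by omega, by omega, rfl⟩, hlb.2.2.1⟩
        ⟨_, ⟨r b, by omega, by omega, rfl⟩, hlb.2.2.2.1⟩ (hYD b (hTY b (hT' hb))) ?_ ?_ ?_)
      · rintro _ ⟨i, -, hi, rfl⟩ _ ⟨j, hj, hjn, rfl⟩
        refine ⟨fun e => ?_, fun e => ?_⟩
        · have := hP.inj _ _ (by omega) (by omega) e
          omega
        · have := (hP.adj _ _ (by omega) (by omega)).1 e
          omega
      · rintro _ ⟨i, -, hi, rfl⟩ b hb
        exact hHD _ (hPH i (by omega)) b hb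
      · rintro _ ⟨i, -, hi, rfl⟩ b hb
        exact hHD _ (hPH i (by omega)) b hb
    omega) hne hT
  have hne' : ∀ i j, i < j → j < N → e i ≠ e j := by
    intro i j hij hj h1
    have h2 := hdis i j hij hj
    have h3 := (hlr _ (he j hj)).1
    rw [h1] at h2
    omega
  refine ⟨e, n, P, e, fun i => {e i}, fun i => l (e i), fun i => r (e i),
    fun i hi => hTY _ (he i hi), hP, hPH, fun _ _ => rfl, fun _ _ => linked_singleton _,
    fun i _ => by simp, fun _ _ => rfl, ?_, ?_, fun i hi => (hlr _ (he i hi)).2.2.1,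
    fun i hi => (hlr _ (he i hi)).2.2.2.1, fun i hi => (hlr _ (he i hi)).1,
    fun i hi => (hlr _ (he i hi)).2.1, ?_, fun i j hij hj => Or.inl (hdis i j hij hj)⟩
  · rintro i hi x rfl k hk e'
    exact h.notMem _ (hTY _ (he i hi)) (e' ▸ hPH k hk)
  · rintro i hi x rfl k hk e'
    exact ⟨rfl, (hlr _ (he i hi)).2.2.2.2 k hk e'⟩
  · rintro i j hij hj a rfl b rfl
    exact ⟨hne' i j hij hj, h.stable _ (hTY _ (he i (by omega))) _ (hTY _ (he j hj))
      (hne' i j hij hj)⟩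

/-- A connected set attached to two distant vertices of a path of `H`. -/
theorem hasSide_of_bypass (h : Tight G Y H) (hP : IndPath G n P) (hPH : ∀ k ≤ n, P k ∈ H)
    {K : Set V} (hK : Linked G K) (hKH : K ⊆ H) (hKP : ∀ x ∈ K, ∀ k ≤ n, x ≠ P k) {a b : ℕ}
    (hab : a + 2 * N ≤ b) (hb : b ≤ n) {ca cb : V} (hca : ca ∈ K) (hcb : cb ∈ K)
    (ea : G.Adj ca (P a)) (eb : G.Adj cb (P b)) : HasSide G H Y N := by
  have key : ∀ i, ∃ X, i < N → X ⊆ H ∧ P a ∈ X ∧ P (a + 1 + 2 * i) ∉ X ∧ Linked G X ∧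
      Linked G (H \ X) ∧ ∀ x ∈ X, ∀ y ∈ H, y ≠ P (a + 1 + 2 * i) → G.Adj x y → y ∈ X := by
    intro i
    by_cases hi : i < N
    · obtain ⟨X, hX⟩ := h.linked.split (hPH (a + 1 + 2 * i) (by omega)) (hPH a (by omega))
        (fun e => by have := hP.inj _ _ (by omega) (by omega) e; omega)
      exact ⟨X, fun _ => hX⟩
    · exact ⟨∅, fun h => absurd h hi⟩
  choose X hX using key
  have hall : ∀ i < N, ∀ k ≤ n, k ≠ a + 1 + 2 * i → P k ∈ X i := by
    intro i hi k hk hki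
    obtain ⟨-, haX, -, -, -, hcl⟩ := hX i hi
    have hPne : ∀ k ≤ n, k ≠ a + 1 + 2 * i → P k ≠ P (a + 1 + 2 * i) :=
      fun k hk hki e => hki (hP.inj _ _ hk (by omega) e)
    rcases lt_or_gt_of_ne hki with hlt | hgt
    · refine (hP.linked (i := 0) (j := a + 2 * i) (by omega) (by omega)).mem_of_closed
        ⟨a, by omega, by omega, rfl⟩ ⟨k, by omega, by omega, rfl⟩ haX ?_
      rintro x - hx _ ⟨j, -, hj, rfl⟩ e
      exact hcl x hx _ (hPH j (by omega)) (hPne j (by omega) (by omega)) e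
    · have h1 : ca ∈ X i := hcl _ haX ca (hKH hca) (hKP ca hca _ (by omega)) ea.symm
      have h2 : cb ∈ X i := hK.mem_of_closed hca hcb h1 fun x _ hx y hy e =>
        hcl x hx y (hKH hy) (hKP y hy _ (by omega)) e
      have h3 : P b ∈ X i := hcl _ h2 _ (hPH b hb) (hPne b hb (by omega)) eb
      refine (hP.linked (i := a + 2 + 2 * i) (j := n) (by omega) le_rfl).mem_of_closed
        ⟨b, by omega, by omega, rfl⟩ ⟨k, by omega, by omega, rfl⟩ h3 ?_
      rintro x - hx _ ⟨j, hj, hjn, rfl⟩ e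
      exact hcl x hx _ (hPH j (by omega)) (hPne j (by omega) (by omega)) e
  obtain ⟨y, hy, hap⟩ := h.exists_legs (u := fun i => P (a + 1 + 2 * i)) (X := X)
    (fun i hi => hPH _ (by omega)) (fun i hi => (hX i hi).2.2.1)
    (fun i hi => (hX i hi).1) (fun i hi => (hX i hi).2.2.2.1)
    (fun i hi => (hX i hi).2.2.2.2.1) (fun i hi => (hX i hi).2.2.2.2.2) (by
      intro i hi j hj hij
      refine ⟨hall i hi _ (by omega) (by omega), fun e => ?_⟩
      have := (hP.adj _ _ (by omega) (by omega)).1 e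
      omega)
  have hnot : ∀ i < N, ∀ x ∈ insert (y i) (H \ X i), ∀ z ∈ X i, x ≠ P (a + 1 + 2 * i) →
      ¬ G.Adj x z := by
    rintro i hi x (rfl | hx) z hz hxP e
    · exact (hy i hi).2.1 z hz e
    · exact hx.2 ((hX i hi).2.2.2.2.2 z hz x hx.1 hxP e.symm)
  have hc : ∀ i, ∃ c, i < N → c ∈ insert (y i) (H \ X i) ∧ G.Adj c (P (a + 1 + 2 * i)) := by
    intro i
    by_cases hi : i < N
    · by_contra! hcon
      have hmem : P (a + 1 + 2 * i) ∈ insert (y i) (H \ X i) :=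
        Or.inr ⟨hPH _ (by omega), (hX i hi).2.2.1⟩
      have : P (a + 1 + 2 * i) ∈ ({y i}ᶜ : Set V) := fun e =>
        h.notMem _ (hy i hi).1 (e ▸ hPH _ (by omega))
      have h2 : y i ∈ ({P (a + 1 + 2 * i)} : Set V) := by
        refine (hy i hi).2.2.mem_of_closed hmem (mem_insert _ _) rfl ?_
        rintro x - rfl z hz e
        exact absurd e.symm ((hcon z).2 hz)
      exact this h2.symm
    · exact ⟨P a, fun h => absurd h hi⟩
  choose c hc using hc
  refine hasSide_of_single hP hPH (y := y) (c := c) (C := fun i => insert (y i) (H \ X i))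
    (j := fun i => a + 1 + 2 * i) (fun i hi => (hy i hi).1)
    (fun _ _ => mem_insert _ _) (fun i hi => (hc i hi).1)
    (fun i hi => (hy i hi).2.2) (fun i _ => insert_subset_insert sdiff_subset)
    (fun i hi => (hc i hi).2)
    (fun i hi e => h.notMem _ (hy i hi).1 (e ▸ hPH (a + 1 + 2 * i) (by omega)))
    (fun i hi => by omega) ?_
    (fun i k hik hk => hap i (by omega) k hk (by omega)) (fun i k _ _ => by omega)
  intro i hi x hx k hk hki
  refine ⟨?_, hnot i hi x hx _ (hall i hi k hk hki)⟩
  rintro rfl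
  rcases hx with hx | hx
  · exact h.notMem _ (hy i hi).1 (hx ▸ hPH k hk)
  · exact hx.2 (hall i hi k hk hki)

end Tight

end Tree

section OneSide

variable {V : Type} {G : SimpleGraph V}

/-- Disjoint connected sets attached to a shortest path of `H` whose complements in `H` are
connected. -/
theorem Tight.hasSide_of_components [Finite V] {Y H : Set V} (h : Tight G Y H) {N n : ℕ} {P : ℕ → V}
    (hP : IndPath G n P) (hPH : ∀ k ≤ n, P k ∈ H) {δ : V → ℕ} (hPδ : ∀ k ≤ n, δ (P k) = k)
    (hδ : ∀ x ∈ H, ∀ y ∈ H, G.Adj x y → δ y ≤ δ x + 1) {d : ℕ}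
    (hd : ∀ v ∈ H, {x | x ∈ H ∧ G.Adj x v}.ncard ≤ d) (T : Finset ℕ) {c : ℕ → V} {K : ℕ → Set V}
    (hTn : ∀ k ∈ T, k ≤ n) (hKH : ∀ k ∈ T, K k ⊆ H) (hKP : ∀ k ∈ T, ∀ x ∈ K k, ∀ j ≤ n, x ≠ P j)
    (hcl : ∀ k ∈ T, ∀ x ∈ K k, ∀ y ∈ H, (∀ j ≤ n, y ≠ P j) → G.Adj x y → y ∈ K k)
    (hK : ∀ k ∈ T, Linked G (K k)) (hHK : ∀ k ∈ T, Linked G (H \ K k)) (hc : ∀ k ∈ T, c k ∈ K k)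
    (hcP : ∀ k ∈ T, G.Adj (c k) (P k))
    (hdis : ∀ k ∈ T, ∀ k' ∈ T, k ≠ k' → Disjoint (K k) (K k'))
    (hne : T.Nonempty) (hT : d * 3 * N ≤ T.card) : HasSide G H Y N := by
  classical
  have key : ∀ k, ∃ y B w l r, k ∈ T → y ∈ Y ∧ y ∈ B ∧ Linked G B ∧ B ⊆ insert y (K k) ∧ w ∈ B ∧
      w ∈ K k ∧ (∀ x ∈ H \ K k, ¬ G.Adj y x) ∧
      (∀ x ∈ B, ∀ j ≤ n, G.Adj x (P j) → x = w ∧ l ≤ j ∧ j ≤ r) ∧ G.Adj w (P l) ∧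
      G.Adj w (P r) ∧ l ≤ r ∧ r ≤ n ∧ r ≤ l + 2 := by
    intro k
    by_cases hk : k ∈ T
    · obtain ⟨y, hy, hyK⟩ := h.exists_not_adj (H \ K k) sdiff_subset
        (fun e => ((e.symm ▸ hKH k hk (hc k hk) : c k ∈ H \ K k)).2 (hc k hk)) (hHK k hk)
      obtain ⟨x, hx, hyx⟩ := h.exists_adj y hy
      have hxK : x ∈ K k := by_contra fun hxK => hyK x ⟨hx, hxK⟩ hyx
      have hyP : ∀ j ≤ n, ¬ G.Adj y (P j) := fun j hj =>
        hyK _ ⟨hPH j hj, fun hjK => hKP k hk _ hjK j hj rfl⟩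
      obtain ⟨B, hB, w, hw, hyB, hBL, ⟨j, hj, hwj⟩, huniq, -⟩ :=
        ((hK k hk).insert_adj hxK hyx.symm).first_hit (mem_insert _ _)
        (mem_insert_of_mem _ (hc k hk)) (fun x => ∃ j ≤ n, G.Adj x (P j))
        ⟨k, hTn k hk, hcP k hk⟩
      have hwK : w ∈ K k := by
        rcases hB hw with rfl | hw
        · exact absurd hwj (hyP j hj)
        · exact hw
      have hmem : ∀ k, k ∈ (Finset.range (n + 1)).filter (fun k => G.Adj w (P k)) ↔
          k ≤ n ∧ G.Adj w (P k) := by simp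
      have hne' : ((Finset.range (n + 1)).filter fun k => G.Adj w (P k)).Nonempty :=
        ⟨j, (hmem j).2 ⟨hj, hwj⟩⟩
      have h1 := (hmem _).1 (Finset.min'_mem _ hne')
      have h2 := (hmem _).1 (Finset.max'_mem _ hne')
      refine ⟨y, B, w, _, _, fun _ => ⟨hy, hyB, hBL, hB, hw, hwK, hyK, ?_, h1.2, h2.2,
        Finset.min'_le_max' _ hne', h2.1, ?_⟩⟩
      · intro x hx i hi e
        obtain rfl := huniq x hx ⟨i, hi, e⟩
        exact ⟨rfl, Finset.min'_le _ _ ((hmem i).2 ⟨hi, e⟩),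
          Finset.le_max' _ _ ((hmem i).2 ⟨hi, e⟩)⟩
      · have h3 := hδ _ (hPH _ h1.1) w (hKH k hk hwK) h1.2.symm
        have h4 := hδ w (hKH k hk hwK) _ (hPH _ h2.1) h2.2
        rw [hPδ _ h1.1] at h3
        rw [hPδ _ h2.1] at h4
        omega
    · exact ⟨P 0, ∅, P 0, 0, 0, fun h => absurd h hk⟩
  choose y B w l r hyB using key
  have hwinj : ∀ k ∈ T, ∀ k' ∈ T, w k = w k' → k = k' := by
    intro k hk k' hk' e
    by_contra hkk
    obtain ⟨-, -, -, -, -, h1, -⟩ := hyB k hk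
    obtain ⟨-, -, -, -, -, h2, -⟩ := hyB k' hk'
    exact Set.disjoint_left.1 (hdis k hk k' hk' hkk) h1 (e ▸ h2)
  obtain ⟨e, he, hord⟩ := exists_disjoint_intervals l r (d * 3) N T (fun k hk => by
    obtain ⟨-, -, -, -, -, -, -, -, -, -, h1, -⟩ := hyB k hk
    exact h1) (by
    intro j T' hT' hj
    refine (Finset.card_le_mul_card_image_of_maps_to (t := Finset.Icc (j - 2) j) (f := l) ?_ d
      ?_).trans (Nat.mul_le_mul_left d ?_)
    · intro k hk
      obtain ⟨-, -, -, -, -, -, -, -, -, -, h1, h2, h3⟩ := hyB k (hT' hk)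
      have := hj k hk
      rw [Finset.mem_Icc]
      omega
    · intro b hb
      rcases (T'.filter fun k => l k = b).eq_empty_or_nonempty with h0 | ⟨k₀, hk₀⟩
      · rw [h0]; simp
      obtain ⟨hk₀, hb₀⟩ := Finset.mem_filter.1 hk₀
      obtain ⟨-, -, -, -, -, -, -, -, -, -, h1, h2, h3⟩ := hyB k₀ (hT' hk₀)
      refine le_trans ?_ (hd (P b) (hPH b (by omega)))
      rw [← Set.ncard_coe_finset]
      refine Set.ncard_le_ncard_of_injOn w ?_ ?_ (Set.toFinite _)
      · intro k hk
        obtain ⟨hk, hkb⟩ := Finset.mem_filter.1 (Finset.mem_coe.1 hk)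
        obtain ⟨-, -, -, -, -, h4, -, -, h5, -⟩ := hyB k (hT' hk)
        exact ⟨hKH k (hT' hk) h4, hkb ▸ h5⟩
      · intro k hk k' hk' e
        exact hwinj k (hT' (Finset.mem_filter.1 (Finset.mem_coe.1 hk)).1) k'
          (hT' (Finset.mem_filter.1 (Finset.mem_coe.1 hk')).1) e
    · rw [Nat.card_Icc]
      omega) hne hT
  have hene : ∀ i j, i < j → j < N → e i ≠ e j := by
    intro i j hij hj h1
    have h2 := hord i j hij hj
    obtain ⟨-, -, -, -, -, -, -, -, -, -, h3, -⟩ := hyB _ (he j hj)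
    rw [h1] at h2
    omega
  have hyne : ∀ k ∈ T, ∀ x ∈ H, y k ≠ x := fun k hk x hx e =>
    h.notMem _ (hyB k hk).1 (e ▸ hx)
  have hyadj : ∀ k ∈ T, ∀ k' ∈ T, k ≠ k' → ∀ x ∈ K k', y k ≠ x ∧ ¬ G.Adj (y k) x := by
    intro k hk k' hk' hkk x hx
    refine ⟨hyne k hk x (hKH k' hk' hx), ?_⟩
    obtain ⟨-, -, -, -, -, -, h1, -⟩ := hyB k hk
    exact h1 x ⟨hKH k' hk' hx, fun hxk => Set.disjoint_left.1 (hdis k hk k' hk' hkk) hxk hx⟩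
  refine ⟨fun i => y (e i), n, P, fun i => w (e i), fun i => B (e i), fun i => l (e i),
    fun i => r (e i), fun i hi => (hyB _ (he i hi)).1, hP, hPH, fun i hi => (hyB _ (he i hi)).2.1,
    fun i hi => (hyB _ (he i hi)).2.2.1, ?_, fun i hi => (hyB _ (he i hi)).2.2.2.2.1, ?_,
    fun i hi => (hyB _ (he i hi)).2.2.2.2.2.2.2.1,
    fun i hi => (hyB _ (he i hi)).2.2.2.2.2.2.2.2.1,
    fun i hi => (hyB _ (he i hi)).2.2.2.2.2.2.2.2.2.1,
    fun i hi => (hyB _ (he i hi)).2.2.2.2.2.2.2.2.2.2.1,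
    fun i hi => (hyB _ (he i hi)).2.2.2.2.2.2.2.2.2.2.2.1, ?_,
    fun i j hij hj => Or.inl (hord i j hij hj)⟩
  · intro i hi
    exact (hyB _ (he i hi)).2.2.2.1.trans (insert_subset_insert (hKH _ (he i hi)))
  · intro i hi x hx k hk
    rcases (hyB _ (he i hi)).2.2.2.1 hx with rfl | hx
    · exact hyne _ (he i hi) _ (hPH k hk)
    · exact hKP _ (he i hi) x hx k hk
  · intro i j hij hj
    have hi := he i (hij.trans hj)
    have hj' := he j hj
    have hij' := hene i j hij hj
    refine Apart.mono ?_ (hyB _ hi).2.2.2.1 (hyB _ hj').2.2.2.1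
    rintro a (rfl | ha) b (rfl | hb)
    · have hne : y (e i) ≠ y (e j) := by
        intro h0
        obtain ⟨x, hx, hyx⟩ := h.exists_adj _ (hyB _ hi).1
        obtain ⟨-, -, -, -, -, -, h1, -⟩ := hyB _ hi
        have hxK : x ∈ K (e i) := by_contra fun hxK => h1 x ⟨hx, hxK⟩ hyx
        exact (hyadj _ hj' _ hi hij'.symm x hxK).2 (h0 ▸ hyx)
      exact ⟨hne, h.stable _ (hyB _ hi).1 _ (hyB _ hj').1 hne⟩
    · exact hyadj _ hi _ hj' hij' b hb
    · have := hyadj _ hj' _ hi hij'.symm a ha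
      exact ⟨this.1.symm, fun e => this.2 e.symm⟩
    · refine ⟨fun e => ?_, fun hab => ?_⟩
      · subst e
        exact Set.disjoint_left.1 (hdis _ hi _ hj' hij') ha hb
      · exact Set.disjoint_left.1 (hdis _ hi _ hj' hij')
          (hcl _ hi a ha b (hKH _ hj' hb) (hKP _ hj' b hb) hab) hb

/-- A large stable set attached to two connected sets far apart yields a large side in each of
them. -/
theorem exists_hasSide (t N : ℕ) : ∃ M : ℕ, ∀ (V : Type) [Fintype V] (G : SimpleGraph V),
    G.CliqueFree t → ¬ HasTheta G → ∀ D D' Y : Set V, Linked G D → Linked G D' → Apart G D D' →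
    StableSet G Y → (∀ y ∈ Y, y ∉ D) → (∀ y ∈ Y, ∃ x ∈ D, G.Adj y x) →
    (∀ y ∈ Y, ∃ x ∈ D', G.Adj y x) → M ≤ Y.ncard → HasSide G D Y N := by
  obtain ⟨d, hd⟩ := exists_clique_or_stable t N
  obtain ⟨b, hb⟩ := exists_clique_or_stable (2 * N + 2) (d * 3 * N + 1)
  set s := ((N + 1) * N + 1) + b + 1 with hs
  refine ⟨N * (∑ i ∈ Finset.range s, d ^ i + 1) + 1, ?_⟩
  intro V _ G hGt htheta D D' Y hD hD' hDD hY hYD hYadj hYadj' hM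
  classical
  obtain ⟨H, hHD, h⟩ := exists_tight hY hYD hD hYadj
  refine HasSide.mono ?_ hHD
  by_contra hno
  have hfew : ∀ v ∈ H, ∀ T : Finset V, (∀ y ∈ T, y ∈ Y ∧ G.Adj y v) → T.card ≤ N := by
    intro v hv T hT
    by_contra! hcard
    obtain ⟨e, he, hinj⟩ := T.exists_enum hcard.le (Finset.card_pos.1 (by omega))
    exact hno (h.hasSide_of_many_adj hv (fun i _ => hT _ (he i)) hinj)
  have hdeg : ∀ v ∈ H, {x | x ∈ H ∧ G.Adj x v}.ncard ≤ d := by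
    intro v hv
    by_contra! hcard
    rw [Set.ncard_eq_toFinset_card'] at hcard
    rcases hd V G _ hcard.le with ⟨T, -, hT⟩ | ⟨T, hT, hTN, hst⟩
    · exact hGt T hT
    rcases T.eq_empty_or_nonempty with rfl | hne
    · obtain rfl : N = 0 := by simpa using hTN.symm
      exact hno (h.hasSide_of_many_adj hv (y := fun _ => v) (by omega) (by omega))
    obtain ⟨e, he, hinj⟩ := T.exists_enum hTN.ge hne
    refine hno (h.hasSide_of_stable_nbrs hv (u := e) (fun i _ => by simpa using hT (he i)) hinj
      fun i hi j hj hij => hst _ (he i) _ (he j) fun e' => hij (hinj i j hi hj e'))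
  have hα : ∀ y, ∃ x, y ∈ Y → x ∈ H ∧ G.Adj y x := by
    intro y
    by_cases hy : y ∈ Y
    · obtain ⟨x, hx⟩ := h.exists_adj y hy
      exact ⟨x, fun _ => hx⟩
    · exact ⟨y, fun h => absurd h hy⟩
  choose α hα using hα
  have hYne : Y.Nonempty := Set.nonempty_of_ncard_ne_zero (by omega)
  obtain ⟨y₀, hy₀⟩ := hYne
  set ρ := α y₀ with hρdef
  have hρ : ρ ∈ H := (hα y₀ hy₀).1
  obtain ⟨δ, π, hδρ, hπ, hlip⟩ := h.linked.exists_tree hρ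
  set Q : V → Prop := fun x => ∃ c ∈ H, ∃ c' ∈ H, c ≠ ρ ∧ c' ≠ ρ ∧ π c = x ∧ π c' = x ∧ c ≠ c'
    with hQ
  set S : Set V := {x | x ∈ H ∧ (x = ρ ∨ x ∈ α '' Y ∨ Q x)} with hS
  have hcardS : ∑ i ∈ Finset.range s, d ^ i < S.ncard := by
    have h1 : (α '' Y).ncard ≤ S.ncard := Set.ncard_le_ncard (by
      rintro _ ⟨y, hy, rfl⟩
      exact ⟨(hα y hy).1, Or.inr (Or.inl ⟨y, hy, rfl⟩)⟩) (Set.toFinite _)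
    have h2 : Y.toFinset.card ≤ N * (Y.toFinset.image α).card := by
      refine Finset.card_le_mul_card_image_of_maps_to
        (fun x hx => Finset.mem_coe.2 (Finset.mem_image_of_mem α hx)) N ?_
      intro v hv
      obtain ⟨y, hy, rfl⟩ := Finset.mem_image.1 hv
      refine hfew _ (hα y (by simpa using hy)).1 _ ?_
      intro z hz
      rw [Finset.mem_filter, Set.mem_toFinset] at hz
      exact ⟨hz.1, hz.2 ▸ (hα z hz.1).2⟩
    have h3 : (Y.toFinset.image α).card = (α '' Y).ncard := by
      rw [← Set.ncard_coe_finset]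
      simp
    rw [← Set.ncard_eq_toFinset_card', h3] at h2
    have h4 : ∑ i ∈ Finset.range s, d ^ i + 1 ≤ (α '' Y).ncard := by
      by_contra! hlt
      have := Nat.mul_le_mul_left N hlt.le
      omega
    omega
  obtain ⟨x, hxS, hx⟩ := exists_many_ancestors H S ρ δ π hρ
    (fun x hx hxρ => ⟨(hπ x hx hxρ).1, (hπ x hx hxρ).2.2⟩) hδρ (fun x hx => hx.1)
    ⟨hρ, Or.inl rfl⟩ (by
      intro c hc c' hc' hcρ hcρ' hcc hcS
      by_contra hne
      exact hcS ⟨(hπ c hc hcρ).1, Or.inr (Or.inr ⟨c, hc, c', hc', hcρ, hcρ', rfl, hcc.symm,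
        hne⟩)⟩) d (by
      intro x hx
      refine le_trans (Set.ncard_le_ncard ?_ (Set.toFinite _)) (hdeg x hx)
      rintro c ⟨hc, hcρ, rfl⟩
      exact ⟨hc, (hπ c hc hcρ).2.1.symm⟩) s hcardS
  have hiter : ∀ k ≤ δ x, π^[k] x ∈ H ∧ δ (π^[k] x) = δ x - k := by
    intro k hk
    induction k with
    | zero => exact ⟨hxS.1, rfl⟩
    | succ k ih =>
      obtain ⟨ih1, ih2⟩ := ih (by omega)
      have hne : π^[k] x ≠ ρ := by
        intro e
        rw [e, hδρ] at ih2
        omega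
      have := hπ _ ih1 hne
      rw [Function.iterate_succ_apply']
      exact ⟨this.1, by omega⟩
  set n := δ x with hn
  set P : ℕ → V := fun k => π^[n - k] x with hPdef
  have hPH : ∀ k ≤ n, P k ∈ H := fun k _ => (hiter (n - k) (by omega)).1
  have hPδ : ∀ k ≤ n, δ (P k) = k := fun k hk => by
    rw [hPdef, (hiter (n - k) (by omega)).2]; omega
  have hPne : ∀ k ≤ n, 0 < k → P k ≠ ρ := by
    intro k hk hk0 e
    have := hPδ k hk
    rw [e, hδρ] at this
    omega
  have hPπ : ∀ k < n, π (P (k + 1)) = P k := by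
    intro k hk
    simp only [hPdef]
    rw [show n - k = (n - (k + 1)) + 1 by omega, Function.iterate_succ_apply']
  have hP : IndPath G n P := by
    refine ⟨fun i j hi hj e => by rw [← hPδ i hi, ← hPδ j hj, e], fun i j hi hj => ⟨?_, ?_⟩⟩
    · intro e
      have h1 := hlip _ (hPH i hi) _ (hPH j hj) e
      have h2 := hlip _ (hPH j hj) _ (hPH i hi) e.symm
      rw [hPδ i hi, hPδ j hj] at h1 h2
      have h3 : i ≠ j := fun h3 => e.ne (h3 ▸ rfl)
      omega
    · rintro (rfl | rfl)
      · rw [← hPπ j (by omega)]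
        exact (hπ _ (hPH _ hi) (hPne _ hi (by omega))).2.1.symm
      · rw [← hPπ i (by omega)]
        exact (hπ _ (hPH _ hj) (hPne _ hj (by omega))).2.1
  have hI : s ≤ ((Finset.range n).filter fun k => P k ∈ S).card := by
    refine hx.trans ?_
    rw [← Set.ncard_coe_finset]
    refine Set.ncard_le_ncard_of_injOn (fun k => n - 1 - k) ?_ ?_ (Set.toFinite _)
    · rintro k ⟨hk, hkS⟩
      simp only [Finset.coe_filter, Finset.mem_range, mem_ofPred_eq, hPdef]
      exact ⟨by omega, by rwa [show n - (n - 1 - k) = k + 1 by omega]⟩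
    · rintro k ⟨hk, -⟩ k' ⟨hk', -⟩ e
      dsimp only at e
      omega
  set I₁ := (Finset.range n).filter fun k => P k ∈ α '' Y with hI₁
  set I₂ := (Finset.range n).filter fun k => Q (P k) with hI₂
  have hIsub : ((Finset.range n).filter fun k => P k ∈ S) ⊆ {0} ∪ (I₁ ∪ I₂) := by
    intro k hk
    rw [Finset.mem_filter, Finset.mem_range] at hk
    simp only [Finset.mem_union, Finset.mem_singleton, hI₁, hI₂, Finset.mem_filter,
      Finset.mem_range]
    rcases hk.2.2 with h1 | h1 | h1
    · refine Or.inl (by_contra fun h2 => hPne k hk.1.le (by omega) h1)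
    · exact Or.inr (Or.inl ⟨hk.1, h1⟩)
    · exact Or.inr (Or.inr ⟨hk.1, h1⟩)
  have hIcard : s ≤ 1 + (I₁.card + I₂.card) := by
    refine hI.trans ((Finset.card_le_card hIsub).trans ((Finset.card_union_le _ _).trans ?_))
    have := Finset.card_union_le I₁ I₂
    rw [Finset.card_singleton]
    omega
  rcases le_or_gt ((N + 1) * N + 1) I₁.card with h₁ | h₁
  · set T := Y.toFinset.filter fun y => ∃ k ≤ n, G.Adj y (P k) with hT
    have hTmem : ∀ y, y ∈ T ↔ y ∈ Y ∧ ∃ k ≤ n, G.Adj y (P k) := by simp [hT]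
    have hTcard : I₁.card ≤ T.card := by
      have hsub : I₁.image P ⊆ T.image α := by
        intro v hv
        obtain ⟨k, hk, rfl⟩ := Finset.mem_image.1 hv
        rw [hI₁, Finset.mem_filter, Finset.mem_range] at hk
        obtain ⟨hk, y, hy, e⟩ := hk
        exact Finset.mem_image.2 ⟨y, (hTmem y).2 ⟨hy, k, hk.le, e ▸ (hα y hy).2⟩, e⟩
      rw [← Finset.card_image_of_injOn (s := I₁) (f := P)]
      · exact (Finset.card_le_card hsub).trans Finset.card_image_le
      · intro k hk k' hk' e
        simp only [hI₁, Finset.coe_filter, Finset.mem_range, mem_ofPred_eq] at hk hk'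
        exact hP.inj k k' hk.1.le hk'.1.le e
    exact hno (h.hasSide_of_nbrs_on_path hP hPH hD' (hDD.mono hHD Subset.rfl) hYadj' htheta hfew T
      (fun y hy => ((hTmem y).1 hy).1) (fun y hy => ((hTmem y).1 hy).2)
      (Finset.card_pos.1 (by omega)) (by omega))
  · have key : ∀ k, ∃ c X, k ∈ I₂ → c ∈ X ∧ G.Adj c (P k) ∧ X ⊆ H ∧
        (∀ x ∈ X, ∀ j ≤ n, x ≠ P j) ∧ Linked G X ∧ Linked G (H \ X) ∧
        ∀ x ∈ X, ∀ y ∈ H, (∀ j ≤ n, y ≠ P j) → G.Adj x y → y ∈ X := by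
      intro k
      by_cases hk : k ∈ I₂
      · have hk' := hk
        rw [hI₂, Finset.mem_filter, Finset.mem_range] at hk'
        obtain ⟨hkn, c, hc, c', hc', hcρ, hcρ', e, e', hcc⟩ := hk'
        have : ∃ c ∈ H, c ≠ ρ ∧ π c = P k ∧ c ≠ P (k + 1) := by
          by_cases h1 : c = P (k + 1)
          · exact ⟨c', hc', hcρ', e', fun h2 => hcc (h1.trans h2.symm)⟩
          · exact ⟨c, hc, hcρ, e, h1⟩
        obtain ⟨c, hc, hcρ, e, hck⟩ := this
        have hcP : ∀ j ≤ n, c ≠ P j := by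
          rintro j hj rfl
          have h1 := (hπ _ hc hcρ).2.2
          rw [e, hPδ k hkn.le, hPδ j hj] at h1
          exact hck (h1 ▸ rfl)
        obtain ⟨X, hX, hcX, hXL, hHX, hcl⟩ := h.linked.split_of_linked
          (hP.linked (Nat.zero_le n) le_rfl) (by rintro _ ⟨j, -, hj, rfl⟩; exact hPH j hj)
          ⟨P 0, 0, le_rfl, Nat.zero_le _, rfl⟩ hc
          (by rintro ⟨j, -, hj, e⟩; exact hcP j hj e.symm)
        refine ⟨c, X, fun _ => ⟨hcX, e ▸ (hπ c hc hcρ).2.1.symm, fun x hx => (hX hx).1, ?_, hXL,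
          hHX, ?_⟩⟩
        · rintro x hx j hj rfl
          exact (hX hx).2 ⟨j, Nat.zero_le _, hj, rfl⟩
        · intro x hx y hy hyP
          exact hcl x hx y hy (by rintro ⟨j, -, hj, e⟩; exact hyP j hj e.symm)
      · exact ⟨x, ∅, fun h => absurd h hk⟩
    choose c K hcK using key
    have hlt : ∀ k ∈ I₂, k ≤ n := fun k hk => by
      rw [hI₂, Finset.mem_filter, Finset.mem_range] at hk
      exact hk.1.le
    rcases hb ℕ (SimpleGraph.fromRel fun k k' => c k' ∈ K k) I₂ (by omega) with
      ⟨T, hT, hTc⟩ | ⟨T, hT, hTcard, hTs⟩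
    · obtain ⟨e, he, hmono⟩ := T.exists_increasing_enum hTc.card_eq.ge
      have hgrow : ∀ i ≤ 2 * N, e 0 + i ≤ e i := by
        intro i hi
        induction i with
        | zero => rfl
        | succ i ih =>
          have := hmono i (i + 1) (by omega) (by omega)
          have := ih (by omega)
          omega
      have h0 := hmono (2 * N) (2 * N + 1) (by omega) (by omega)
      have h1 := hgrow (2 * N) le_rfl
      have ha := hcK _ (hT (he 0 (by omega)))
      have hb := hcK _ (hT (he (2 * N + 1) (by omega)))
      have hbn := hlt _ (hT (he (2 * N + 1) (by omega)))
      have hadj := hTc.isClique (he 0 (by omega)) (he (2 * N + 1) (by omega)) (by omega)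
      rw [SimpleGraph.fromRel_adj] at hadj
      rcases hadj.2 with h2 | h2
      · exact hno (h.hasSide_of_bypass hP hPH ha.2.2.2.2.1 ha.2.2.1 ha.2.2.2.1 (by omega) hbn
          ha.1 h2 ha.2.1 hb.2.1)
      · exact hno (h.hasSide_of_bypass hP hPH hb.2.2.2.2.1 hb.2.2.1 hb.2.2.2.1 (by omega) hbn
          h2 hb.1 ha.2.1 hb.2.1)
    · have hmem := fun k hk => hcK k (hT hk)
      refine hno (h.hasSide_of_components hP hPH hPδ hlip hdeg T (c := c) (K := K)
        (fun k hk => hlt k (hT hk)) (fun k hk => (hmem k hk).2.2.1)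
        (fun k hk => (hmem k hk).2.2.2.1) (fun k hk => (hmem k hk).2.2.2.2.2.2)
        (fun k hk => (hmem k hk).2.2.2.2.1) (fun k hk => (hmem k hk).2.2.2.2.2.1)
        (fun k hk => (hmem k hk).1) (fun k hk => (hmem k hk).2.1) ?_
        (Finset.card_pos.1 (by omega)) (by omega))
      intro k hk k' hk' hkk
      rw [Set.disjoint_left]
      intro z hz hz'
      refine hTs k hk k' hk' hkk ((SimpleGraph.fromRel_adj _ _ _).2 ⟨hkk, Or.inl ?_⟩)
      refine (hmem k' hk').2.2.2.2.1.mem_of_closed hz' (hmem k' hk').1 hz ?_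
      intro a _ haK b hb e
      exact (hmem k hk).2.2.2.2.2.2 a haK b ((hmem k' hk').2.2.1 hb)
        ((hmem k' hk').2.2.2.1 b hb) e

end OneSide

section Separator

variable {V : Type} {G : SimpleGraph V} {S A X : Set V} {a b : V}

theorem SameComp.mem_of_closed (h : SameComp G S a b) (ha : a ∈ X)
    (hX : ∀ x ∈ X, ∀ y ∈ S, G.Adj x y → y ∈ X) : b ∈ X := by
  obtain ⟨hu, hv, ⟨W⟩⟩ := h
  have key : ∀ {x y : S}, (G.induce S).Walk x y → (x : V) ∈ X → (y : V) ∈ X := by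
    intro x y W
    induction W with
    | nil => exact id
    | cons h _ ih => exact fun hx => ih (hX _ hx _ (Subtype.property _) (by simpa using h))
  exact key W ha

theorem SameComp.symm (h : SameComp G S a b) : SameComp G S b a := by
  obtain ⟨hu, hv, h⟩ := h
  exact ⟨hv, hu, h.symm⟩

theorem Linked.sameComp (hA : Linked G A) (hAS : A ⊆ S) (ha : a ∈ A) (hb : b ∈ A) :
    SameComp G S a b := by
  refine hA.mem_of_closed (X := {x | SameComp G S a x}) ha hb
    ⟨hAS ha, hAS ha, SimpleGraph.Reachable.refl _⟩ ?_
  rintro x hx ⟨hu, hv, hax⟩ y hy hxy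
  refine ⟨hu, hAS hy, hax.trans (SimpleGraph.Adj.reachable ?_)⟩
  simpa using hxy

theorem exists_adj_of_separator {D : Set V} {u v s : V}
    (hmin : ∀ Y ⊂ S, SameComp G (univ \ Y) u v) (hu : u ∈ D) (hv : v ∉ D)
    (hD : ∀ x ∈ D, ∀ y ∈ univ \ S, G.Adj x y → y ∈ D) (hs : s ∈ S) : ∃ x ∈ D, G.Adj s x := by
  by_contra! hno
  refine hv ((hmin (S \ {s}) ⟨sdiff_subset, fun h => (h hs).2 rfl⟩).mem_of_closed hu ?_)
  intro x hx y hy hxy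
  by_cases hys : y = s
  · subst hys
    exact absurd hxy.symm (hno x hx)
  · exact hD x hx y ⟨mem_univ y, fun h => hy.2 ⟨h, hys⟩⟩ hxy

/-- A minimal separator has two full components. -/
theorem IsMinimalSeparator.exists_sides (h : IsMinimalSeparator G S) :
    ∃ D D' : Set V, Linked G D ∧ Linked G D' ∧ Apart G D D' ∧
      ∀ s ∈ S, s ∉ D ∧ s ∉ D' ∧ (∃ x ∈ D, G.Adj s x) ∧ ∃ x ∈ D', G.Adj s x := by
  obtain ⟨u, v, hu, hv, hsep, hmin⟩ := h
  obtain ⟨D, hDS, huD, hD, hDc⟩ :=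
    exists_linked_closed (G := G) (show u ∈ univ \ S from ⟨mem_univ u, hu⟩)
  obtain ⟨D', hDS', hvD, hD', hDc'⟩ :=
    exists_linked_closed (G := G) (show v ∈ univ \ S from ⟨mem_univ v, hv⟩)
  have hdisj : ∀ x ∈ D, x ∉ D' := by
    intro x hx hx'
    have := hD.union hD' hx hx'
    exact hsep (this.sameComp (union_subset hDS hDS') (Or.inl huD) (Or.inr hvD))
  refine ⟨D, D', hD, hD', ?_, fun s hs => ⟨fun h => (hDS h).2 hs, fun h => (hDS' h).2 hs,
    exists_adj_of_separator hmin huD (fun h => hdisj v h hvD) hDc hs,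
    exists_adj_of_separator (fun Y hY => (hmin Y hY).symm) hvD (hdisj u huD) hDc' hs⟩⟩
  intro x hx y hy
  exact ⟨fun e => hdisj x hx (e ▸ hy), fun e => hdisj y (hDc x hx y (hDS' hy) e) hy⟩

end Separator

section Assembly

variable {V : Type} {G : SimpleGraph V}

theorem Attach.union {n l r : ℕ} {p : ℕ → V} {C C' : Set V} {w : V} (h : Attach G n p C w l r)
    (h' : ∀ x ∈ C', x ∈ C ∨ ∀ k ≤ n, x ≠ p k ∧ ¬ G.Adj x (p k)) :
    Attach G n p (C ∪ C') w l r where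
  mem := Or.inl h.mem
  ne := by
    rintro x (hx | hx) i hi
    · exact h.ne x hx i hi
    · exact (h' x hx).elim (fun hx => h.ne x hx i hi) fun hx => (hx i hi).1
  nbr := by
    rintro x (hx | hx) i hi e
    · exact h.nbr x hx i hi e
    · exact (h' x hx).elim (fun hx => h.nbr x hx i hi e) fun hx => absurd e (hx i hi).2
  adj_left := h.adj_left
  adj_right := h.adj_right
  le := h.le
  pos := h.pos
  lt := h.lt

theorem HolePair.containsGenPyramid_of_card {n m t : ℕ} {p q : ℕ → V} (h : HolePair G n p m q)
    {S : Finset ℕ} (hS : t ≤ S.card) {C : ℕ → Set V} {w₁ w₂ : ℕ → V} {l₁ r₁ l₂ r₂ : ℕ → ℕ}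
    (hC : ∀ i ∈ S, Linked G (C i)) (hap : ∀ i ∈ S, ∀ j ∈ S, i < j → Apart G (C i) (C j))
    (a₁ : ∀ i ∈ S, Attach G n p (C i) (w₁ i) (l₁ i) (r₁ i))
    (a₂ : ∀ i ∈ S, Attach G m q (C i) (w₂ i) (l₂ i) (r₂ i))
    (o₁ : ∀ i ∈ S, ∀ j ∈ S, i < j → r₁ i < l₁ j ∨ (l₁ i = r₁ i ∧ r₁ i = l₁ j ∧ l₁ j = r₁ j))
    (o₂ : ∀ i ∈ S, ∀ j ∈ S, i < j → r₂ i < l₂ j ∨ (l₂ i = r₂ i ∧ r₂ i = l₂ j ∧ l₂ j = r₂ j))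
    (hr : ∀ i ∈ S, r₁ i = l₁ i + 1)
    (hcase : (∀ i ∈ S, l₂ i = r₂ i) ∨ ∀ i ∈ S, l₂ i + 2 ≤ r₂ i ∧ w₁ i ≠ w₂ i) :
    ContainsGenPyramid G t := by
  obtain ⟨e, he, hmono⟩ := S.exists_increasing_enum hS
  have hmem : ∀ i j, i < j → j < t → e i ∈ S ∧ e j ∈ S := fun i j hij hj =>
    ⟨he i (by omega), he j hj⟩
  have hC' : ∀ i < t, Linked G (C (e i)) := fun i hi => hC _ (he i hi)
  have hap' : ∀ i j, i < j → j < t → Apart G (C (e i)) (C (e j)) := fun i j hij hj =>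
    hap _ (hmem i j hij hj).1 _ (hmem i j hij hj).2 (hmono i j hij hj)
  have b₁ : ∀ i < t, Attach G n p (C (e i)) (w₁ (e i)) (l₁ (e i)) (l₁ (e i) + 1) := by
    intro i hi
    have := a₁ _ (he i hi)
    rwa [hr _ (he i hi)] at this
  have hl : ∀ i j, i < j → j < t → l₁ (e i) + 1 < l₁ (e j) := by
    intro i j hij hj
    obtain ⟨hi', hj'⟩ := hmem i j hij hj
    have := o₁ _ hi' _ hj' (hmono i j hij hj)
    have := hr _ hi'
    omega
  rcases hcase with hcase | hcase
  · refine h.containsGenPyramid (fun i => C (e i)) (fun i => w₁ (e i)) (fun i => w₂ (e i))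
      (fun i => l₁ (e i)) (fun i => l₂ (e i)) hC' hap' b₁ ?_ hl ?_
    · intro i hi
      have := a₂ _ (he i hi)
      rwa [← hcase _ (he i hi)] at this
    · intro i j hij hj
      obtain ⟨hi', hj'⟩ := hmem i j hij hj
      have := o₂ _ hi' _ hj' (hmono i j hij hj)
      have := hcase _ hi'
      omega
  · have ho : ∀ i j, i < j → j < t → r₂ (e i) < l₂ (e j) := by
      intro i j hij hj
      obtain ⟨hi', hj'⟩ := hmem i j hij hj
      have := o₂ _ hi' _ hj' (hmono i j hij hj)
      have := hcase _ hi'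
      omega
    obtain ⟨m', q', C', w, l, r, h', hall, hord⟩ := h.exists_reroute (fun i => C (e i))
      (fun i => w₁ (e i)) (fun i => w₂ (e i)) (fun i => l₁ (e i)) (fun i => l₂ (e i))
      (fun i => r₂ (e i)) hC' hap' b₁ (fun i hi => a₂ _ (he i hi)) (fun i hi => hcase _ (he i hi))
      ho le_rfl
    refine h'.containsGenPyramid C' (fun i => w₁ (e i)) w (fun i => l₁ (e i)) l
      (fun i hi => (hall i hi).2.1) ?_ (fun i hi => (hall i hi).2.2.1) ?_ hl ?_
    · exact fun i j hij hj => (hap' i j hij hj).mono (hall i (by omega)).1 (hall j hj).1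
    · intro i hi
      obtain ⟨-, -, -, c, hlr, -⟩ := hall i hi
      rwa [← hlr hi] at c
    · intro i j hij hj
      have := hord i j hij hj
      have := (hall i (by omega)).2.2.2.2.1 (by omega)
      omega

namespace Side

variable {D D' : Set V} {N n n' : ℕ} {y P P' w w' : ℕ → V} {B B' : ℕ → Set V} {l r l' r' : ℕ → ℕ}

theorem congr {y' : ℕ → V} (h : Side G D N y n P w B l r) (hy : ∀ i < N, y i = y' i) :
    Side G D N y' n P w B l r :=
  { h with
    mem := fun i hi => hy i hi ▸ h.mem i hi
    sub := fun i hi => hy i hi ▸ h.sub i hi }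

theorem apart_cross (h : Side G D N y n P w B l r) (h' : Side G D' N y n' P' w' B' l' r')
    (hD : Apart G D D') {i j : ℕ} (hi : i < N) (hj : j < N) (hij : i ≠ j) :
    Apart G (B i) (B' j) := by
  have ap : Apart G (B i) (B j) := by
    rcases lt_or_gt_of_ne hij with hij | hij
    · exact h.apart _ _ hij hj
    · exact (h.apart _ _ hij hi).symm
  have ap' : Apart G (B' i) (B' j) := by
    rcases lt_or_gt_of_ne hij with hij | hij
    · exact h'.apart _ _ hij hj
    · exact (h'.apart _ _ hij hi).symm
  intro x hx z hz
  rcases h.sub i hi hx with rfl | hxD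
  · exact ap' _ (h'.mem i hi) z hz
  rcases h'.sub j hj hz with rfl | hzD
  · exact ap x hx _ (h.mem j hj)
  · exact hD x hxD z hzD

theorem attach_union (h : Side G D N y n P w B l r) (h' : Side G D' N y n' P' w' B' l' r')
    (hD : Apart G D D') {i j k m a b : ℕ} {E : ℕ → V} {v : V} (hi : i < N) (hj : j < N)
    (hk : k < N) (hik : i ≠ k) (hjk : j ≠ k) (h0 : E 0 = y i) (hm : E m = y j)
    (hE : ∀ c, 0 < c → c < m → E c ∈ D) (att : Attach G m E (B k) v a b) :
    Attach G m E (B k ∪ B' k) v a b := by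
  refine att.union fun x hx => ?_
  rcases h'.sub k hk hx with rfl | hxD
  · exact Or.inl (h.mem k hk)
  refine Or.inr fun c hc => ?_
  rcases Nat.eq_zero_or_pos c with rfl | hc0
  · rw [h0]
    exact (h.apart_cross h' hD hi hk hik).symm x hx _ (h.mem i hi)
  rcases hc.eq_or_lt with rfl | hcm
  · rw [hm]
    exact (h.apart_cross h' hD hj hk hjk).symm x hx _ (h.mem j hj)
  · exact hD.symm x hxD _ (hE c hc0 hcm)

/-- Two sides through the same long sequence of vertices that are not hubs yield a generalized
pyramid. -/
theorem containsGenPyramid {t : ℕ} (hG : MemC G) (hD : Apart G D D')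
    (h : Side G D (4 * t + 2) y n P w B l r) (h' : Side G D' (4 * t + 2) y n' P' w' B' l' r')
    (hy : ∀ i < 4 * t + 2, y i ∉ D ∧ y i ∉ D' ∧ ¬ IsHub G (y i)) :
    ContainsGenPyramid G t := by
  obtain ⟨m₁, E₁, l₁, r₁, hE₁, hm₁, s₁, f₁, i₁, a₁, o₁⟩ :=
    h.exists_path (K := 4 * t + 1) (by omega)
  obtain ⟨m₂, E₂, l₂, r₂, hE₂, hm₂, s₂, f₂, i₂, a₂, o₂⟩ :=
    h'.exists_path (K := 4 * t + 1) (by omega)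
  have hp : HolePair G m₁ E₁ m₂ E₂ := ⟨hE₁, hE₂, s₁.trans s₂.symm, f₁.trans f₂.symm, hm₁, hm₂,
    fun i j hi hi' hj hj' => hD _ (i₁ i hi hi') _ (i₂ j hj hj')⟩
  set C : ℕ → Set V := fun i => B i ∪ B' i with hCdef
  set S := Finset.Ioo 0 (4 * t + 1) with hSdef
  have hS : ∀ {i}, i ∈ S ↔ 0 < i ∧ i < 4 * t + 1 := by simp [hSdef]
  have hC : ∀ i ∈ S, Linked G (C i) := fun i hi => (h.linked i (by grind)).union
    (h'.linked i (by grind)) (h.mem i (by grind)) (h'.mem i (by grind))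
  have hap : ∀ i ∈ S, ∀ j ∈ S, i < j → Apart G (C i) (C j) := by
    intro i hi j hj hij
    rw [hS] at hi hj
    rintro x (hx | hx) z (hz | hz)
    · exact h.apart i j hij (by omega) x hx z hz
    · exact h.apart_cross h' hD (by omega) (by omega) hij.ne x hx z hz
    · exact h'.apart_cross h hD.symm (by omega) (by omega) hij.ne x hx z hz
    · exact h'.apart i j hij (by omega) x hx z hz
  have b₁ : ∀ i ∈ S, Attach G m₁ E₁ (C i) (w i) (l₁ i) (r₁ i) := by
    intro i hi
    rw [hS] at hi
    exact h.attach_union h' hD (i := 0) (j := 4 * t + 1) (by omega) (by omega) (by omega)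
      (by omega) (by omega) s₁ f₁ i₁ (a₁ i hi.1 hi.2)
  have b₂ : ∀ i ∈ S, Attach G m₂ E₂ (C i) (w' i) (l₂ i) (r₂ i) := by
    intro i hi
    rw [hS] at hi
    have := h'.attach_union h hD.symm (i := 0) (j := 4 * t + 1) (by omega) (by omega) (by omega)
      (by omega) (by omega) s₂ f₂ i₂ (a₂ i hi.1 hi.2)
    rwa [union_comm] at this
  have hub : ∀ i ∈ S, w i = w' i → ¬ IsHub G (w i) := by
    intro i hi e
    have hi' : i < 4 * t + 2 := by grind
    obtain ⟨hyD, hyD', hub⟩ := hy i hi'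
    rcases h.sub i hi' (h.w_mem i hi') with hw | hw
    · rwa [hw]
    · rcases h'.sub i hi' (h'.w_mem i hi') with hw' | hw'
      · exact absurd (e.trans hw' ▸ hw) hyD
      · exact absurd e (hD _ hw _ hw').1
  have hcases := fun i hi => hp.attach_cases hG (hC i hi) (b₁ i hi) (b₂ i hi) (hub i hi)
  have o₁' : ∀ i ∈ S, ∀ j ∈ S, i < j →
      r₁ i < l₁ j ∨ (l₁ i = r₁ i ∧ r₁ i = l₁ j ∧ l₁ j = r₁ j) :=
    fun i hi j hj hij => o₁ i j hij (hS.1 hi).1 (hS.1 hj).2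
  have o₂' : ∀ i ∈ S, ∀ j ∈ S, i < j →
      r₂ i < l₂ j ∨ (l₂ i = r₂ i ∧ r₂ i = l₂ j ∧ l₂ j = r₂ j) :=
    fun i hi j hj hij => o₂ i j hij (hS.1 hi).1 (hS.1 hj).2
  have key₁ : ∀ T ⊆ S, t ≤ T.card → (∀ i ∈ T, r₁ i = l₁ i + 1) →
      ((∀ i ∈ T, l₂ i = r₂ i) ∨ ∀ i ∈ T, l₂ i + 2 ≤ r₂ i ∧ w i ≠ w' i) →
      ContainsGenPyramid G t := fun T hT hcard hr hcase =>
    hp.containsGenPyramid_of_card hcard (fun i hi => hC i (hT hi))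
      (fun i hi j hj => hap i (hT hi) j (hT hj)) (fun i hi => b₁ i (hT hi))
      (fun i hi => b₂ i (hT hi)) (fun i hi j hj => o₁' i (hT hi) j (hT hj))
      (fun i hi j hj => o₂' i (hT hi) j (hT hj)) hr hcase
  have key₂ : ∀ T ⊆ S, t ≤ T.card → (∀ i ∈ T, r₂ i = l₂ i + 1) →
      ((∀ i ∈ T, l₁ i = r₁ i) ∨ ∀ i ∈ T, l₁ i + 2 ≤ r₁ i ∧ w' i ≠ w i) →
      ContainsGenPyramid G t := fun T hT hcard hr hcase =>
    hp.swap.containsGenPyramid_of_card hcard (fun i hi => hC i (hT hi))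
      (fun i hi j hj => hap i (hT hi) j (hT hj)) (fun i hi => b₂ i (hT hi))
      (fun i hi => b₁ i (hT hi)) (fun i hi j hj => o₂' i (hT hi) j (hT hj))
      (fun i hi j hj => o₁' i (hT hi) j (hT hj)) hr hcase
  classical
  have hcover : S ⊆ (S.filter (fun i => r₁ i = l₁ i + 1 ∧ l₂ i = r₂ i) ∪
      S.filter (fun i => r₁ i = l₁ i + 1 ∧ l₂ i + 2 ≤ r₂ i ∧ w i ≠ w' i)) ∪
      (S.filter (fun i => r₂ i = l₂ i + 1 ∧ l₁ i = r₁ i) ∪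
      S.filter (fun i => r₂ i = l₂ i + 1 ∧ l₁ i + 2 ≤ r₁ i ∧ w' i ≠ w i)) := by
    intro i hi
    have := hcases i hi
    have hc : w i ≠ w' i ↔ w' i ≠ w i := ne_comm
    simp only [Finset.mem_union, Finset.mem_filter, hi, true_and]
    tauto
  have hcard := (Finset.card_le_card hcover).trans ((Finset.card_union_le _ _).trans
    (add_le_add (Finset.card_union_le _ _) (Finset.card_union_le _ _)))
  have hScard : S.card = 4 * t := by simp [hSdef]
  rw [hScard] at hcard
  by_cases c₁ : t ≤ (S.filter (fun i => r₁ i = l₁ i + 1 ∧ l₂ i = r₂ i)).card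
  · exact key₁ _ (Finset.filter_subset _ _) c₁ (by simp +contextual) (Or.inl (by simp +contextual))
  by_cases c₂ : t ≤ (S.filter
      (fun i => r₁ i = l₁ i + 1 ∧ l₂ i + 2 ≤ r₂ i ∧ w i ≠ w' i)).card
  · exact key₁ _ (Finset.filter_subset _ _) c₂ (by simp +contextual) (Or.inr (by simp +contextual))
  by_cases c₃ : t ≤ (S.filter (fun i => r₂ i = l₂ i + 1 ∧ l₁ i = r₁ i)).card
  · exact key₂ _ (Finset.filter_subset _ _) c₃ (by simp +contextual) (Or.inl (by simp +contextual))
  have c₄ : t ≤ (S.filter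
      (fun i => r₂ i = l₂ i + 1 ∧ l₁ i + 2 ≤ r₁ i ∧ w' i ≠ w i)).card := by omega
  exact key₂ _ (Finset.filter_subset _ _) c₄ (by simp +contextual)
    (Or.inr (by simp +contextual))

end Side

end Assembly

/-- stable sets of non-hubs in minimal separators of graphs in `𝒞ₜₜ` have
bounded size. -/
theorem stmt_16 (t : ℕ) :
    ∃ τ : ℕ, ∀ (V : Type) [Fintype V] (G : SimpleGraph V),
      MemCtt t G → ∀ S : Set V, IsMinimalSeparator G S →
      ∀ Y : Set V, Y ⊆ S → (∀ y ∈ Y, ¬ IsHub G y) → StableSet G Y →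
      Y.ncard ≤ τ := by
  set N := 4 * t + 2 with hN
  obtain ⟨L, hL⟩ := exists_clique_or_stable N N
  obtain ⟨M₂, hM₂⟩ := exists_hasSide t L
  obtain ⟨M₁, hM₁⟩ := exists_hasSide t M₂
  refine ⟨M₁, fun V _ G hG S hS Y hYS hYhub hY => ?_⟩
  by_contra! hcard
  obtain ⟨⟨hC, hfree⟩, hpyr⟩ := hG
  obtain ⟨D, D', hD, hD', hDD, hfull⟩ := hS.exists_sides
  have htheta := hC.2.1
  obtain ⟨y, n, P, w, B, l, r, hyY, h⟩ := hM₁ V G hfree htheta D D' Y hD hD' hDD hY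
    (fun x hx => (hfull x (hYS hx)).1) (fun x hx => (hfull x (hYS hx)).2.2.1)
    (fun x hx => (hfull x (hYS hx)).2.2.2) hcard.le
  have hinj : ∀ i j, i < M₂ → j < M₂ → y i = y j → i = j := by
    intro i j hi hj e
    by_contra hij
    rcases lt_or_gt_of_ne hij with hij | hij
    · exact (h.apart i j hij hj _ (h.mem i hi) _ (h.mem j hj)).1 e
    · exact (h.apart j i hij hi _ (h.mem j hj) _ (h.mem i hi)).1 e.symm
  set Y₂ : Set V := y '' {i | i < M₂} with hY₂def
  have hY₂ : Y₂ ⊆ Y := by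
    rintro _ ⟨i, hi, rfl⟩
    exact hyY i hi
  have hY₂card : M₂ ≤ Y₂.ncard := by
    have hon : InjOn y {i | i < M₂} := fun i hi j hj => hinj i j hi hj
    rw [hY₂def, hon.ncard_image, show {i | i < M₂} = ((Finset.range M₂ : Finset ℕ) : Set ℕ) by
      ext; simp, ncard_coe_finset, Finset.card_range]
  obtain ⟨y', n', P', w', B', l', r', hyY', h'⟩ := hM₂ V G hfree htheta D' D Y₂ hD' hD hDD.symm
    (fun a ha b hb => hY a (hY₂ ha) b (hY₂ hb))
    (fun x hx => (hfull x (hYS (hY₂ hx))).2.1) (fun x hx => (hfull x (hYS (hY₂ hx))).2.2.2)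
    (fun x hx => (hfull x (hYS (hY₂ hx))).2.2.1) hY₂card
  choose! σ hσ using fun i (hi : i < L) => hyY' i hi
  have hσinj : ∀ i j, i < j → j < L → σ i ≠ σ j := by
    intro i j hij hj e
    refine (h'.apart i j hij hj _ (h'.mem i (by omega)) _ (h'.mem j hj)).1 ?_
    rw [← (hσ i (by omega)).2, ← (hσ j hj).2, e]
  have h'' : Side G D' L (fun i => y (σ i)) n' P' w' B' l' r' :=
    h'.congr fun i hi => (hσ i hi).2.symm
  have hgood : ∀ i < M₂, y i ∉ D ∧ y i ∉ D' ∧ ¬ IsHub G (y i) := fun i hi =>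
    ⟨(hfull _ (hYS (hyY i hi))).1, (hfull _ (hYS (hyY i hi))).2.1, hYhub _ (hyY i hi)⟩
  rcases hL ℕ (SimpleGraph.fromRel fun i j => i < j ∧ σ i < σ j) (Finset.range L) (by simp) with
    ⟨T, hT, hTc⟩ | ⟨T, hT, hTcard, hTs⟩
  · obtain ⟨e, he, hmono⟩ := T.exists_increasing_enum hTc.card_eq.ge
    have heL : ∀ i < N, e i < L := fun i hi => Finset.mem_range.1 (hT (he i hi))
    refine hpyr (Side.containsGenPyramid hC hDD
      (h.comp (e := fun i => σ (e i)) (fun i hi => (hσ _ (heL i hi)).1) ?_) (h''.comp heL hmono)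
      fun i hi => hgood _ (hσ _ (heL i hi)).1)
    intro i j hij hj
    have hlt := hmono i j hij hj
    have := hTc.isClique (he i (by omega)) (he j hj) hlt.ne
    simp only [SimpleGraph.fromRel_adj] at this
    omega
  · obtain ⟨e, he, hmono⟩ := T.exists_increasing_enum hTcard.ge
    have heL : ∀ i < N, e i < L := fun i hi => Finset.mem_range.1 (hT (he i hi))
    refine hpyr (Side.containsGenPyramid hC hDD
      (h.comp (e := fun i => σ (e (N - 1 - i))) (fun i hi => (hσ _ (heL _ (by omega))).1) ?_)
      (h''.comp heL hmono).reverse fun i hi => hgood _ (hσ _ (heL _ (by omega))).1)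
    intro i j hij hj
    have hlt := hmono (N - 1 - j) (N - 1 - i) (by omega) (by omega)
    have := hTs _ (he (N - 1 - j) (by omega)) _ (he (N - 1 - i) (by omega)) hlt.ne
    have := hσinj _ _ hlt (heL _ (by omega))
    simp only [SimpleGraph.fromRel_adj] at *
    omega
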